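/- arXiv:math/0002207 — 3 statements merged into one kernel-verified Lean document; each statement's English description precedes it below -/
import Mathlib

section
/- Let n = 4. For every 10-element subset {s_1, …, s_10} of {1, 2, 3, 5, 7, 10, 11, 13, 15, 16, 17, 23, 29, 31}, the set of 4-dimensional maximal isotropic subspaces H ⊆ ℂ^9 (for the symmetric form B(x,y) = Σ_{i=1}^{9} x_i y_{10−i}) satisfying H ∩ F_5(s_j) ≠ {0} for j = 1, …, 10 has exactly twelve elements, and all twelve are real, i.e., stable under coordinatewise complex conjugation. -/
/-- The `i`-th coordinate function of the curve `γ : ℂ → ℂ^{2n+1}`,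
`γ(s)_i = (−1)^{max(i−n−1,0)} s^{i−1}/(i−1)!` (0-indexed `i`). -/
noncomputable def gammaOC (n : ℕ) (i : Fin (2 * n + 1)) : ℂ → ℂ :=
  fun s => (-1 : ℂ) ^ ((i : ℕ) - n) * s ^ (i : ℕ) / (Nat.factorial (i : ℕ))

/-- The index pairing `i ↦ 2n+2−i` (1-indexed), i.e. `i ↦ 2n−i` (0-indexed). -/
def pairOC (n : ℕ) (i : Fin (2 * n + 1)) : Fin (2 * n + 1) :=
  ⟨2 * n - (i : ℕ), by omega⟩

/-- The symmetric bilinear form `B(x,y) = Σ_{i=1}^{2n+1} x_i y_{2n+2−i}` on `ℂ^{2n+1}`. -/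
noncomputable def formOC (n : ℕ) (x y : Fin (2 * n + 1) → ℂ) : ℂ :=
  ∑ i, x i * y (pairOC n i)

/-- The osculating subspace `F_k(s) = span{γ(s), γ'(s), …, γ^{(k-1)}(s)}`,
derivatives taken coordinatewise. -/
noncomputable def oscOC (n k : ℕ) (s : ℂ) : Submodule ℂ (Fin (2 * n + 1) → ℂ) :=
  Submodule.span ℂ (Set.range fun j : Fin k => fun i => iteratedDeriv (j : ℕ) (gammaOC n i) s)

/-- A subspace of `ℂ^N` is real if it is stable under coordinatewise complex conjugation. -/
def conjStableOC (n : ℕ) (H : Submodule ℂ (Fin (2 * n + 1) → ℂ)) : Prop :=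
  ∀ x ∈ H, (fun i => (starRingEnd ℂ) (x i)) ∈ H

/-- A formal difference `p - n` of natural numbers. -/
inductive DInt
  | mk (p n : ℕ)

namespace DInt

noncomputable def add (a b : DInt) : DInt :=
  DInt.rec (fun p n => DInt.rec (fun r s => mk (Nat.add p r) (Nat.add n s)) b) a

noncomputable def mul (a b : DInt) : DInt :=
  DInt.rec (fun p n => DInt.rec (fun r s => mk (Nat.add (Nat.mul p r) (Nat.mul n s))
    (Nat.add (Nat.mul p s) (Nat.mul n r))) b) a

noncomputable def neg (a : DInt) : DInt := DInt.rec (fun p n => mk n p) a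

noncomputable def scale (c : ℕ) (a : DInt) : DInt :=
  DInt.rec (fun p n => mk (Nat.mul c p) (Nat.mul c n)) a

noncomputable def scaleNeg (c : ℕ) (a : DInt) : DInt :=
  DInt.rec (fun p n => mk (Nat.mul c n) (Nat.mul c p)) a

noncomputable def isPos (a : DInt) : Bool := DInt.rec (fun p n => Nat.ble (Nat.succ n) p) a

noncomputable def abs (a : DInt) : ℕ :=
  DInt.rec (fun p n => Nat.add (Nat.sub p n) (Nat.sub n p)) a

noncomputable def div (g : ℕ) (a : DInt) : DInt :=
  DInt.rec (fun p n => mk (Nat.div (Nat.sub p n) g) (Nat.div (Nat.sub n p) g)) a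

noncomputable def reduce (a : DInt) : DInt :=
  DInt.rec (fun p n => mk (Nat.sub p n) (Nat.sub n p)) a

noncomputable def hd (l : List DInt) : DInt := List.rec (.mk 0 0) (fun z _ _ => z) l

noncomputable def tl (l : List DInt) : List DInt := List.rec [] (fun _ z _ => z) l

noncomputable def forceN {α : Type} (n : ℕ) (k : ℕ → α) : α :=
  Nat.rec (k 0) (fun m _ => k (Nat.succ m)) n

noncomputable def forceL {α : Type} (l : List DInt) : (List DInt → α) → α :=
  List.rec (fun k => k []) (fun z _ ih k => DInt.rec (fun p n => forceN p fun p =>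
    forceN n fun n => ih fun t => k (.mk p n :: t)) z) l

noncomputable def at' (l : List DInt) (n : ℕ) : DInt := hd (Nat.rec l (fun _ ih => tl ih) n)

noncomputable def gcdL (l : List DInt) : ℕ := List.rec 0 (fun z _ ih => Nat.gcd z.abs ih) l

noncomputable def divL (g : ℕ) (l : List DInt) : List DInt :=
  List.rec [] (fun z _ ih => .div g z :: ih) l

noncomputable def primitive (l : List DInt) : List DInt := divL (gcdL l) l

noncomputable def negL (l : List DInt) : List DInt := List.rec [] (fun z _ ih => .neg z :: ih) l

noncomputable def rev (a : List DInt) : List DInt → List DInt :=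
  List.rec (fun b => b) (fun x _ ih b => ih (x :: b)) a

noncomputable def axpy (x : DInt) (b : List DInt) : List DInt → List DInt :=
  List.rec (fun c => c) (fun y _ ih c =>
    List.rec (.mul x y :: ih []) (fun z t _ => .add (.mul x y) z :: ih t) c) b

noncomputable def pmac (a b : List DInt) : List DInt → List DInt :=
  List.rec (fun c => c) (fun x _ ih c => axpy x b (hd c :: ih (tl c))) a

noncomputable def rem (u v w : DInt) (l : List DInt) : List DInt → List DInt :=
  List.rec (fun _ => []) (fun b bs ih as =>
    .add (.add (.mul u (hd bs)) (.mul v b)) (.mul w (hd as)) :: ih (tl as)) l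

noncomputable def sturmStep (a b : List DInt) : List DInt :=
  rem (.reduce (.mul (hd a) (hd b)))
    (.reduce (.add (.mul (hd (tl a)) (hd b)) (.neg (.mul (hd a) (hd (tl b))))))
    (.reduce (.neg (.mul (hd b) (hd b)))) (tl b) (tl (tl a))

noncomputable def sturmChain (n : ℕ) : List DInt → List DInt → Bool :=
  Nat.rec (fun a b => and (hd a).isPos (hd b).isPos)
    (fun _ ih a b => and (hd a).isPos (and (hd b).isPos
      (forceL (primitive (sturmStep a b)) (ih b)))) n

noncomputable def der (l : List DInt) : ℕ → List DInt :=
  List.rec (fun _ => []) (fun a _ ih n => Nat.rec [] (fun m _ => .scale n a :: ih m) n) l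

noncomputable def monicProd (l : List DInt) : List DInt :=
  List.rec [.mk 1 0] (fun x _ ih => axpy (.neg x) ih (.mk 0 0 :: ih)) l

noncomputable def sumN (l : List ℕ) : ℕ := List.rec 0 (fun x _ ih => Nat.add x ih) l

noncomputable def center (s : ℕ) (l : List ℕ) : List DInt :=
  List.rec [] (fun x _ ih => .reduce (.mk (Nat.mul 10 x) s) :: ih) l

noncomputable def phi11 (h2 h3 h4 h5 h6 h7 h8 h9 h10 : DInt) : List DInt :=
  [(.add (.mul h2 (.add (.mul h4 (.add (.mul h2 (.add (.mul h4 (.add (.scaleNeg 30 h6) (.mul h4 (.scale 15 h2)))) (.add (.scaleNeg 30 h10) (.mul h8 (.scaleNeg 6 h2))))) (.add (.mul h9 (.scale 30 h3)) (.add (.mul h8 (.scale 10 h4)) (.mul h7 (.scale 30 h5)))))) (.add (.mul h8 (.add (.scaleNeg 2 h8) (.mul h6 (.scale 6 h2)))) (.mul h7 (.add (.scaleNeg 12 h9) (.mul h7 (.scale 6 h2))))))) (.add (.mul h8 (.add (.scaleNeg 20 h10) (.add (.mul h7 (.scale 20 h3)) (.add (.mul h6 (.scaleNeg 20 h4)) (.mul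 h5 (.scale 30 h5)))))) (.mul h9 (.add (.scale 6 h9) (.mul h5 (.scaleNeg 30 h4)))))),
   (.add (.mul h3 (.add (.mul h2 (.add (.mul h4 (.add (.scale 600 h6) (.mul h4 (.scaleNeg 450 h2)))) (.add (.scale 300 h10) (.mul h8 (.scale 60 h2))))) (.add (.mul h9 (.scaleNeg 300 h3)) (.add (.mul h8 (.scaleNeg 100 h4)) (.mul h7 (.scaleNeg 300 h5)))))) (.add (.mul h2 (.add (.mul h9 (.scaleNeg 210 h4)) (.add (.mul h8 (.scaleNeg 30 h5)) (.mul h7 (.scaleNeg 60 h6))))) (.add (.mul h10 (.scale 300 h5)) (.add (.mul h9 (.scale 60 h6)) (.mul h8 (.scaleNeg 140 h7)))))),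
   (.add (.mul h2 (.add (.mul h4 (.add (.scaleNeg 4200 h6) (.add (.mul h4 (.scale 3150 h2)) (.mul h3 (.scale 4500 h3))))) (.add (.scaleNeg 2400 h10) (.mul h8 (.scaleNeg 420 h2))))) (.add (.mul h3 (.add (.scale 4500 h9) (.mul h6 (.scaleNeg 3000 h3)))) (.add (.mul h8 (.scale 700 h4)) (.mul h7 (.scale 2100 h5))))),
   (.add (.mul h3 (.add (.scale 42000 h6) (.add (.mul h4 (.scaleNeg 63000 h2)) (.mul h3 (.scaleNeg 15000 h3))))) (.scaleNeg 16800 h9)),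
   (.add (.scaleNeg 147000 h6) (.add (.mul h4 (.scale 220500 h2)) (.mul h3 (.scale 315000 h3)))),
   (.scaleNeg 2205000 h3),
   (.mk 5145000 0)]

noncomputable def phi12 (h2 h3 h4 h5 h6 h7 h8 h9 h10 : DInt) : List DInt :=
  [(.add (.mul h2 (.add (.mul h2 (.add (.mul h4 (.add (.scale 30 h6) (.mul h4 (.scaleNeg 15 h2)))) (.add (.scale 30 h10) (.add (.mul h8 (.scale 3 h2)) (.mul h7 (.scale 30 h3)))))) (.add (.mul h9 (.scaleNeg 60 h3)) (.mul h8 (.scaleNeg 10 h4))))) (.mul h8 (.add (.scale 20 h6) (.mul h3 (.scale 100 h3))))),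
   (.add (.mul h2 (.add (.mul h3 (.add (.scaleNeg 600 h6) (.mul h4 (.scale 450 h2)))) (.add (.scale 420 h9) (.mul h7 (.scaleNeg 210 h2))))) (.mul h8 (.scaleNeg 1300 h3))),
   (.add (.mul h2 (.add (.scale 4200 h6) (.add (.mul h4 (.scaleNeg 3150 h2)) (.mul h3 (.scaleNeg 3000 h3))))) (.scale 4200 h8)),
   (.mul h3 (.scale 42000 h2)),
   (.scaleNeg 147000 h2)]

noncomputable def phi13 (h2 h3 h4 h5 h6 h7 h8 h9 h10 : DInt) : List DInt :=
  [(.add (.mul h2 (.add (.mul h7 (.add (.scaleNeg 60 h4) (.mul h2 (.scaleNeg 18 h2)))) (.add (.mul h9 (.scale 18 h2)) (.mul h8 (.scaleNeg 60 h3))))) (.add (.mul h9 (.scale 60 h4)) (.mul h8 (.scaleNeg 60 h5)))),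
   (.add (.mul h2 (.add (.mul h2 (.add (.scale 180 h6) (.mul h4 (.scaleNeg 90 h2)))) (.scale 420 h8))) (.add (.scaleNeg 600 h10) (.mul h7 (.scale 600 h3)))),
   (.add (.scaleNeg 4200 h7) (.mul h3 (.mul h2 (.scale 900 h2)))),
   (.mul h2 (.scaleNeg 6300 h2))]

noncomputable def phi22 (h2 h3 h4 h5 h6 h7 h8 h9 h10 : DInt) : List DInt :=
  [(.add (.mul h2 (.add (.mul h2 (.add (.scaleNeg 30 h6) (.add (.mul h4 (.scale 15 h2)) (.mul h3 (.scale 150 h3))))) (.add (.scale 10 h8) (.mul h5 (.scale 300 h3))))) (.add (.mul h3 (.add (.scaleNeg 100 h7) (.mul h4 (.scaleNeg 500 h3)))) (.scale 100 h10))),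
   (.add (.mul h3 (.add (.scale 7000 h4) (.mul h2 (.scaleNeg 2550 h2)))) (.add (.scale 700 h7) (.mul h5 (.scaleNeg 2100 h2)))),
   (.add (.scaleNeg 24500 h4) (.mul h2 (.scale 10500 h2)))]

noncomputable def phi23 (h2 h3 h4 h5 h6 h7 h8 h9 h10 : DInt) : List DInt :=
  [(.add (.mul h2 (.add (.mul h2 (.add (.scaleNeg 90 h5) (.mul h3 (.scaleNeg 90 h2)))) (.scale 60 h7))) (.scaleNeg 60 h9)),
   (.add (.mul h3 (.scale 3000 h3)) (.mul h2 (.mul h2 (.scale 720 h2)))),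
   (.scaleNeg 42000 h3),
   (.mk 147000 0)]

noncomputable def phi33 (h2 h3 h4 h5 h6 h7 h8 h9 h10 : DInt) : List DInt :=
  [(.add (.mul h2 (.mul h2 (.add (.scale 180 h4) (.mul h2 (.scale 54 h2))))) (.scale 120 h8)),
   (.mul h3 (.scaleNeg 3600 h2)),
   (.scale 25200 h2)]

noncomputable def negDet (p q r s t w : List DInt) : List DInt :=
  pmac p (pmac t t (pmac (negL s) w [])) (pmac q (pmac q w (pmac (negL r) t []))
    (pmac r (pmac r s (pmac (negL q) t [])) []))

noncomputable def negDetPhi (h2 h3 h4 h5 h6 h7 h8 h9 h10 : DInt) : List DInt :=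
  negDet (phi11 h2 h3 h4 h5 h6 h7 h8 h9 h10)
    (phi12 h2 h3 h4 h5 h6 h7 h8 h9 h10)
    (phi13 h2 h3 h4 h5 h6 h7 h8 h9 h10)
    (phi22 h2 h3 h4 h5 h6 h7 h8 h9 h10)
    (phi23 h2 h3 h4 h5 h6 h7 h8 h9 h10)
    (phi33 h2 h3 h4 h5 h6 h7 h8 h9 h10)

noncomputable def charList (P : List DInt) : List DInt :=
  negDetPhi (.reduce (.scaleNeg 490 (at' P 8)))
    (.reduce (.scaleNeg 15435 (at' P 7)))
    (.reduce (.scaleNeg 463050 (at' P 6)))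
    (.reduce (.scaleNeg 27011250 (at' P 5)))
    (.reduce (.scaleNeg 1701708750 (at' P 4)))
    (.reduce (.scaleNeg 178679418750 (at' P 3)))
    (.reduce (.scale 12507559312500 (at' P 2)))
    (.reduce (.scale 1313293727812500 (at' P 1)))
    (.reduce (.scale 137895841420312500 (at' P 0)))

noncomputable def cert (l : List ℕ) : Bool :=
  forceL (monicProd (center (sumN l) l)) fun P =>
    forceL (primitive (rev (charList P) [])) fun a => sturmChain 11 a (der a 12)

noncomputable def allSub (l : List ℕ) : ℕ → (List ℕ → Bool) → Bool :=
  List.rec (fun k f => Nat.rec (f []) (fun _ _ => true) k)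
    (fun x _ ih k f => Nat.rec (f []) (fun j _ => and (ih j fun t => f (x :: t)) (ih k f)) k) l

open Polynomial

/-- The integer represented by a formal difference. -/
def toInt : DInt → ℤ
  | mk p n => (p : ℤ) - n

@[simp] theorem toInt_mk (p n : ℕ) : toInt (mk p n) = (p : ℤ) - n := rfl

@[simp] theorem toInt_add (a b : DInt) : (a.add b).toInt = a.toInt + b.toInt := by
  cases a; cases b; simp [add]; ring

@[simp] theorem toInt_mul (a b : DInt) : (a.mul b).toInt = a.toInt * b.toInt := by
  cases a; cases b; simp [mul]; ring

@[simp] theorem toInt_neg (a : DInt) : a.neg.toInt = -a.toInt := by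
  cases a; simp [neg]

@[simp] theorem toInt_scale (c : ℕ) (a : DInt) : (scale c a).toInt = c * a.toInt := by
  cases a; simp [scale]; ring

@[simp] theorem toInt_scaleNeg (c : ℕ) (a : DInt) : (scaleNeg c a).toInt = -(c * a.toInt) := by
  cases a; simp [scaleNeg]; ring

@[simp] theorem toInt_reduce (a : DInt) : a.reduce.toInt = a.toInt := by
  cases a; simp [reduce]; omega

theorem isPos_iff (a : DInt) : a.isPos = true ↔ 0 < a.toInt := by
  obtain ⟨p, n⟩ := a
  change Nat.ble (n + 1) p = true ↔ _
  rw [Nat.ble_eq]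
  simp only [toInt_mk]; omega

theorem toInt_eq_mul_div {g : ℕ} {a : DInt} (h : g ∣ a.abs) :
    a.toInt = g * (div g a).toInt := by
  obtain ⟨p, n⟩ := a
  change g ∣ (p - n) + (n - p) at h
  change _ = (g : ℤ) * ((((p - n) / g : ℕ) : ℤ) - (((n - p) / g : ℕ) : ℤ))
  obtain ⟨k, hk⟩ := h
  rcases le_total p n with hpn | hpn
  · have h0 : p - n = 0 := by omega
    have h1 : g * ((n - p) / g) = n - p := Nat.mul_div_cancel' ⟨k, by omega⟩
    rw [h0, Nat.zero_div, mul_sub, ← Nat.cast_mul, ← Nat.cast_mul, h1]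
    simp only [toInt_mk]; omega
  · have h0 : n - p = 0 := by omega
    have h1 : g * ((p - n) / g) = p - n := Nat.mul_div_cancel' ⟨k, by omega⟩
    rw [h0, Nat.zero_div, mul_sub, ← Nat.cast_mul, ← Nat.cast_mul, h1]
    simp only [toInt_mk]; omega

theorem toInt_div_zero (a : DInt) : (div 0 a).toInt = 0 := by
  obtain ⟨p, n⟩ := a
  change (((p - n) / 0 : ℕ) : ℤ) - (((n - p) / 0 : ℕ) : ℤ) = 0
  simp

theorem forceN_eq {α : Type} (n : ℕ) (k : ℕ → α) : forceN n k = k n := by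
  cases n <;> rfl

theorem forceL_eq {α : Type} (l : List DInt) (k : List DInt → α) : forceL l k = k l := by
  induction l generalizing k with
  | nil => rfl
  | cons z l ih =>
    obtain ⟨p, n⟩ := z
    change forceN p (fun p => forceN n fun n => forceL l fun t => k (mk p n :: t)) = _
    rw [forceN_eq, forceN_eq, ih]

/-- The polynomial with the given coefficients, constant coefficient first. -/
noncomputable def polyA : List DInt → ℤ[X]
  | [] => 0
  | a :: l => C a.toInt + X * polyA l

/-- The polynomial with the given coefficients, leading coefficient first. -/
noncomputable def polyD : List DInt → ℤ[X]
  | [] => 0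
  | a :: l => C a.toInt * X ^ l.length + polyD l

theorem polyA_axpy (x : DInt) (b c : List DInt) :
    polyA (axpy x b c) = C x.toInt * polyA b + polyA c := by
  induction b generalizing c with
  | nil => simp [axpy, polyA]
  | cons y b ih =>
    cases c with
    | nil =>
      change polyA (mul x y :: axpy x b []) = _
      simp only [polyA, ih, toInt_mul, map_mul]; ring
    | cons z c =>
      change polyA (add (mul x y) z :: axpy x b c) = _
      simp only [polyA, ih, toInt_mul, toInt_add, map_mul, map_add]; ring

theorem polyA_eq_hd_tl (c : List DInt) : polyA c = C (hd c).toInt + X * polyA (tl c) := by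
  cases c with
  | nil => simp [hd, tl, polyA]
  | cons z c => rfl

theorem polyA_pmac (a b c : List DInt) :
    polyA (pmac a b c) = polyA a * polyA b + polyA c := by
  induction a generalizing c with
  | nil => simp [pmac, polyA]
  | cons x a ih =>
    change polyA (axpy x b (hd c :: pmac a b (tl c))) = _
    rw [polyA_axpy, polyA_eq_hd_tl c]
    simp only [polyA, ih]; ring

theorem polyA_negL (l : List DInt) : polyA (negL l) = -polyA l := by
  induction l with
  | nil => simp [negL, polyA]
  | cons z l ih =>
    change polyA (neg z :: negL l) = _
    simp only [polyA, ih, toInt_neg, map_neg]; ring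

theorem polyA_negDet (p q r s t w : List DInt) :
    polyA (negDet p q r s t w) =
      -(polyA p * (polyA s * polyA w - polyA t ^ 2)
        - polyA q * (polyA q * polyA w - polyA r * polyA t)
        + polyA r * (polyA q * polyA t - polyA r * polyA s)) := by
  simp only [negDet, polyA_pmac, polyA_negL, polyA]; ring

theorem polyD_rev (a b : List DInt) :
    polyD (rev a b) = X ^ b.length * polyA a + polyD b := by
  induction a generalizing b with
  | nil => simp [rev, polyA]
  | cons x a ih =>
    change polyD (rev a (x :: b)) = _
    simp only [ih, polyA, polyD, List.length_cons, pow_succ]; ring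

theorem length_rev (a b : List DInt) : (rev a b).length = a.length + b.length := by
  induction a generalizing b with
  | nil => simp [rev]
  | cons x a ih =>
    change (rev a (x :: b)).length = _
    rw [ih]; simp; ring

theorem gcdL_dvd {l : List DInt} {z : DInt} (h : z ∈ l) : gcdL l ∣ z.abs := by
  induction l with
  | nil => simp at h
  | cons y l ih =>
    change Nat.gcd y.abs (gcdL l) ∣ _
    rcases List.mem_cons.mp h with rfl | h
    · exact Nat.gcd_dvd_left _ _
    · exact (Nat.gcd_dvd_right _ _).trans (ih h)

theorem length_divL (g : ℕ) (l : List DInt) : (divL g l).length = l.length := by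
  induction l with
  | nil => rfl
  | cons y l ih => exact congrArg (· + 1) ih

theorem polyD_divL {g : ℕ} {l : List DInt} (h : ∀ z ∈ l, g ∣ z.abs) :
    polyD l = C (g : ℤ) * polyD (divL g l) := by
  induction l with
  | nil => simp [divL, polyD]
  | cons y l ih =>
    change polyD (y :: l) = _ * polyD (div g y :: divL g l)
    simp only [polyD, length_divL]
    rw [ih fun z hz => h z (by simp [hz]), toInt_eq_mul_div (h y (by simp))]
    simp only [map_mul]; ring

theorem length_primitive (l : List DInt) : (primitive l).length = l.length := length_divL _ _

theorem exists_primitive {l : List DInt} (h : 0 < (hd (primitive l)).toInt) :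
    ∃ g : ℕ, 0 < g ∧ polyD l = C (g : ℤ) * polyD (primitive l) := by
  refine ⟨gcdL l, Nat.pos_of_ne_zero fun h0 => ?_, polyD_divL fun z hz => gcdL_dvd hz⟩
  cases l with
  | nil => simp [primitive, divL, hd] at h
  | cons y l =>
    have : hd (primitive (y :: l)) = div (gcdL (y :: l)) y := rfl
    rw [this, h0, toInt_div_zero] at h
    exact lt_irrefl _ h

theorem X_mul_polyD (l : List DInt) :
    X * polyD l = C (hd l).toInt * X ^ l.length + X * polyD (tl l) := by
  cases l with
  | nil => simp [hd, tl, polyD]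
  | cons z l =>
    change X * (C z.toInt * X ^ l.length + polyD l) = C z.toInt * X ^ (l.length + 1) + X * polyD l
    ring

theorem length_rem (u v w : DInt) (l as : List DInt) : (rem u v w l as).length = l.length := by
  induction l generalizing as with
  | nil => rfl
  | cons y l ih => exact congrArg (· + 1) (ih (tl as))

theorem polyD_rem (u v w : DInt) {l as : List DInt} (h : l.length = as.length) :
    polyD (rem u v w l as) = C u.toInt * (X * polyD (tl l)) + C v.toInt * polyD l
      + C w.toInt * polyD as := by
  induction l generalizing as with
  | nil =>
    obtain rfl : as = [] := List.length_eq_zero_iff.mp h.symm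
    simp [rem, tl, polyD]
  | cons y l ih =>
    cases as with
    | nil => simp at h
    | cons z as =>
      have h' : l.length = as.length := by simpa using h
      change polyD (add (add (mul u (hd l)) (mul v y)) (mul w z) :: rem u v w l as) =
        C u.toInt * (X * polyD l) + C v.toInt * polyD (y :: l) + C w.toInt * polyD (z :: as)
      rw [X_mul_polyD]
      simp only [polyD, length_rem, ih h', toInt_add, toInt_mul, map_add, map_mul, h']
      ring

theorem length_sturmStep (a b : List DInt) : (sturmStep a b).length = (tl b).length :=
  length_rem _ _ _ _ _

theorem polyD_sturmStep {a b : List DInt} {n : ℕ} (ha : a.length = n + 2)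
    (hb : b.length = n + 1) :
    polyD (sturmStep a b) =
      (C ((hd a).toInt * (hd b).toInt) * X
        + C ((hd (tl a)).toInt * (hd b).toInt - (hd a).toInt * (hd (tl b)).toInt)) * polyD b
      - C ((hd b).toInt ^ 2) * polyD a := by
  obtain ⟨a0, a1, a, rfl⟩ : ∃ a0 a1 a', a = a0 :: a1 :: a' := by
    match a, ha with
    | a0 :: a1 :: a', _ => exact ⟨a0, a1, a', rfl⟩
  obtain ⟨b0, b, rfl⟩ : ∃ b0 b', b = b0 :: b' := by
    match b, hb with
    | b0 :: b', _ => exact ⟨b0, b', rfl⟩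
  have ha' : a.length = n := by simpa using ha
  have hb' : b.length = n := by simpa using hb
  have hX : X * polyD b = _ := X_mul_polyD b
  change polyD (rem (reduce (mul a0 b0)) (reduce (add (mul a1 b0) (neg (mul a0 (hd b)))))
    (reduce (neg (mul b0 b0))) b a) = _
  rw [polyD_rem _ _ _ (by rw [ha', hb'])]
  change _ = (C (a0.toInt * b0.toInt) * X + C (a1.toInt * b0.toInt - a0.toInt * (hd b).toInt))
    * polyD (b0 :: b) - C (b0.toInt ^ 2) * polyD (a0 :: a1 :: a)
  simp only [polyD, toInt_reduce, toInt_add, toInt_mul, toInt_neg, map_add, map_mul, map_sub,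
    map_neg, map_pow, List.length_cons, ha', hb']
  rw [hb'] at hX
  linear_combination (-C a0.toInt * C b0.toInt) * hX

theorem exists_eq_cons {a : List DInt} {n : ℕ} (h : a.length = n + 1) :
    ∃ z l, a = z :: l ∧ l.length = n := by
  match a, h with
  | z :: l, h => exact ⟨z, l, rfl, by simpa using h⟩

theorem length_tl {a : List DInt} {n : ℕ} (h : a.length = n + 1) : (tl a).length = n := by
  obtain ⟨z, l, rfl, hl⟩ := exists_eq_cons h
  exact hl

theorem sturmChain_zero_im_pos {a b : List DInt} (ha : a.length = 2) (hb : b.length = 1)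
    (ha0 : 0 < (hd a).toInt) (hb0 : 0 < (hd b).toInt) {z : ℂ} (hz : 0 < z.im) :
    0 < (aeval z (polyD a) * (starRingEnd ℂ) (aeval z (polyD b))).im := by
  match a, b, ha, hb with
  | [a0, a1], [b0], _, _ =>
    have ha0' : (0 : ℝ) < (a0.toInt : ℝ) := by exact_mod_cast ha0
    have hb0' : (0 : ℝ) < (b0.toInt : ℝ) := by exact_mod_cast hb0
    simp [polyD]
    positivity

theorem sturmChain_zero_wronskian {a b : List DInt} (ha : a.length = 2) (hb : b.length = 1)
    (ha0 : 0 < (hd a).toInt) (hb0 : 0 < (hd b).toInt) (x : ℝ) :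
    0 < aeval x (derivative (polyD a)) * aeval x (polyD b)
      - aeval x (polyD a) * aeval x (derivative (polyD b)) := by
  match a, b, ha, hb with
  | [a0, a1], [b0], _, _ =>
    have ha0' : (0 : ℝ) < (a0.toInt : ℝ) := by exact_mod_cast ha0
    have hb0' : (0 : ℝ) < (b0.toInt : ℝ) := by exact_mod_cast hb0
    simp [polyD]
    positivity

theorem sturmChain_succ_iff (n : ℕ) (a b : List DInt) :
    sturmChain (n + 1) a b = true ↔ 0 < (hd a).toInt ∧ 0 < (hd b).toInt ∧
      sturmChain n b (primitive (sturmStep a b)) = true := by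
  change (_ && (_ && forceL _ (sturmChain n b))) = true ↔ _
  rw [forceL_eq, Bool.and_eq_true, Bool.and_eq_true, isPos_iff, isPos_iff]

theorem sturmChain_pos {n : ℕ} {a b : List DInt} (h : sturmChain n a b = true) :
    0 < (hd a).toInt ∧ 0 < (hd b).toInt := by
  cases n with
  | zero =>
    change (_ && _) = true at h
    rwa [Bool.and_eq_true, isPos_iff, isPos_iff] at h
  | succ n =>
    rw [sturmChain_succ_iff] at h
    exact ⟨h.1, h.2.1⟩

theorem sturmChain_sound {n : ℕ} {a b : List DInt} (ha : a.length = n + 2)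
    (hb : b.length = n + 1) (h : sturmChain n a b = true) :
    (∀ z : ℂ, 0 < z.im →
      0 < (aeval z (polyD a) * (starRingEnd ℂ) (aeval z (polyD b))).im) ∧
    ∀ x : ℝ, 0 < aeval x (derivative (polyD a)) * aeval x (polyD b)
      - aeval x (polyD a) * aeval x (derivative (polyD b)) := by
  induction n generalizing a b with
  | zero =>
    obtain ⟨h1, h2⟩ := sturmChain_pos h
    exact ⟨fun z hz => sturmChain_zero_im_pos ha hb h1 h2 hz,
      sturmChain_zero_wronskian ha hb h1 h2⟩
  | succ n ih =>
    obtain ⟨h1, h2, h3⟩ := (sturmChain_succ_iff n a b).mp h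
    obtain ⟨g, hg, hr⟩ := exists_primitive (sturmChain_pos h3).2
    have hlen : (primitive (sturmStep a b)).length = n + 1 := by
      rw [length_primitive, length_sturmStep, length_tl hb]
    obtain ⟨im_pos, wr_pos⟩ := ih hb hlen h3
    rw [polyD_sturmStep ha hb] at hr
    generalize primitive (sturmStep a b) = r at *
    generalize (hd (tl a)).toInt * (hd b).toInt - (hd a).toInt * (hd (tl b)).toInt = v at hr
    generalize (hd a).toInt = a0 at *
    generalize (hd b).toInt = b0 at *
    have ha0 : (0 : ℝ) < a0 := by exact_mod_cast h1
    have hb0 : (0 : ℝ) < b0 := by exact_mod_cast h2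
    have hg0 : (0 : ℝ) < g := by exact_mod_cast hg
    constructor
    · intro z hz
      have hq := im_pos z hz
      have e := congrArg (aeval z) hr
      simp only [map_sub, map_mul, map_add, aeval_X, eq_intCast, map_intCast, map_pow,
        Int.cast_natCast, map_natCast] at e
      generalize aeval z (polyD a) = P at *
      generalize aeval z (polyD b) = Q at *
      generalize aeval z (polyD r) = R at *
      have e1 := congrArg Complex.re e
      have e2 := congrArg Complex.im e
      simp [pow_two] at e1 e2 hq ⊢
      have hQ : 0 < Q.re ^ 2 + Q.im ^ 2 := by
        by_contra hQ
        have h1 : Q.re = 0 := by nlinarith [sq_nonneg Q.re, sq_nonneg Q.im]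
        have h2 : Q.im = 0 := by nlinarith [sq_nonneg Q.re, sq_nonneg Q.im]
        rw [h1, h2] at hq
        simp at hq
      have key : (b0 : ℝ) ^ 2 * (-(P.re * Q.im) + P.im * Q.re) =
          a0 * b0 * z.im * (Q.re ^ 2 + Q.im ^ 2) + g * (-(Q.re * R.im) + Q.im * R.re) := by
        linear_combination (-Q.re) * e2 + Q.im * e1
      have hpos : 0 < (b0 : ℝ) ^ 2 * (-(P.re * Q.im) + P.im * Q.re) := by
        rw [key]
        exact add_pos (mul_pos (mul_pos (mul_pos ha0 hb0) hz) hQ) (mul_pos hg0 (by linarith))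
      have := (mul_pos_iff_of_pos_left (by positivity)).mp hpos
      linarith
    · intro x
      have hw := wr_pos x
      have e := congrArg (aeval x) hr
      have e' := congrArg (fun p => aeval x (derivative p)) hr
      simp only [derivative_add, derivative_sub, derivative_mul, derivative_C, derivative_X,
        zero_mul, zero_add, add_zero, mul_one] at e'
      rw [map_sub, map_add] at e'
      rw [map_sub] at e
      simp only [map_add, map_mul, aeval_C, aeval_X] at e e'
      simp only [algebraMap_int_eq, eq_intCast, Int.cast_mul, Int.cast_pow,
        Int.cast_natCast] at e e'
      have key : (b0 : ℝ) ^ 2 * (aeval x (derivative (polyD a)) * aeval x (polyD b)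
          - aeval x (polyD a) * aeval x (derivative (polyD b))) =
          a0 * b0 * aeval x (polyD b) ^ 2 + g * (aeval x (derivative (polyD b)) * aeval x (polyD r)
          - aeval x (polyD b) * aeval x (derivative (polyD r))) := by
        linear_combination aeval x (derivative (polyD b)) * e - aeval x (polyD b) * e'
      have hpos : 0 < (b0 : ℝ) ^ 2 * (aeval x (derivative (polyD a)) * aeval x (polyD b)
          - aeval x (polyD a) * aeval x (derivative (polyD b))) := by
        rw [key]
        exact add_pos_of_nonneg_of_pos (by positivity) (mul_pos hg0 hw)
      exact (mul_pos_iff_of_pos_left (by positivity)).mp hpos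

theorem length_der (l : List DInt) {n : ℕ} (h : l.length = n + 1) : (der l n).length = n := by
  induction n generalizing l with
  | zero =>
    obtain ⟨z, t, rfl, ht⟩ := exists_eq_cons h
    rfl
  | succ n ih =>
    obtain ⟨z, t, rfl, ht⟩ := exists_eq_cons h
    exact congrArg (· + 1) (ih t ht)

theorem polyD_der (l : List DInt) {n : ℕ} (h : l.length = n + 1) :
    polyD (der l n) = derivative (polyD l) := by
  induction n generalizing l with
  | zero =>
    match l, h with
    | [z], _ => simp [der, polyD]
  | succ n ih =>
    obtain ⟨z, t, rfl, ht⟩ := exists_eq_cons h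
    change polyD (scale (n + 1) z :: der t n) = derivative (polyD (z :: t))
    simp only [polyD, length_der t ht, ih t ht, ht, toInt_scale, derivative_add,
      derivative_C_mul, derivative_X_pow, map_mul]
    simp
    ring

theorem natDegree_polyD {l : List DInt} {n : ℕ} (h : l.length = n + 1)
    (h0 : (hd l).toInt ≠ 0) : (polyD l).natDegree = n := by
  have hlt : ∀ t : List DInt, (polyD t).degree < (t.length : WithBot ℕ) := by
    intro t
    induction t with
    | nil => simp [polyD]
    | cons z t ih =>
      refine (degree_add_le _ _).trans_lt (max_lt ((degree_C_mul_X_pow_le _ _).trans_lt ?_)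
        (ih.trans ?_)) <;> simp <;> exact_mod_cast Nat.lt_succ_self _
  obtain ⟨z, t, rfl, ht⟩ := exists_eq_cons h
  refine natDegree_eq_of_degree_eq_some ?_
  change z.toInt ≠ 0 at h0
  rw [polyD, degree_add_eq_left_of_degree_lt, degree_C_mul_X_pow _ h0, ht]
  rw [degree_C_mul_X_pow _ h0]
  exact hlt t

theorem aeval_conj (p : ℤ[X]) (z : ℂ) :
    aeval ((starRingEnd ℂ) z) p = (starRingEnd ℂ) (aeval z p) := by
  simpa using Polynomial.aeval_algHom_apply ((starRingEnd ℂ).toIntAlgHom) z p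

/-- If the modified Sturm chain of a polynomial is positive then the polynomial has only
real and simple roots. -/
theorem roots_of_sturmChain {a : List DInt} {n : ℕ} (ha : a.length = n + 2)
    (h : sturmChain n a (der a (n + 1)) = true) :
    ((polyD a).rootSet ℂ).ncard = n + 1 ∧
      ∀ z : ℂ, aeval z (polyD a) = 0 → z.im = 0 ∧ aeval z (derivative (polyD a)) ≠ 0 := by
  obtain ⟨him, hwr⟩ := sturmChain_sound ha (length_der a ha) h
  rw [polyD_der a ha] at him hwr
  have key : ∀ z : ℂ, aeval z (polyD a) = 0 →
      z.im = 0 ∧ aeval z (derivative (polyD a)) ≠ 0 := by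
    intro z hz
    have him0 : z.im = 0 := by
      rcases lt_trichotomy z.im 0 with hlt | heq | hgt
      · have := him ((starRingEnd ℂ) z) (by simpa using hlt)
        rw [aeval_conj, hz] at this
        simp at this
      · exact heq
      · have := him z hgt
        rw [hz] at this
        simp at this
    refine ⟨him0, fun hd => ?_⟩
    obtain ⟨x, rfl⟩ : ∃ x : ℝ, z = algebraMap ℝ ℂ x := ⟨z.re, Complex.ext rfl (by simp [him0])⟩
    rw [aeval_algebraMap_apply] at hz hd
    have h1 : aeval x (polyD a) = 0 := by simpa using hz
    have h2 : aeval x (derivative (polyD a)) = 0 := by simpa using hd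
    have := hwr x
    rw [h1, h2] at this
    simp at this
  refine ⟨?_, key⟩
  have hdeg : (polyD a).natDegree = n + 1 := natDegree_polyD ha (sturmChain_pos h).1.ne'
  have h0 : polyD a ≠ 0 := fun h0 => by simp [h0] at hdeg
  have hinj : Function.Injective (algebraMap ℤ ℂ) := by
    simpa using (Int.cast_injective : Function.Injective (Int.cast : ℤ → ℂ))
  have hm0 : (polyD a).map (algebraMap ℤ ℂ) ≠ 0 := (Polynomial.map_ne_zero_iff hinj).mpr h0
  have hnodup : ((polyD a).aroots ℂ).Nodup := by
    rw [aroots, Multiset.nodup_iff_count_le_one]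
    intro z
    rw [count_roots]
    by_contra! hz
    rw [one_lt_rootMultiplicity_iff_isRoot hm0, derivative_map, IsRoot.def, IsRoot.def,
      eval_map_algebraMap, eval_map_algebraMap] at hz
    exact (key z hz.1).2 hz.2
  rw [rootSet, Set.ncard_coe_finset, Multiset.toFinset_card_of_nodup hnodup, aroots,
    splits_iff_card_roots.mp (IsAlgClosed.splits _), natDegree_map_eq_of_injective hinj, hdeg]

end DInt

section Bezoutian

/-! Entries of a symmetric matrix whose kernel parametrises the solutions of the
normalised system. -/

noncomputable def entry00 (g2 g3 g4 g5 g6 g7 g8 g9 g10 X : ℂ) : ℂ :=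
    15 * g2 ^ 3 * g4 ^ 3 - 30 * g2 ^ 2 * g4 ^ 2 * g6 - 6 * g2 ^ 3 * g4 * g8 + 30 * g2 * g3 * g4
    * g9 + 30 * g2 * g4 * g5 * g7 + 10 * g2 * g4 ^ 2 * g8 - 30 * g2 ^ 2 * g4 * g10 + 6 * g2 ^ 2
    * g6 * g8 + 6 * g2 ^ 2 * g7 ^ 2 - 12 * g2 * g7 * g9 - 2 * g2 * g8 ^ 2 + 20 * g3 * g7 * g8 -
    30 * g4 * g5 * g9 - 20 * g4 * g6 * g8 + 30 * g5 ^ 2 * g8 - 20 * g8 * g10 + 6 * g9 ^ 2 +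
    (-450 * g2 ^ 2 * g3 * g4 ^ 2 + 600 * g2 * g3 * g4 * g6 + 60 * g2 ^ 2 * g3 * g8 + 300 * g2 *
    g3 * g10 - 210 * g2 * g4 * g9 - 30 * g2 * g5 * g8 - 60 * g2 * g6 * g7 - 100 * g3 * g4 * g8 -
    300 * g3 * g5 * g7 - 300 * g3 ^ 2 * g9 + 300 * g5 * g10 + 60 * g6 * g9 - 140 * g7 * g8) * X
    + (4500 * g2 * g3 ^ 2 * g4 + 3150 * g2 ^ 2 * g4 ^ 2 - 4200 * g2 * g4 * g6 - 420 * g2 ^ 2 *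
    g8 - 3000 * g3 ^ 2 * g6 - 2400 * g2 * g10 + 4500 * g3 * g9 + 700 * g4 * g8 + 2100 * g5 * g7)
    * X ^ 2 + (-63000 * g2 * g3 * g4 - 15000 * g3 ^ 3 + 42000 * g3 * g6 - 16800 * g9) * X ^ 3 +
    (220500 * g2 * g4 + 315000 * g3 ^ 2 - 147000 * g6) * X ^ 4 + (-2205000 * g3) * X ^ 5 +
    (5145000) * X ^ 6

noncomputable def entry01 (g2 g3 g4 g5 g6 g7 g8 g9 g10 X : ℂ) : ℂ :=
    -15 * g2 ^ 3 * g4 ^ 2 + 30 * g2 ^ 2 * g3 * g7 + 30 * g2 ^ 2 * g4 * g6 + 3 * g2 ^ 3 * g8 - 60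
    * g2 * g3 * g9 - 10 * g2 * g4 * g8 + 30 * g2 ^ 2 * g10 + 100 * g3 ^ 2 * g8 + 20 * g6 * g8 +
    (450 * g2 ^ 2 * g3 * g4 - 600 * g2 * g3 * g6 - 210 * g2 ^ 2 * g7 + 420 * g2 * g9 - 1300 * g3
    * g8) * X + (-3000 * g2 * g3 ^ 2 - 3150 * g2 ^ 2 * g4 + 4200 * g2 * g6 + 4200 * g8) * X ^ 2
    + (42000 * g2 * g3) * X ^ 3 + (-147000 * g2) * X ^ 4

noncomputable def entry02 (g2 g3 g4 g5 g6 g7 g8 g9 g10 X : ℂ) : ℂ :=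
    -18 * g2 ^ 3 * g7 - 60 * g2 * g3 * g8 - 60 * g2 * g4 * g7 + 18 * g2 ^ 2 * g9 + 60 * g4 * g9
    - 60 * g5 * g8 + (-90 * g2 ^ 3 * g4 + 180 * g2 ^ 2 * g6 + 420 * g2 * g8 + 600 * g3 * g7 -
    600 * g10) * X + (900 * g2 ^ 2 * g3 - 4200 * g7) * X ^ 2 + (-6300 * g2 ^ 2) * X ^ 3

noncomputable def entry11 (g2 g3 g4 g5 g6 g7 g8 g9 g10 X : ℂ) : ℂ :=
    150 * g2 ^ 2 * g3 ^ 2 + 15 * g2 ^ 3 * g4 + 300 * g2 * g3 * g5 - 30 * g2 ^ 2 * g6 - 500 * g3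
    ^ 2 * g4 + 10 * g2 * g8 - 100 * g3 * g7 + 100 * g10 + (-2550 * g2 ^ 2 * g3 - 2100 * g2 * g5
    + 7000 * g3 * g4 + 700 * g7) * X + (10500 * g2 ^ 2 - 24500 * g4) * X ^ 2

noncomputable def entry12 (g2 g3 g4 g5 g6 g7 g8 g9 g10 X : ℂ) : ℂ :=
    -90 * g2 ^ 3 * g3 - 90 * g2 ^ 2 * g5 + 60 * g2 * g7 - 60 * g9 + (720 * g2 ^ 3 + 3000 * g3 ^
    2) * X + (-42000 * g3) * X ^ 2 + (147000) * X ^ 3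

noncomputable def entry22 (g2 g3 g4 g5 g6 g7 g8 g9 g10 X : ℂ) : ℂ :=
    54 * g2 ^ 4 + 180 * g2 ^ 2 * g4 + 120 * g8 + (-3600 * g2 * g3) * X + (25200 * g2) * X ^ 2

end Bezoutian

namespace DInt

open Polynomial

theorem aeval_polyA_nil (x : ℂ) : aeval x (polyA []) = 0 := map_zero _

theorem aeval_polyA_cons (a : DInt) (l : List DInt) (x : ℂ) :
    aeval x (polyA (a :: l)) = a.toInt + x * aeval x (polyA l) := by
  simp [polyA]

theorem aeval_phi11 (h2 h3 h4 h5 h6 h7 h8 h9 h10 : DInt) (x : ℂ) :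
    aeval x (polyA (phi11 h2 h3 h4 h5 h6 h7 h8 h9 h10)) =
      entry00 h2.toInt h3.toInt h4.toInt h5.toInt h6.toInt
        h7.toInt h8.toInt h9.toInt h10.toInt x := by
  simp only [phi11, aeval_polyA_cons, aeval_polyA_nil, entry00, toInt_add, toInt_mul, toInt_scale,
    toInt_scaleNeg, toInt_mk]
  push_cast
  ring

theorem aeval_phi12 (h2 h3 h4 h5 h6 h7 h8 h9 h10 : DInt) (x : ℂ) :
    aeval x (polyA (phi12 h2 h3 h4 h5 h6 h7 h8 h9 h10)) =
      entry01 h2.toInt h3.toInt h4.toInt h5.toInt h6.toInt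
        h7.toInt h8.toInt h9.toInt h10.toInt x := by
  simp only [phi12, aeval_polyA_cons, aeval_polyA_nil, entry01, toInt_add, toInt_mul, toInt_scale,
    toInt_scaleNeg, toInt_mk]
  push_cast
  ring

theorem aeval_phi13 (h2 h3 h4 h5 h6 h7 h8 h9 h10 : DInt) (x : ℂ) :
    aeval x (polyA (phi13 h2 h3 h4 h5 h6 h7 h8 h9 h10)) =
      entry02 h2.toInt h3.toInt h4.toInt h5.toInt h6.toInt
        h7.toInt h8.toInt h9.toInt h10.toInt x := by
  simp only [phi13, aeval_polyA_cons, aeval_polyA_nil, entry02, toInt_add, toInt_mul, toInt_scale,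
    toInt_scaleNeg, toInt_mk]
  push_cast
  ring

theorem aeval_phi22 (h2 h3 h4 h5 h6 h7 h8 h9 h10 : DInt) (x : ℂ) :
    aeval x (polyA (phi22 h2 h3 h4 h5 h6 h7 h8 h9 h10)) =
      entry11 h2.toInt h3.toInt h4.toInt h5.toInt h6.toInt
        h7.toInt h8.toInt h9.toInt h10.toInt x := by
  simp only [phi22, aeval_polyA_cons, aeval_polyA_nil, entry11, toInt_add, toInt_mul, toInt_scale,
    toInt_scaleNeg, toInt_mk]
  push_cast
  ring

theorem aeval_phi23 (h2 h3 h4 h5 h6 h7 h8 h9 h10 : DInt) (x : ℂ) :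
    aeval x (polyA (phi23 h2 h3 h4 h5 h6 h7 h8 h9 h10)) =
      entry12 h2.toInt h3.toInt h4.toInt h5.toInt h6.toInt
        h7.toInt h8.toInt h9.toInt h10.toInt x := by
  simp only [phi23, aeval_polyA_cons, aeval_polyA_nil, entry12, toInt_add, toInt_mul, toInt_scale,
    toInt_scaleNeg, toInt_mk]
  push_cast
  ring

theorem aeval_phi33 (h2 h3 h4 h5 h6 h7 h8 h9 h10 : DInt) (x : ℂ) :
    aeval x (polyA (phi33 h2 h3 h4 h5 h6 h7 h8 h9 h10)) =
      entry22 h2.toInt h3.toInt h4.toInt h5.toInt h6.toInt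
        h7.toInt h8.toInt h9.toInt h10.toInt x := by
  simp only [phi33, aeval_polyA_cons, aeval_polyA_nil, entry22, toInt_add, toInt_mul, toInt_scale,
    toInt_scaleNeg, toInt_mk]
  push_cast
  ring

end DInt

/-- The determinant of a symmetric matrix of size three. -/
def symDet {R : Type*} [CommRing R] (p q r s t w : R) : R :=
  p * (s * w - t ^ 2) - q * (q * w - r * t) + r * (q * t - r * s)

open Polynomial in
/-- The determinant of the symmetric matrix with entries `entry00`, ..., `entry22` is an
integral polynomial in `X` with twelve complex roots, all real and simple. -/
def HasRealSpectrum (g2 g3 g4 g5 g6 g7 g8 g9 g10 : ℂ) : Prop :=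
  ∃ p q r s t w : ℤ[X],
    (∀ x : ℂ, aeval x p = entry00 g2 g3 g4 g5 g6 g7 g8 g9 g10 x ∧
      aeval x q = entry01 g2 g3 g4 g5 g6 g7 g8 g9 g10 x ∧
      aeval x r = entry02 g2 g3 g4 g5 g6 g7 g8 g9 g10 x ∧
      aeval x s = entry11 g2 g3 g4 g5 g6 g7 g8 g9 g10 x ∧
      aeval x t = entry12 g2 g3 g4 g5 g6 g7 g8 g9 g10 x ∧
      aeval x w = entry22 g2 g3 g4 g5 g6 g7 g8 g9 g10 x) ∧
    ((symDet p q r s t w).rootSet ℂ).ncard = 12 ∧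
    ∀ z : ℂ, aeval z (symDet p q r s t w) = 0 →
      z.im = 0 ∧ aeval z (derivative (symDet p q r s t w)) ≠ 0

namespace DInt

open Polynomial

theorem at'_tl (l : List DInt) (n : ℕ) : at' (tl l) n = at' l (n + 1) := by
  have key : (Nat.rec (tl l) (fun _ ih => tl ih) n : List DInt)
      = Nat.rec l (fun _ ih => tl ih) (n + 1) := by
    induction n with
    | zero => rfl
    | succ n ih => exact congrArg tl ih
  exact congrArg hd key

theorem coeff_polyA (l : List DInt) (n : ℕ) : (polyA l).coeff n = (at' l n).toInt := by
  induction n generalizing l with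
  | zero =>
    rw [polyA_eq_hd_tl]
    simp
    rfl
  | succ n ih =>
    rw [polyA_eq_hd_tl, coeff_add, coeff_X_mul, coeff_C_succ, zero_add, ih (tl l), at'_tl]

theorem polyA_monicProd (l : List DInt) :
    polyA (monicProd l) = (l.map fun z => X - C z.toInt).prod := by
  induction l with
  | nil => simp [monicProd, polyA]
  | cons z l ih =>
    change polyA (axpy (neg z) (monicProd l) (mk 0 0 :: monicProd l)) = _
    rw [polyA_axpy, List.map_cons, List.prod_cons, ← ih]
    simp only [polyA, toInt_neg, toInt_mk, map_neg]
    simp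
    ring

theorem center_eq (s : ℕ) (l : List ℕ) :
    (center s l).map toInt = l.map fun x : ℕ => 10 * (x : ℤ) - (s : ℤ) := by
  induction l with
  | nil => rfl
  | cons x l ih =>
    change toInt (reduce (mk (10 * x) s)) :: (center s l).map toInt = _
    rw [ih]; simp

theorem sumN_eq (l : List ℕ) : sumN l = l.sum := by
  induction l with
  | nil => rfl
  | cons x l ih =>
    change x + sumN l = _
    rw [ih, List.sum_cons]

/-- The monic polynomial whose roots are the points of `l`, translated to have mean zero and
multiplied by `10`. -/
noncomputable def centeredPoly (l : List ℕ) : ℤ[X] :=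
  (l.map fun t : ℕ => X - C (10 * (t : ℤ) - l.sum)).prod

theorem polyA_monicProd_center (l : List ℕ) :
    polyA (monicProd (center (sumN l) l)) = centeredPoly l := by
  rw [polyA_monicProd, centeredPoly, sumN_eq]
  have := congrArg (List.map fun z : ℤ => (X - C z : ℤ[X])) (center_eq l.sum l)
  rw [List.map_map] at this
  refine congrArg List.prod (this.trans ?_)
  rw [List.map_map]
  rfl

theorem hasRealSpectrum_of_sturmChain (h2 h3 h4 h5 h6 h7 h8 h9 h10 : DInt)
    (h : sturmChain 11 (primitive (rev (negDetPhi h2 h3 h4 h5 h6 h7 h8 h9 h10) []))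
      (der (primitive (rev (negDetPhi h2 h3 h4 h5 h6 h7 h8 h9 h10) [])) 12) = true) :
    HasRealSpectrum h2.toInt h3.toInt h4.toInt h5.toInt h6.toInt h7.toInt h8.toInt h9.toInt
      h10.toInt := by
  have hlen : (negDetPhi h2 h3 h4 h5 h6 h7 h8 h9 h10).length = 13 := rfl
  obtain ⟨hn, hr⟩ := roots_of_sturmChain (n := 11)
    (by rw [length_primitive, length_rev, hlen]; rfl) h
  obtain ⟨g, hg, e⟩ := exists_primitive (sturmChain_pos h).1
  rw [polyD_rev, List.length_nil, pow_zero, one_mul, polyD, add_zero, negDetPhi,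
    polyA_negDet, neg_eq_iff_eq_neg, ← negDetPhi] at e
  have hg' : (g : ℂ) ≠ 0 := by exact_mod_cast hg.ne'
  generalize polyD (primitive (rev (negDetPhi h2 h3 h4 h5 h6 h7 h8 h9 h10) [])) = a at *
  refine ⟨_, _, _, _, _, _, fun x => ⟨aeval_phi11 _ _ _ _ _ _ _ _ _ x,
    aeval_phi12 _ _ _ _ _ _ _ _ _ x, aeval_phi13 _ _ _ _ _ _ _ _ _ x,
    aeval_phi22 _ _ _ _ _ _ _ _ _ x, aeval_phi23 _ _ _ _ _ _ _ _ _ x,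
    aeval_phi33 _ _ _ _ _ _ _ _ _ x⟩, ?_⟩
  rw [symDet, e]
  have hiff : ∀ z : ℂ, aeval z (-(C (g : ℤ) * a)) = 0 ↔ aeval z a = 0 := by
    intro z
    simp [hg']
  constructor
  · refine Eq.trans (congrArg Set.ncard ?_) hn
    have ha : a ≠ 0 := by rintro rfl; simp at hn
    have ha' : -(C (g : ℤ) * a) ≠ 0 := by
      simp [ha, hg.ne']
    ext z
    rw [mem_rootSet_of_ne ha, mem_rootSet_of_ne ha', hiff]
  · intro z hz
    refine ⟨(hr z ((hiff z).mp hz)).1, ?_⟩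
    have := (hr z ((hiff z).mp hz)).2
    simpa [hg'] using this

theorem cert_sound {l : List ℕ} (h : cert l = true) {P : ℤ[X]} (hP : P = centeredPoly l) :
    HasRealSpectrum (-490 * P.coeff 8) (-15435 * P.coeff 7) (-463050 * P.coeff 6)
      (-27011250 * P.coeff 5) (-1701708750 * P.coeff 4) (-178679418750 * P.coeff 3)
      (12507559312500 * P.coeff 2) (1313293727812500 * P.coeff 1)
      (137895841420312500 * P.coeff 0) := by
  change forceL _ _ = true at h
  rw [forceL_eq, forceL_eq] at h
  rw [← polyA_monicProd_center] at hP
  subst hP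
  have := hasRealSpectrum_of_sturmChain _ _ _ _ _ _ _ _ _ h
  simpa [coeff_polyA] using this

theorem allSub_cons {x : ℕ} {l : List ℕ} {k : ℕ} {f : List ℕ → Bool}
    (h1 : allSub l k (fun t => f (x :: t)) = true) (h2 : allSub l (k + 1) f = true) :
    allSub (x :: l) (k + 1) f = true := by
  change and _ _ = true
  rw [Bool.and_eq_true]
  exact ⟨h1, h2⟩

theorem allSub_sound {l t : List ℕ} {f : List ℕ → Bool} (h : allSub l t.length f = true)
    (ht : t.Sublist l) : f t = true := by
  induction ht generalizing f with
  | slnil => exact h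
  | @cons t l x ht ih =>
    cases t with
    | nil => exact h
    | cons y t =>
      change and _ _ = true at h
      rw [Bool.and_eq_true] at h
      exact ih h.2
  | @cons_cons t l x ht ih =>
    change and _ _ = true at h
    rw [Bool.and_eq_true] at h
    exact ih (f := fun t => f (x :: t)) h.1

end DInt

namespace DInt

theorem cert_chunk_none : allSub [7, 10, 11, 13, 15, 16, 17, 23, 29, 31] 10
    (fun t => cert (t)) = true := by
  decide +kernel

theorem cert_chunk_1 : allSub [7, 10, 11, 13, 15, 16, 17, 23, 29, 31] 9
    (fun t => cert (1 :: t)) = true := by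
  decide +kernel

theorem cert_chunk_2 : allSub [7, 10, 11, 13, 15, 16, 17, 23, 29, 31] 9
    (fun t => cert (2 :: t)) = true := by
  decide +kernel

theorem cert_chunk_3 : allSub [7, 10, 11, 13, 15, 16, 17, 23, 29, 31] 9
    (fun t => cert (3 :: t)) = true := by
  decide +kernel

theorem cert_chunk_5 : allSub [7, 10, 11, 13, 15, 16, 17, 23, 29, 31] 9
    (fun t => cert (5 :: t)) = true := by
  decide +kernel

theorem cert_chunk_1_2 : allSub [7, 10, 11, 13, 15, 16, 17, 23, 29, 31] 8
    (fun t => cert (1 :: 2 :: t)) = true := by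
  decide +kernel

theorem cert_chunk_1_3 : allSub [7, 10, 11, 13, 15, 16, 17, 23, 29, 31] 8
    (fun t => cert (1 :: 3 :: t)) = true := by
  decide +kernel

theorem cert_chunk_1_5 : allSub [7, 10, 11, 13, 15, 16, 17, 23, 29, 31] 8
    (fun t => cert (1 :: 5 :: t)) = true := by
  decide +kernel

theorem cert_chunk_2_3 : allSub [7, 10, 11, 13, 15, 16, 17, 23, 29, 31] 8
    (fun t => cert (2 :: 3 :: t)) = true := by
  decide +kernel

theorem cert_chunk_2_5 : allSub [7, 10, 11, 13, 15, 16, 17, 23, 29, 31] 8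
    (fun t => cert (2 :: 5 :: t)) = true := by
  decide +kernel

theorem cert_chunk_3_5 : allSub [7, 10, 11, 13, 15, 16, 17, 23, 29, 31] 8
    (fun t => cert (3 :: 5 :: t)) = true := by
  decide +kernel

theorem cert_chunk_1_2_3 : allSub [7, 10, 11, 13, 15, 16, 17, 23, 29, 31] 7
    (fun t => cert (1 :: 2 :: 3 :: t)) = true := by
  decide +kernel

theorem cert_chunk_1_2_5 : allSub [7, 10, 11, 13, 15, 16, 17, 23, 29, 31] 7
    (fun t => cert (1 :: 2 :: 5 :: t)) = true := by
  decide +kernel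

theorem cert_chunk_1_3_5 : allSub [7, 10, 11, 13, 15, 16, 17, 23, 29, 31] 7
    (fun t => cert (1 :: 3 :: 5 :: t)) = true := by
  decide +kernel

theorem cert_chunk_2_3_5 : allSub [7, 10, 11, 13, 15, 16, 17, 23, 29, 31] 7
    (fun t => cert (2 :: 3 :: 5 :: t)) = true := by
  decide +kernel

theorem cert_chunk_1_2_3_5_7 : allSub [10, 11, 13, 15, 16, 17, 23, 29, 31] 5
    (fun t => cert (1 :: 2 :: 3 :: 5 :: 7 :: t)) = true := by
  decide +kernel

theorem cert_chunk_1_2_3_5_skip_7 : allSub [10, 11, 13, 15, 16, 17, 23, 29, 31] 6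
    (fun t => cert (1 :: 2 :: 3 :: 5 :: t)) = true := by
  decide +kernel

theorem cert_chunk_1_2_3_5 : allSub [7, 10, 11, 13, 15, 16, 17, 23, 29, 31] 6
    (fun t => cert (1 :: 2 :: 3 :: 5 :: t)) = true :=
  allSub_cons cert_chunk_1_2_3_5_7 cert_chunk_1_2_3_5_skip_7

theorem allSub_cert : allSub [1, 2, 3, 5, 7, 10, 11, 13, 15, 16, 17, 23, 29, 31] 10 cert = true :=
  (allSub_cons (allSub_cons (allSub_cons (allSub_cons cert_chunk_1_2_3_5
    cert_chunk_1_2_3)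
    (allSub_cons cert_chunk_1_2_5
    cert_chunk_1_2))
    (allSub_cons (allSub_cons cert_chunk_1_3_5
    cert_chunk_1_3)
    (allSub_cons cert_chunk_1_5
    cert_chunk_1)))
    (allSub_cons (allSub_cons (allSub_cons cert_chunk_2_3_5
    cert_chunk_2_3)
    (allSub_cons cert_chunk_2_5
    cert_chunk_2))
    (allSub_cons (allSub_cons cert_chunk_3_5
    cert_chunk_3)
    (allSub_cons cert_chunk_5
    cert_chunk_none))))

end DInt

open Polynomial in
theorem hasRealSpectrum_of_subset {T : Finset ℕ}
    (hT : T ⊆ ({1, 2, 3, 5, 7, 10, 11, 13, 15, 16, 17, 23, 29, 31} : Finset ℕ))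
    (hcard : T.card = 10) {P : ℤ[X]}
    (hP : P = ∏ t ∈ T, (X - C (10 * (t : ℤ) - ((∑ u ∈ T, u : ℕ) : ℤ)))) :
    HasRealSpectrum (-490 * P.coeff 8) (-15435 * P.coeff 7) (-463050 * P.coeff 6)
      (-27011250 * P.coeff 5) (-1701708750 * P.coeff 4) (-178679418750 * P.coeff 3)
      (12507559312500 * P.coeff 2) (1313293727812500 * P.coeff 1)
      (137895841420312500 * P.coeff 0) := by
  let l := [1, 2, 3, 5, 7, 10, 11, 13, 15, 16, 17, 23, 29, 31].filter (· ∈ T)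
  have hnodup : l.Nodup := List.Nodup.filter _ (by decide)
  have hlT : l.toFinset = T := by
    ext x
    rw [List.mem_toFinset, List.mem_filter, decide_eq_true_iff]
    refine ⟨fun h => h.2, fun h => ⟨?_, h⟩⟩
    simpa using hT h
  have hlen : l.length = 10 := by
    rw [← List.toFinset_card_of_nodup hnodup, hlT, hcard]
  have hsum : l.sum = ∑ u ∈ T, u := by
    rw [← hlT, List.sum_toFinset _ hnodup, List.map_id']
  have hsub : l.Sublist [1, 2, 3, 5, 7, 10, 11, 13, 15, 16, 17, 23, 29, 31] :=
    List.filter_sublist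
  have hcert : DInt.cert l = true := by
    refine DInt.allSub_sound ?_ hsub
    rw [hlen]
    exact DInt.allSub_cert
  clear_value l
  refine DInt.cert_sound hcert ?_
  rw [hP, DInt.centeredPoly, hsum, ← hlT, List.prod_toFinset _ hnodup]

/-- The polynomial system for the remaining coordinates `(X, y, z)` of an isotropic subspace
after all coordinates entering linearly have been eliminated. -/
def IsNormSol (g2 g3 g4 g5 g6 g7 g8 g9 g10 X y z : ℂ) : Prop :=
  -(10 * X) * (3 * z) + 5 * y * (g4 - y) = g8 ∧
  g2 * (g7 - g2 * (3 * z) + 5 * y * (g3 - 7 * X))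
    - 10 * X * (g6 + (-g2 * (g4 - y) + 10 * X * (g3 - 7 * X)) / 2)
    + 5 * y * (g5 - 2 * z) = g9 ∧
  (g3 - 7 * X) * (g7 - g2 * (3 * z) + 5 * y * (g3 - 7 * X))
    - (g4 - y) * (g6 + (-g2 * (g4 - y) + 10 * X * (g3 - 7 * X)) / 2)
    + 3 * z * (g5 - 2 * z) = g10

theorem isNormSol_iff (g2 g3 g4 g5 g6 g7 g8 g9 g10 X y z : ℂ) :
    IsNormSol g2 g3 g4 g5 g6 g7 g8 g9 g10 X y z ↔
      y ^ 2 = -g8 / 5 + g4 * y + -6 * X * z ∧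
      y * z = (-g9 / 10 - X * g6 + g2 * g7 / 10 + X * g2 * g4 / 2 - 5 * X ^ 2 * g3 + 35 * X ^ 3)
        + (g5 / 2 - 4 * X * g2 + g2 * g3 / 2) * y + -(3 / 10) * g2 ^ 2 * z ∧
      z ^ 2 = (-g10 / 6 - 7 / 6 * X * g7 - g2 * g8 / 60 + g3 * g7 / 6 - g4 * g6 / 6
          - 5 / 6 * X * g3 * g4 + 35 / 6 * X ^ 2 * g4 + g2 * g4 ^ 2 / 12)
        + (g6 / 6 - 65 / 6 * X * g3 + 35 * X ^ 2 - g2 * g4 / 12 + 5 / 6 * g3 ^ 2) * y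
        + (g5 / 2 + 3 * X * g2 - g2 * g3 / 2) * z := by
  constructor
  · rintro ⟨h1, h2, h3⟩
    exact ⟨by linear_combination (-1 / 5) * h1, by linear_combination (-1 / 10) * h2,
      by linear_combination (-1 / 6) * h3 + (-g2 / 60) * h1⟩
  · rintro ⟨h1, h2, h3⟩
    exact ⟨by linear_combination (-5) * h1, by linear_combination (-10) * h2,
      by linear_combination (-6) * h3 + (g2 / 2) * h1⟩

theorem kernel_of_isNormSol {g2 g3 g4 g5 g6 g7 g8 g9 g10 X y z : ℂ}
    (h : IsNormSol g2 g3 g4 g5 g6 g7 g8 g9 g10 X y z) :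
    entry00 g2 g3 g4 g5 g6 g7 g8 g9 g10 X + entry01 g2 g3 g4 g5 g6 g7 g8 g9 g10 X * y
      + entry02 g2 g3 g4 g5 g6 g7 g8 g9 g10 X * z = 0 ∧
    entry01 g2 g3 g4 g5 g6 g7 g8 g9 g10 X + entry11 g2 g3 g4 g5 g6 g7 g8 g9 g10 X * y
      + entry12 g2 g3 g4 g5 g6 g7 g8 g9 g10 X * z = 0 ∧
    entry02 g2 g3 g4 g5 g6 g7 g8 g9 g10 X + entry12 g2 g3 g4 g5 g6 g7 g8 g9 g10 X * y
      + entry22 g2 g3 g4 g5 g6 g7 g8 g9 g10 X * z = 0 := by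
  rw [isNormSol_iff] at h
  obtain ⟨hy, hyz, hz⟩ := h
  have h1 : entry01 g2 g3 g4 g5 g6 g7 g8 g9 g10 X + entry11 g2 g3 g4 g5 g6 g7 g8 g9 g10 X * y
      + entry12 g2 g3 g4 g5 g6 g7 g8 g9 g10 X * z = 0 := by
    simp only [entry01, entry11, entry12]
    linear_combination 600 * (-z * hyz + y * hz - (g5 / 2 - 4 * X * g2 + g2 * g3 / 2) * hyz
      + (3 / 10) * g2 ^ 2 * hz
      + (g6 / 6 - 65 / 6 * X * g3 + 35 * X ^ 2 - g2 * g4 / 12 + 5 / 6 * g3 ^ 2) * hy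
      + (g5 / 2 + 3 * X * g2 - g2 * g3 / 2) * hyz)
  have h2 : entry02 g2 g3 g4 g5 g6 g7 g8 g9 g10 X + entry12 g2 g3 g4 g5 g6 g7 g8 g9 g10 X * y
      + entry22 g2 g3 g4 g5 g6 g7 g8 g9 g10 X * z = 0 := by
    simp only [entry02, entry12, entry22]
    linear_combination (-600) * (-z * hy + y * hyz - g4 * hyz + 6 * X * hz
      + (g5 / 2 - 4 * X * g2 + g2 * g3 / 2) * hy - (3 / 10) * g2 ^ 2 * hyz)
  refine ⟨?_, h1, h2⟩
  have e : entry00 g2 g3 g4 g5 g6 g7 g8 g9 g10 X + entry01 g2 g3 g4 g5 g6 g7 g8 g9 g10 X * y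
      + entry02 g2 g3 g4 g5 g6 g7 g8 g9 g10 X * z =
      (y - g4) * (entry01 g2 g3 g4 g5 g6 g7 g8 g9 g10 X
        + entry11 g2 g3 g4 g5 g6 g7 g8 g9 g10 X * y
        + entry12 g2 g3 g4 g5 g6 g7 g8 g9 g10 X * z)
      - (g5 / 2 - 4 * X * g2 + g2 * g3 / 2) * (entry02 g2 g3 g4 g5 g6 g7 g8 g9 g10 X
        + entry12 g2 g3 g4 g5 g6 g7 g8 g9 g10 X * y
        + entry22 g2 g3 g4 g5 g6 g7 g8 g9 g10 X * z) := by
    have e1 := congrArg (entry11 g2 g3 g4 g5 g6 g7 g8 g9 g10 X * ·) hy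
    have e2 := congrArg (entry12 g2 g3 g4 g5 g6 g7 g8 g9 g10 X * ·) hyz
    simp only [entry11, entry12] at e1 e2
    simp only [entry00, entry01, entry02, entry11, entry12, entry22]
    linear_combination -e1 - e2
  rw [e, h1, h2]
  ring

theorem proportional_aux {K : Type*} [Field K] {p q r s t w a0 a1 a2 b0 b1 b2 : K}
    (hmin : ¬ (s * w - t ^ 2 = 0 ∧ q * w - r * t = 0 ∧ q * t - r * s = 0 ∧ p * w - r ^ 2 = 0 ∧
      p * t - q * r = 0 ∧ p * s - q ^ 2 = 0))
    (ha0 : p * a0 + q * a1 + r * a2 = 0) (ha1 : q * a0 + s * a1 + t * a2 = 0)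
    (ha2 : r * a0 + t * a1 + w * a2 = 0)
    (hb0 : p * b0 + q * b1 + r * b2 = 0) (hb1 : q * b0 + s * b1 + t * b2 = 0)
    (hb2 : r * b0 + t * b1 + w * b2 = 0) :
    a0 * b1 = a1 * b0 := by
  by_contra hne
  have hu : a0 * b1 - a1 * b0 ≠ 0 := sub_ne_zero.mpr hne
  have cancel : ∀ v : K, (a0 * b1 - a1 * b0) * v = 0 → v = 0 := fun v h =>
    (mul_eq_zero.mp h).resolve_left hu
  have eq : (a0 * b1 - a1 * b0) * q = -(a0 * b2 - a2 * b0) * r := by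
    linear_combination a0 * hb0 - b0 * ha0
  have es : (a0 * b1 - a1 * b0) * s = -(a0 * b2 - a2 * b0) * t := by
    linear_combination a0 * hb1 - b0 * ha1
  have et : (a0 * b1 - a1 * b0) * t = -(a0 * b2 - a2 * b0) * w := by
    linear_combination a0 * hb2 - b0 * ha2
  have ep' : (a0 * b1 - a1 * b0) * p = (a1 * b2 - a2 * b1) * r := by
    linear_combination b1 * ha0 - a1 * hb0
  have eq' : (a0 * b1 - a1 * b0) * q = (a1 * b2 - a2 * b1) * t := by
    linear_combination b1 * ha1 - a1 * hb1
  have er' : (a0 * b1 - a1 * b0) * r = (a1 * b2 - a2 * b1) * w := by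
    linear_combination b1 * ha2 - a1 * hb2
  refine hmin ⟨cancel _ ?_, cancel _ ?_, cancel _ ?_, cancel _ ?_, cancel _ ?_,
    cancel _ (cancel _ ?_)⟩
  · linear_combination w * es - t * et
  · linear_combination w * eq - r * et
  · linear_combination t * eq - r * es
  · linear_combination w * ep' - r * er'
  · linear_combination t * ep' - r * eq'
  · linear_combination (a0 * b1 - a1 * b0) * (s * ep' - q * eq')
      + (a1 * b2 - a2 * b1) * (r * es - t * eq)

/-- Two kernel vectors of a symmetric matrix of size three with a nonvanishing minor of size two
are proportional. -/
theorem proportional_of_kernel {K : Type*} [Field K] {p q r s t w a0 a1 a2 b0 b1 b2 : K}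
    (hmin : ¬ (s * w - t ^ 2 = 0 ∧ q * w - r * t = 0 ∧ q * t - r * s = 0 ∧ p * w - r ^ 2 = 0 ∧
      p * t - q * r = 0 ∧ p * s - q ^ 2 = 0))
    (ha0 : p * a0 + q * a1 + r * a2 = 0) (ha1 : q * a0 + s * a1 + t * a2 = 0)
    (ha2 : r * a0 + t * a1 + w * a2 = 0)
    (hb0 : p * b0 + q * b1 + r * b2 = 0) (hb1 : q * b0 + s * b1 + t * b2 = 0)
    (hb2 : r * b0 + t * b1 + w * b2 = 0) :
    a0 * b1 = a1 * b0 ∧ a0 * b2 = a2 * b0 := by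
  refine ⟨proportional_aux hmin ha0 ha1 ha2 hb0 hb1 hb2,
    proportional_aux (p := p) (q := r) (r := q) (s := w) (t := t) (w := s) (a2 := a1) (b2 := b1)
      (fun h => hmin ?_) (by linear_combination ha0) (by linear_combination ha2)
      (by linear_combination ha1) (by linear_combination hb0) (by linear_combination hb2)
      (by linear_combination hb1)⟩
  obtain ⟨h1, h2, h3, h4, h5, h6⟩ := h
  exact ⟨by linear_combination h1, by linear_combination -h3, by linear_combination -h2,
    by linear_combination h6, by linear_combination h5, by linear_combination h4⟩

theorem exists_kernel_of_symDet {K : Type*} [Field K] {p q r s t w : K}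
    (h : symDet p q r s t w = 0) : ∃ a0 a1 a2 : K, ¬ (a0 = 0 ∧ a1 = 0 ∧ a2 = 0) ∧
      p * a0 + q * a1 + r * a2 = 0 ∧ q * a0 + s * a1 + t * a2 = 0 ∧
      r * a0 + t * a1 + w * a2 = 0 := by
  have hdet : (!![p, q, r; q, s, t; r, t, w] : Matrix (Fin 3) (Fin 3) K).det = 0 := by
    rw [Matrix.det_fin_three, ← h, symDet]
    simp
    ring
  obtain ⟨v, hv, hv0⟩ := Matrix.exists_mulVec_eq_zero_iff.mpr hdet
  refine ⟨v 0, v 1, v 2, fun h0 => hv ?_, ?_, ?_, ?_⟩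
  · ext i
    fin_cases i
    exacts [h0.1, h0.2.1, h0.2.2]
  · simpa [Matrix.mulVec, dotProduct, Fin.sum_univ_three] using congrFun hv0 0
  · simpa [Matrix.mulVec, dotProduct, Fin.sum_univ_three] using congrFun hv0 1
  · simpa [Matrix.mulVec, dotProduct, Fin.sum_univ_three] using congrFun hv0 2

theorem symDet_eq_zero_of_kernel {K : Type*} [Field K] {p q r s t w y z : K}
    (h0 : p + q * y + r * z = 0) (h1 : q + s * y + t * z = 0) (h2 : r + t * y + w * z = 0) :
    symDet p q r s t w = 0 := by
  rw [symDet]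
  linear_combination (s * w - t ^ 2) * h0 - (q * w - r * t) * h1 + (q * t - r * s) * h2

open Polynomial in
theorem minors_of_derivative {p q r s t w : ℤ[X]} {x : ℂ}
    (h : aeval x (derivative (symDet p q r s t w)) ≠ 0) :
    ¬ (aeval x s * aeval x w - aeval x t ^ 2 = 0 ∧ aeval x q * aeval x w - aeval x r * aeval x t = 0
      ∧ aeval x q * aeval x t - aeval x r * aeval x s = 0
      ∧ aeval x p * aeval x w - aeval x r ^ 2 = 0
      ∧ aeval x p * aeval x t - aeval x q * aeval x r = 0
      ∧ aeval x p * aeval x s - aeval x q ^ 2 = 0) := by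
  rintro ⟨h1, h2, h3, h4, h5, h6⟩
  refine h ?_
  simp only [symDet, derivative_mul, pow_two, map_add, map_sub,
    map_mul]
  linear_combination aeval x (derivative p) * h1 + aeval x (derivative s) * h4
    + aeval x (derivative w) * h6 - 2 * aeval x (derivative q) * h2
    + 2 * aeval x (derivative r) * h3 - 2 * aeval x (derivative t) * h5

section

variable {g2 g3 g4 g5 g6 g7 g8 g9 g10 X : ℂ}

theorem symDet_of_isNormSol {y z : ℂ} (h : IsNormSol g2 g3 g4 g5 g6 g7 g8 g9 g10 X y z) :
    symDet (entry00 g2 g3 g4 g5 g6 g7 g8 g9 g10 X) (entry01 g2 g3 g4 g5 g6 g7 g8 g9 g10 X)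
      (entry02 g2 g3 g4 g5 g6 g7 g8 g9 g10 X) (entry11 g2 g3 g4 g5 g6 g7 g8 g9 g10 X)
      (entry12 g2 g3 g4 g5 g6 g7 g8 g9 g10 X) (entry22 g2 g3 g4 g5 g6 g7 g8 g9 g10 X) = 0 :=
  have ⟨h0, h1, h2⟩ := kernel_of_isNormSol h
  symDet_eq_zero_of_kernel h0 h1 h2

/-- The algebra of the normalised system acts on the kernel of the matrix. -/
theorem kernel_mul {a0 a1 a2 : ℂ}
    (h0 : entry00 g2 g3 g4 g5 g6 g7 g8 g9 g10 X * a0 + entry01 g2 g3 g4 g5 g6 g7 g8 g9 g10 X * a1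
      + entry02 g2 g3 g4 g5 g6 g7 g8 g9 g10 X * a2 = 0)
    (h1 : entry01 g2 g3 g4 g5 g6 g7 g8 g9 g10 X * a0 + entry11 g2 g3 g4 g5 g6 g7 g8 g9 g10 X * a1
      + entry12 g2 g3 g4 g5 g6 g7 g8 g9 g10 X * a2 = 0)
    (h2 : entry02 g2 g3 g4 g5 g6 g7 g8 g9 g10 X * a0 + entry12 g2 g3 g4 g5 g6 g7 g8 g9 g10 X * a1
      + entry22 g2 g3 g4 g5 g6 g7 g8 g9 g10 X * a2 = 0)
    {A0 A1 A2 B0 B1 B2 C0 C1 C2 : ℂ} (hA0 : A0 = -g8 / 5) (hA1 : A1 = g4) (hA2 : A2 = -6 * X)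
    (hB0 : B0 = -g9 / 10 - X * g6 + g2 * g7 / 10 + X * g2 * g4 / 2 - 5 * X ^ 2 * g3 + 35 * X ^ 3)
    (hB1 : B1 = g5 / 2 - 4 * X * g2 + g2 * g3 / 2) (hB2 : B2 = -(3 / 10) * g2 ^ 2)
    (hC0 : C0 = -g10 / 6 - 7 / 6 * X * g7 - g2 * g8 / 60 + g3 * g7 / 6 - g4 * g6 / 6
          - 5 / 6 * X * g3 * g4 + 35 / 6 * X ^ 2 * g4 + g2 * g4 ^ 2 / 12)
    (hC1 : C1 = g6 / 6 - 65 / 6 * X * g3 + 35 * X ^ 2 - g2 * g4 / 12 + 5 / 6 * g3 ^ 2)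
    (hC2 : C2 = g5 / 2 + 3 * X * g2 - g2 * g3 / 2) :
    (entry00 g2 g3 g4 g5 g6 g7 g8 g9 g10 X * a1
      + entry01 g2 g3 g4 g5 g6 g7 g8 g9 g10 X * (A0 * a0 + A1 * a1 + A2 * a2)
      + entry02 g2 g3 g4 g5 g6 g7 g8 g9 g10 X * (B0 * a0 + B1 * a1 + B2 * a2) = 0 ∧
    entry01 g2 g3 g4 g5 g6 g7 g8 g9 g10 X * a1
      + entry11 g2 g3 g4 g5 g6 g7 g8 g9 g10 X * (A0 * a0 + A1 * a1 + A2 * a2)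
      + entry12 g2 g3 g4 g5 g6 g7 g8 g9 g10 X * (B0 * a0 + B1 * a1 + B2 * a2) = 0 ∧
    entry02 g2 g3 g4 g5 g6 g7 g8 g9 g10 X * a1
      + entry12 g2 g3 g4 g5 g6 g7 g8 g9 g10 X * (A0 * a0 + A1 * a1 + A2 * a2)
      + entry22 g2 g3 g4 g5 g6 g7 g8 g9 g10 X * (B0 * a0 + B1 * a1 + B2 * a2) = 0) ∧
    (entry00 g2 g3 g4 g5 g6 g7 g8 g9 g10 X * a2
      + entry01 g2 g3 g4 g5 g6 g7 g8 g9 g10 X * (B0 * a0 + B1 * a1 + B2 * a2)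
      + entry02 g2 g3 g4 g5 g6 g7 g8 g9 g10 X * (C0 * a0 + C1 * a1 + C2 * a2) = 0 ∧
    entry01 g2 g3 g4 g5 g6 g7 g8 g9 g10 X * a2
      + entry11 g2 g3 g4 g5 g6 g7 g8 g9 g10 X * (B0 * a0 + B1 * a1 + B2 * a2)
      + entry12 g2 g3 g4 g5 g6 g7 g8 g9 g10 X * (C0 * a0 + C1 * a1 + C2 * a2) = 0 ∧
    entry02 g2 g3 g4 g5 g6 g7 g8 g9 g10 X * a2
      + entry12 g2 g3 g4 g5 g6 g7 g8 g9 g10 X * (B0 * a0 + B1 * a1 + B2 * a2)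
      + entry22 g2 g3 g4 g5 g6 g7 g8 g9 g10 X * (C0 * a0 + C1 * a1 + C2 * a2) = 0) := by
  refine ⟨⟨?_, ?_, ?_⟩, ?_, ?_, ?_⟩
  · rw [hA0, hA1, hA2, hB0, hB1, hB2]
    linear_combination (norm := (simp only [entry00, entry01, entry02, entry11, entry12, entry22]; ring)) (-g8 / 5) * h1 + (-g9 / 10 - X * g6 + g2 * g7 / 10 + X * g2 * g4 / 2 - 5 * X ^ 2 * g3 + 35 * X ^ 3) * h2
  · rw [hA0, hA1, hA2, hB0, hB1, hB2]
    linear_combination (norm := (simp only [entry00, entry01, entry02, entry11, entry12, entry22]; ring)) h0 + g4 * h1 + (g5 / 2 - 4 * X * g2 + g2 * g3 / 2) * h2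
  · rw [hA0, hA1, hA2, hB0, hB1, hB2]
    linear_combination (norm := (simp only [entry00, entry01, entry02, entry11, entry12, entry22]; ring)) (-6 * X) * h1 + (-(3 / 10) * g2 ^ 2) * h2
  · rw [hB0, hB1, hB2, hC0, hC1, hC2]
    linear_combination (norm := (simp only [entry00, entry01, entry02, entry11, entry12, entry22]; ring)) (-g9 / 10 - X * g6 + g2 * g7 / 10 + X * g2 * g4 / 2 - 5 * X ^ 2 * g3 + 35 * X ^ 3) * h1 + (-g10 / 6 - 7 / 6 * X * g7 - g2 * g8 / 60 + g3 * g7 / 6 - g4 * g6 / 6 - 5 / 6 * X * g3 * g4 + 35 / 6 * X ^ 2 * g4 + g2 * g4 ^ 2 / 12) * h2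
  · rw [hB0, hB1, hB2, hC0, hC1, hC2]
    linear_combination (norm := (simp only [entry00, entry01, entry02, entry11, entry12, entry22]; ring)) (g5 / 2 - 4 * X * g2 + g2 * g3 / 2) * h1 + (g6 / 6 - 65 / 6 * X * g3 + 35 * X ^ 2 - g2 * g4 / 12 + 5 / 6 * g3 ^ 2) * h2
  · rw [hB0, hB1, hB2, hC0, hC1, hC2]
    linear_combination (norm := (simp only [entry00, entry01, entry02, entry11, entry12, entry22]; ring)) h0 + (-(3 / 10) * g2 ^ 2) * h1 + (g5 / 2 + 3 * X * g2 - g2 * g3 / 2) * h2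

/-- The matrix has corank at most one. -/
def CorankLEOne (g2 g3 g4 g5 g6 g7 g8 g9 g10 X : ℂ) : Prop :=
  ¬ (entry11 g2 g3 g4 g5 g6 g7 g8 g9 g10 X * entry22 g2 g3 g4 g5 g6 g7 g8 g9 g10 X
      - entry12 g2 g3 g4 g5 g6 g7 g8 g9 g10 X ^ 2 = 0 ∧
    entry01 g2 g3 g4 g5 g6 g7 g8 g9 g10 X * entry22 g2 g3 g4 g5 g6 g7 g8 g9 g10 X
      - entry02 g2 g3 g4 g5 g6 g7 g8 g9 g10 X * entry12 g2 g3 g4 g5 g6 g7 g8 g9 g10 X = 0 ∧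
    entry01 g2 g3 g4 g5 g6 g7 g8 g9 g10 X * entry12 g2 g3 g4 g5 g6 g7 g8 g9 g10 X
      - entry02 g2 g3 g4 g5 g6 g7 g8 g9 g10 X * entry11 g2 g3 g4 g5 g6 g7 g8 g9 g10 X = 0 ∧
    entry00 g2 g3 g4 g5 g6 g7 g8 g9 g10 X * entry22 g2 g3 g4 g5 g6 g7 g8 g9 g10 X
      - entry02 g2 g3 g4 g5 g6 g7 g8 g9 g10 X ^ 2 = 0 ∧
    entry00 g2 g3 g4 g5 g6 g7 g8 g9 g10 X * entry12 g2 g3 g4 g5 g6 g7 g8 g9 g10 X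
      - entry01 g2 g3 g4 g5 g6 g7 g8 g9 g10 X * entry02 g2 g3 g4 g5 g6 g7 g8 g9 g10 X = 0 ∧
    entry00 g2 g3 g4 g5 g6 g7 g8 g9 g10 X * entry11 g2 g3 g4 g5 g6 g7 g8 g9 g10 X
      - entry01 g2 g3 g4 g5 g6 g7 g8 g9 g10 X ^ 2 = 0)

theorem CorankLEOne.unique (hX : CorankLEOne g2 g3 g4 g5 g6 g7 g8 g9 g10 X) {y z y' z' : ℂ}
    (h : IsNormSol g2 g3 g4 g5 g6 g7 g8 g9 g10 X y z)
    (h' : IsNormSol g2 g3 g4 g5 g6 g7 g8 g9 g10 X y' z') : y = y' ∧ z = z' := by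
  obtain ⟨h0, h1, h2⟩ := kernel_of_isNormSol h
  obtain ⟨h0', h1', h2'⟩ := kernel_of_isNormSol h'
  have := proportional_of_kernel hX (a0 := 1) (a1 := y) (a2 := z)
    (b0 := 1) (b1 := y') (b2 := z') (by linear_combination h0)
    (by linear_combination h1) (by linear_combination h2) (by linear_combination h0')
    (by linear_combination h1') (by linear_combination h2')
  exact ⟨by linear_combination -this.1, by linear_combination -this.2⟩

theorem CorankLEOne.exists_isNormSol (hX : CorankLEOne g2 g3 g4 g5 g6 g7 g8 g9 g10 X)
    (hdet : symDet (entry00 g2 g3 g4 g5 g6 g7 g8 g9 g10 X)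
      (entry01 g2 g3 g4 g5 g6 g7 g8 g9 g10 X)
      (entry02 g2 g3 g4 g5 g6 g7 g8 g9 g10 X) (entry11 g2 g3 g4 g5 g6 g7 g8 g9 g10 X)
      (entry12 g2 g3 g4 g5 g6 g7 g8 g9 g10 X) (entry22 g2 g3 g4 g5 g6 g7 g8 g9 g10 X) = 0) :
    ∃ y z, IsNormSol g2 g3 g4 g5 g6 g7 g8 g9 g10 X y z := by
  obtain ⟨a0, a1, a2, hne, h0, h1, h2⟩ := exists_kernel_of_symDet hdet
  obtain ⟨⟨k0, k1, k2⟩, l0, l1, l2⟩ := kernel_mul h0 h1 h2 rfl rfl rfl rfl rfl rfl rfl rfl rfl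
  obtain ⟨p1, p2⟩ := proportional_of_kernel hX h0 h1 h2 k0 k1 k2
  obtain ⟨-, q2⟩ := proportional_of_kernel hX h0 h1 h2 l0 l1 l2
  have ha0 : a0 ≠ 0 := by
    rintro rfl
    have e1 : a1 ^ 2 = 0 := by linear_combination -p1
    have e2 : a2 ^ 2 = 0 := by linear_combination -q2
    exact hne ⟨rfl, by simpa using e1, by simpa using e2⟩
  obtain ⟨y, rfl⟩ : ∃ y, a1 = y * a0 := ⟨a1 / a0, by field_simp⟩
  obtain ⟨z, rfl⟩ : ∃ z, a2 = z * a0 := ⟨a2 / a0, by field_simp⟩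
  have ha0' := pow_ne_zero 2 ha0
  exact ⟨y, z, (isNormSol_iff ..).mpr ⟨mul_left_cancel₀ ha0' (by linear_combination -p1),
    mul_left_cancel₀ ha0' (by linear_combination -p2),
    mul_left_cancel₀ ha0' (by linear_combination -q2)⟩⟩

theorem HasRealSpectrum.isNormSol (h : HasRealSpectrum g2 g3 g4 g5 g6 g7 g8 g9 g10) :
    {v : ℂ × ℂ × ℂ | IsNormSol g2 g3 g4 g5 g6 g7 g8 g9 g10 v.1 v.2.1 v.2.2}.ncard = 12 ∧
    ∀ X y z, IsNormSol g2 g3 g4 g5 g6 g7 g8 g9 g10 X y z →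
      X.im = 0 ∧ CorankLEOne g2 g3 g4 g5 g6 g7 g8 g9 g10 X := by
  obtain ⟨p, q, r, s, t, w, hev, hcard, hroot⟩ := h
  have hdet : ∀ x : ℂ, Polynomial.aeval x (symDet p q r s t w) =
      symDet (entry00 g2 g3 g4 g5 g6 g7 g8 g9 g10 x) (entry01 g2 g3 g4 g5 g6 g7 g8 g9 g10 x)
      (entry02 g2 g3 g4 g5 g6 g7 g8 g9 g10 x) (entry11 g2 g3 g4 g5 g6 g7 g8 g9 g10 x)
      (entry12 g2 g3 g4 g5 g6 g7 g8 g9 g10 x) (entry22 g2 g3 g4 g5 g6 g7 g8 g9 g10 x) := by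
    intro x
    obtain ⟨e0, e1, e2, e3, e4, e5⟩ := hev x
    simp only [symDet, map_add, map_sub, map_mul, map_pow, e0, e1, e2, e3, e4, e5]
  have hne : symDet p q r s t w ≠ 0 := by
    intro h0
    rw [h0] at hcard
    simp at hcard
  have hcorank : ∀ x : ℂ, Polynomial.aeval x (symDet p q r s t w) = 0 →
      CorankLEOne g2 g3 g4 g5 g6 g7 g8 g9 g10 x := by
    intro x hx
    have := minors_of_derivative (hroot x hx).2
    obtain ⟨e0, e1, e2, e3, e4, e5⟩ := hev x
    rwa [e0, e1, e2, e3, e4, e5] at this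
  have hsol : ∀ X y z, IsNormSol g2 g3 g4 g5 g6 g7 g8 g9 g10 X y z →
      Polynomial.aeval X (symDet p q r s t w) = 0 := fun X y z hs => by
    rw [hdet, symDet_of_isNormSol hs]
  refine ⟨?_, fun X y z hs => ⟨(hroot X (hsol X y z hs)).1, hcorank X (hsol X y z hs)⟩⟩
  rw [← hcard]
  refine Set.ncard_congr (fun v _ => v.1) ?_ ?_ ?_
  · rintro ⟨X, y, z⟩ hv
    rw [Polynomial.mem_rootSet_of_ne hne]
    exact hsol X y z hv
  · rintro ⟨X, y, z⟩ ⟨X', y', z'⟩ hv hv' rfl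
    obtain ⟨rfl, rfl⟩ := (hcorank _ (hsol X y z hv)).unique hv hv'
    rfl
  · intro X hX
    rw [Polynomial.mem_rootSet_of_ne hne] at hX
    obtain ⟨y, z, hs⟩ := (hcorank X hX).exists_isNormSol (hdet X ▸ hX)
    exact ⟨(X, y, z), hs, rfl⟩

theorem IsNormSol.conj {y z : ℂ} (h : IsNormSol g2 g3 g4 g5 g6 g7 g8 g9 g10 X y z) :
    IsNormSol (starRingEnd ℂ g2) (starRingEnd ℂ g3) (starRingEnd ℂ g4) (starRingEnd ℂ g5)
      (starRingEnd ℂ g6) (starRingEnd ℂ g7) (starRingEnd ℂ g8) (starRingEnd ℂ g9)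
      (starRingEnd ℂ g10) (starRingEnd ℂ X) (starRingEnd ℂ y) (starRingEnd ℂ z) := by
  obtain ⟨h1, h2, h3⟩ := h
  refine ⟨?_, ?_, ?_⟩
  · rw [← h1]
    simp [Complex.conj_ofNat]
  · rw [← h2]
    simp [Complex.conj_ofNat]
  · rw [← h3]
    simp [Complex.conj_ofNat]

end

section Geometry

/-- The derivative of order `j` of the curve in `ℂ⁹` at `s`. -/
noncomputable def osc (j : ℕ) (s : ℂ) : Fin (2 * 4 + 1) → ℂ :=
  fun i => iteratedDeriv j (gammaOC 4 i) s

theorem osc_apply (j : ℕ) (s : ℂ) (i : Fin (2 * 4 + 1)) :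
    osc j s i = (-1) ^ ((i : ℕ) - 4) / ((i : ℕ).factorial : ℂ) *
      (((i : ℕ).descFactorial j : ℂ) * s ^ ((i : ℕ) - j)) := by
  have : gammaOC 4 i = fun s => (-1 : ℂ) ^ ((i : ℕ) - 4) / ((i : ℕ).factorial : ℂ) * s ^ (i : ℕ) := by
    ext s
    rw [gammaOC]
    ring
  rw [osc, this, iteratedDeriv_const_mul_field]
  congr 1
  simp

theorem formOC_four (x y : Fin (2 * 4 + 1) → ℂ) : formOC 4 x y =
    x 0 * y 8 + x 1 * y 7 + x 2 * y 6 + x 3 * y 5 + x 4 * y 4 + x 5 * y 3 + x 6 * y 2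
      + x 7 * y 1 + x 8 * y 0 := by
  change ∑ i : Fin 9, x i * y (pairOC 4 i) = _
  simp only [Fin.sum_univ_castSucc, Fin.sum_univ_zero, zero_add]
  rfl

theorem formOC_osc_0 (x : Fin (2 * 4 + 1) → ℂ) (s : ℂ) : formOC 4 x (osc 0 s) =
    x 8 + x 7 * s + x 6 * s ^ 2 / 2 + x 5 * s ^ 3 / 6 + x 4 * s ^ 4 / 24 - x 3 * s ^ 5 / 120 + x 2 * s ^ 6 / 720 - x 1 * s ^ 7 / 5040 + x 0 * s ^ 8 / 40320 := by
  simp [formOC_four, osc_apply, Nat.descFactorial, Nat.factorial]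
  ring

theorem formOC_osc_1 (x : Fin (2 * 4 + 1) → ℂ) (s : ℂ) : formOC 4 x (osc 1 s) =
    x 7 + x 6 * s + x 5 * s ^ 2 / 2 + x 4 * s ^ 3 / 6 - x 3 * s ^ 4 / 24 + x 2 * s ^ 5 / 120 - x 1 * s ^ 6 / 720 + x 0 * s ^ 7 / 5040 := by
  simp [formOC_four, osc_apply, Nat.descFactorial, Nat.factorial]
  ring

theorem formOC_osc_2 (x : Fin (2 * 4 + 1) → ℂ) (s : ℂ) : formOC 4 x (osc 2 s) =
    x 6 + x 5 * s + x 4 * s ^ 2 / 2 - x 3 * s ^ 3 / 6 + x 2 * s ^ 4 / 24 - x 1 * s ^ 5 / 120 + x 0 * s ^ 6 / 720 := by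
  simp [formOC_four, osc_apply, Nat.descFactorial, Nat.factorial]
  ring

theorem formOC_osc_3 (x : Fin (2 * 4 + 1) → ℂ) (s : ℂ) : formOC 4 x (osc 3 s) =
    x 5 + x 4 * s - x 3 * s ^ 2 / 2 + x 2 * s ^ 3 / 6 - x 1 * s ^ 4 / 24 + x 0 * s ^ 5 / 120 := by
  simp [formOC_four, osc_apply, Nat.descFactorial, Nat.factorial]
  ring

theorem formOC_osc_4 (x : Fin (2 * 4 + 1) → ℂ) (s : ℂ) : formOC 4 x (osc 4 s) =
    x 4 - x 3 * s + x 2 * s ^ 2 / 2 - x 1 * s ^ 3 / 6 + x 0 * s ^ 4 / 24 := by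
  simp [formOC_four, osc_apply, Nat.descFactorial, Nat.factorial]
  ring

theorem formOC_osc_5 (x : Fin (2 * 4 + 1) → ℂ) (s : ℂ) : formOC 4 x (osc 5 s) =
    -x 3 + x 2 * s - x 1 * s ^ 2 / 2 + x 0 * s ^ 3 / 6 := by
  simp [formOC_four, osc_apply, Nat.descFactorial, Nat.factorial]
  ring

theorem formOC_osc_6 (x : Fin (2 * 4 + 1) → ℂ) (s : ℂ) : formOC 4 x (osc 6 s) =
    x 2 - x 1 * s + x 0 * s ^ 2 / 2 := by
  simp [formOC_four, osc_apply, Nat.descFactorial, Nat.factorial]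
  ring

theorem formOC_osc_7 (x : Fin (2 * 4 + 1) → ℂ) (s : ℂ) : formOC 4 x (osc 7 s) =
    -x 1 + x 0 * s := by
  simp [formOC_four, osc_apply, Nat.descFactorial, Nat.factorial]
  ring

theorem formOC_osc_8 (x : Fin (2 * 4 + 1) → ℂ) (s : ℂ) : formOC 4 x (osc 8 s) =
    x 0 := by
  simp [formOC_four, osc_apply, Nat.descFactorial, Nat.factorial]
  ring

theorem formOC_add_left (x y z : Fin (2 * 4 + 1) → ℂ) :
    formOC 4 (x + y) z = formOC 4 x z + formOC 4 y z := by
  simp [formOC, add_mul, Finset.sum_add_distrib]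

theorem formOC_smul_left (a : ℂ) (x z : Fin (2 * 4 + 1) → ℂ) :
    formOC 4 (a • x) z = a * formOC 4 x z := by
  simp [formOC, Finset.mul_sum, mul_assoc]

theorem formOC_comm (x y : Fin (2 * 4 + 1) → ℂ) : formOC 4 x y = formOC 4 y x := by
  rw [formOC_four, formOC_four]
  ring

theorem osc_expansion (x : Fin (2 * 4 + 1) → ℂ) (s : ℂ) :
    x = formOC 4 x (osc 8 s) • osc 0 s - formOC 4 x (osc 7 s) • osc 1 s
      + formOC 4 x (osc 6 s) • osc 2 s - formOC 4 x (osc 5 s) • osc 3 s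
      + formOC 4 x (osc 4 s) • osc 4 s - formOC 4 x (osc 3 s) • osc 5 s
      + formOC 4 x (osc 2 s) • osc 6 s - formOC 4 x (osc 1 s) • osc 7 s
      + formOC 4 x (osc 0 s) • osc 8 s := by
  rw [formOC_osc_0, formOC_osc_1, formOC_osc_2, formOC_osc_3, formOC_osc_4, formOC_osc_5,
    formOC_osc_6, formOC_osc_7, formOC_osc_8]
  ext i
  obtain ⟨i, hi⟩ := i
  have hi' : i < 9 := hi
  interval_cases i <;>
  simp [osc_apply, Nat.descFactorial, Nat.factorial] <;> ring

theorem mem_oscOC_five_iff (x : Fin (2 * 4 + 1) → ℂ) (s : ℂ) :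
    x ∈ oscOC 4 5 s ↔ formOC 4 x (osc 0 s) = 0 ∧ formOC 4 x (osc 1 s) = 0 ∧
      formOC 4 x (osc 2 s) = 0 ∧ formOC 4 x (osc 3 s) = 0 := by
  change x ∈ Submodule.span ℂ (Set.range fun j : Fin 5 => osc j s) ↔ _
  constructor
  · intro hx
    induction hx using Submodule.span_induction with
    | mem x hx =>
      obtain ⟨j, rfl⟩ := hx
      rw [formOC_osc_0, formOC_osc_1, formOC_osc_2, formOC_osc_3]
      fin_cases j <;>
      refine ⟨?_, ?_, ?_, ?_⟩ <;>
      simp [osc_apply, Nat.descFactorial, Nat.factorial] <;> ring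
    | zero => simp [formOC]
    | add x y _ _ hx hy =>
      rw [formOC_add_left, formOC_add_left, formOC_add_left, formOC_add_left]
      simp [hx, hy]
    | smul a x _ hx =>
      rw [formOC_smul_left, formOC_smul_left, formOC_smul_left, formOC_smul_left]
      simp [hx]
  · rintro ⟨h0, h1, h2, h3⟩
    rw [osc_expansion x s, h0, h1, h2, h3]
    simp only [zero_smul, sub_zero, add_zero]
    have mem : ∀ j : Fin 5, osc j s ∈ Submodule.span ℂ (Set.range fun j : Fin 5 => osc j s) :=
      fun j => Submodule.subset_span ⟨j, rfl⟩
    have mem_smul := fun (j : Fin 5) (c : ℂ) => Submodule.smul_mem _ c (mem j)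
    exact add_mem (sub_mem (add_mem (sub_mem (mem_smul 0 _) (mem_smul 1 _)) (mem_smul 2 _))
      (mem_smul 3 _)) (mem_smul 4 _)

/-- A subspace meets the osculating five-space at `s` iff it contains a nonzero vector orthogonal
to the osculating four-space. -/
theorem inf_oscOC_five_ne_bot_iff (H : Submodule ℂ (Fin (2 * 4 + 1) → ℂ)) (s : ℂ) :
    H ⊓ oscOC 4 5 s ≠ ⊥ ↔ ∃ x ∈ H, x ≠ 0 ∧ formOC 4 x (osc 0 s) = 0 ∧
      formOC 4 x (osc 1 s) = 0 ∧ formOC 4 x (osc 2 s) = 0 ∧ formOC 4 x (osc 3 s) = 0 := by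
  rw [Submodule.ne_bot_iff]
  simp only [Submodule.mem_inf, mem_oscOC_five_iff]
  exact ⟨fun ⟨x, ⟨hx, h⟩, hx0⟩ => ⟨x, hx, hx0, h⟩, fun ⟨x, hx, hx0, h⟩ => ⟨x, ⟨hx, h⟩, hx0⟩⟩

theorem formOC_eq_osc (x y : Fin (2 * 4 + 1) → ℂ) (s : ℂ) : formOC 4 x y =
    formOC 4 x (osc 8 s) * formOC 4 y (osc 0 s) - formOC 4 x (osc 7 s) * formOC 4 y (osc 1 s)
      + formOC 4 x (osc 6 s) * formOC 4 y (osc 2 s) - formOC 4 x (osc 5 s) * formOC 4 y (osc 3 s)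
      + formOC 4 x (osc 4 s) * formOC 4 y (osc 4 s) - formOC 4 x (osc 3 s) * formOC 4 y (osc 5 s)
      + formOC 4 x (osc 2 s) * formOC 4 y (osc 6 s) - formOC 4 x (osc 1 s) * formOC 4 y (osc 7 s)
      + formOC 4 x (osc 0 s) * formOC 4 y (osc 8 s) := by
  conv_lhs => rw [osc_expansion x s]
  simp only [sub_eq_add_neg, ← neg_smul, formOC_add_left, formOC_smul_left, neg_mul]
  simp only [formOC_comm (osc _ s) y]

theorem formOC_osc_four_eq_zero {x : Fin (2 * 4 + 1) → ℂ} {s : ℂ} (hx : formOC 4 x x = 0)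
    (h0 : formOC 4 x (osc 0 s) = 0) (h1 : formOC 4 x (osc 1 s) = 0)
    (h2 : formOC 4 x (osc 2 s) = 0) (h3 : formOC 4 x (osc 3 s) = 0) :
    formOC 4 x (osc 4 s) = 0 := by
  rw [formOC_eq_osc x x s, h0, h1, h2, h3] at hx
  simpa using hx

end Geometry

section Wronskian

open Polynomial

theorem Polynomial.natDegree_det_le {n R : Type*} [Fintype n] [DecidableEq n] [CommRing R]
    (M : Matrix n n R[X]) {N : ℕ} (hM : ∀ i j, (M i j).natDegree ≤ N) :
    M.det.natDegree ≤ Fintype.card n * N := by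
  rw [Matrix.det_apply]
  refine natDegree_sum_le_of_forall_le _ _ fun σ _ => ?_
  refine (natDegree_smul_le _ _).trans ((natDegree_prod_le _ _).trans ?_)
  simpa using Finset.sum_le_card_nsmul Finset.univ _ N fun i _ => hM (σ i) i

theorem Polynomial.coeff_det_of_natDegree_le {n R : Type*} [Fintype n] [DecidableEq n]
    [CommRing R] (M : Matrix n n R[X]) {N : ℕ} (hM : ∀ i j, (M i j).natDegree ≤ N) :
    M.det.coeff (Fintype.card n * N) = (Matrix.of fun i j => (M i j).coeff N).det := by
  rw [Matrix.det_apply, Matrix.det_apply, finsetSum_coeff]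
  refine Finset.sum_congr rfl fun σ _ => ?_
  rw [coeff_smul, ← Finset.card_univ, coeff_prod_of_natDegree_le _ _ _ fun i _ => hM (σ i) i]
  rfl

/-- The Wronskian matrix of a family of polynomials. -/
noncomputable def wronskianMatrix {n : ℕ} (p : Fin n → ℂ[X]) : Matrix (Fin n) (Fin n) ℂ[X] :=
  Matrix.of fun i j => derivative^[j] (p i)

theorem natDegree_X_pow_mul_iterate_derivative_le (p : ℂ[X]) (j : ℕ) :
    (X ^ j * derivative^[j] p).natDegree ≤ p.natDegree := by
  by_cases h : p.natDegree < j
  · rw [iterate_derivative_eq_zero h]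
    simp
  · refine natDegree_mul_le.trans ?_
    rw [natDegree_X_pow]
    have := natDegree_iterate_derivative p j
    omega

theorem coeff_X_pow_mul_iterate_derivative (p : ℂ[X]) (j m : ℕ) :
    (X ^ j * derivative^[j] p).coeff m = m.descFactorial j * p.coeff m := by
  rw [coeff_X_pow_mul']
  split_ifs with h
  · rw [coeff_iterate_derivative, Nat.sub_add_cancel h, nsmul_eq_mul]
  · rw [Nat.descFactorial_eq_zero_iff_lt.mpr (not_le.mp h)]
    simp

theorem det_wronskianMatrix {n : ℕ} {p : Fin n → ℂ[X]} (hp : ∀ i, p i ≠ 0)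
    (hinj : Function.Injective fun i => (p i).natDegree) :
    (wronskianMatrix p).det ≠ 0 ∧
      (wronskianMatrix p).det.natDegree + ∑ j : Fin n, (j : ℕ) = ∑ i, (p i).natDegree := by
  set N := ∑ i, (p i).natDegree with hN
  have hle : ∀ i, (p i).natDegree ≤ N := fun i =>
    Finset.single_le_sum (f := fun i => (p i).natDegree) (fun _ _ => Nat.zero_le _)
      (Finset.mem_univ i)
  let M : Matrix (Fin n) (Fin n) ℂ[X] := Matrix.of fun i j =>
    X ^ (N - (p i).natDegree) * (X ^ (j : ℕ) * derivative^[j] (p i))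
  have hM : ∀ i j, (M i j).natDegree ≤ N := fun i j => by
    change (X ^ (N - (p i).natDegree) * (X ^ (j : ℕ) * derivative^[j] (p i))).natDegree ≤ N
    refine natDegree_mul_le.trans ?_
    rw [natDegree_X_pow]
    have := natDegree_X_pow_mul_iterate_derivative_le (p i) j
    have := hle i
    omega
  have hdet : M.det = X ^ (∑ i, (N - (p i).natDegree)) * (X ^ (∑ j : Fin n, (j : ℕ)) *
      (wronskianMatrix p).det) := by
    rw [← Finset.prod_pow_eq_pow_sum, ← Finset.prod_pow_eq_pow_sum, ← Matrix.det_mul_row,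
      ← Matrix.det_mul_column]
    rfl
  have hcoeff : M.det.coeff (n * N) ≠ 0 := by
    have := coeff_det_of_natDegree_le M hM
    rw [Fintype.card_fin] at this
    rw [this]
    have hT : (Matrix.of fun i j => (M i j).coeff N) = Matrix.of fun i j =>
        (p i).leadingCoeff * (Matrix.of fun i j : Fin n =>
          (descPochhammer ℂ j).eval ((p i).natDegree : ℂ)) i j := by
      ext i j
      simp only [M, Matrix.of_apply, descPochhammer_eval_eq_descFactorial]
      rw [coeff_X_pow_mul', if_pos (Nat.sub_le _ _), Nat.sub_sub_self (hle i),
        coeff_X_pow_mul_iterate_derivative, leadingCoeff, mul_comm]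
    rw [hT, Matrix.det_mul_column, ← Matrix.det_eval_matrixOfPolynomials_eq_det_vandermonde
      (fun i => ((p i).natDegree : ℂ)) (fun j : Fin n => descPochhammer ℂ j)
      (fun j => descPochhammer_natDegree ℂ j) (fun j => monic_descPochhammer ℂ j)]
    refine mul_ne_zero (Finset.prod_ne_zero_iff.mpr fun i _ => leadingCoeff_ne_zero.mpr (hp i))
      (Matrix.det_vandermonde_ne_zero_iff.mpr fun i j hij => hinj (Nat.cast_injective hij))
  have hM0 : M.det ≠ 0 := fun h => hcoeff (by rw [h, coeff_zero])
  have hW0 : (wronskianMatrix p).det ≠ 0 := fun h => hM0 (by rw [hdet, h, mul_zero, mul_zero])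
  refine ⟨hW0, ?_⟩
  have hdeg : M.det.natDegree = n * N := by
    refine le_antisymm ?_ (le_natDegree_of_ne_zero hcoeff)
    simpa using natDegree_det_le M hM
  rw [hdet, natDegree_mul (pow_ne_zero _ X_ne_zero) (mul_ne_zero (pow_ne_zero _ X_ne_zero) hW0),
    natDegree_mul (pow_ne_zero _ X_ne_zero) hW0, natDegree_X_pow, natDegree_X_pow] at hdeg
  have hsum : ∑ i, (N - (p i).natDegree) + ∑ i, (p i).natDegree = n * N := by
    rw [← Finset.sum_add_distrib, Finset.sum_congr rfl fun i _ => Nat.sub_add_cancel (hle i)]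
    simp
  omega

theorem sq_dvd_det_wronskianMatrix {n : ℕ} {p : Fin n → ℂ[X]} {c : Fin n → ℂ} (hc : c ≠ 0)
    {s : ℂ} (h : (X - C s) ^ (n + 1) ∣ ∑ i, C (c i) * p i) :
    (X - C s) ^ 2 ∣ (wronskianMatrix p).det := by
  obtain ⟨k, hk⟩ := Function.ne_iff.mp hc
  have hrow : ∀ j : Fin n, (X - C s) ^ 2 ∣ derivative^[j] (∑ i, C (c i) * p i) := fun j =>
    (pow_dvd_pow _ (by omega)).trans (pow_sub_dvd_iterate_derivative_of_pow_dvd j h)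
  choose r hr using hrow
  have h1 := Matrix.det_updateRow_sum (wronskianMatrix p) k fun i => C (c i)
  have h2 : (∑ i, C (c i) • (wronskianMatrix p) i) = (X - C s) ^ 2 • r := by
    ext1 j
    rw [Finset.sum_apply, Pi.smul_apply, smul_eq_mul, ← hr, iterate_derivative_sum]
    simp [wronskianMatrix]
  rw [h2, Matrix.det_updateRow_smul, smul_eq_mul] at h1
  have hu : IsUnit (C (c k)) := isUnit_C.mpr (isUnit_iff_ne_zero.mpr hk)
  rw [← hu.dvd_mul_left, ← h1]
  exact dvd_mul_right _ _

end Wronskian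

section BigCell

open Polynomial

theorem Polynomial.linearIndependent_of_injective_natDegree {n : ℕ} {p : Fin n → ℂ[X]}
    (hp : ∀ i, p i ≠ 0) (hinj : Function.Injective fun i => (p i).natDegree) :
    LinearIndependent ℂ p := by
  rw [Fintype.linearIndependent_iff]
  intro c hc
  have hdeg := degree_sum_eq_of_disjoint (fun i => c i • p i) Finset.univ (by
    rintro i ⟨-, hi⟩ j ⟨-, hj⟩ hij
    have hi0 : c i ≠ 0 := fun h => hi (by simp [h])
    have hj0 : c j ≠ 0 := fun h => hj (by simp [h])
    simp only [Function.onFun, Function.comp_apply, degree_smul_of_smul_regular _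
      (IsSMulRegular.of_ne_zero hi0), degree_smul_of_smul_regular _
      (IsSMulRegular.of_ne_zero hj0), degree_eq_natDegree (hp i), degree_eq_natDegree (hp j)]
    exact fun h => hij (hinj (by exact_mod_cast h)))
  intro i
  have hi : (c i • p i).degree ≤ ⊥ := by
    rw [← degree_zero (R := ℂ), ← hc, hdeg]
    exact Finset.le_sup (f := fun i => (c i • p i).degree) (Finset.mem_univ i)
  rw [le_bot_iff, degree_eq_bot] at hi
  exact (smul_eq_zero.mp hi).resolve_right (hp i)

/-- A finite-dimensional space of polynomials realises at least as many degrees as its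
dimension. -/
theorem Polynomial.finrank_le_card_of_natDegree_mem (Q : Submodule ℂ ℂ[X]) (D : Finset ℕ)
    (hD : ∀ q ∈ Q, q ≠ 0 → q.natDegree ∈ D) : Module.finrank ℂ Q ≤ D.card := by
  have hinj : Function.Injective
      ((LinearMap.pi fun d : D => lcoeff ℂ (d : ℕ)) ∘ₗ Q.subtype : Q →ₗ[ℂ] D → ℂ) := by
    rw [injective_iff_map_eq_zero]
    rintro ⟨q, hq⟩ h
    by_contra hne
    have hq0 : q ≠ 0 := fun h0 => hne (Subtype.ext h0)
    have := congrFun h ⟨q.natDegree, hD q hq hq0⟩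
    simp [hq0] at this
  simpa using LinearMap.finrank_le_finrank_of_injective hinj

/-- The polynomial `t ↦ B(x, γ(t))`. -/
noncomputable def pairingPoly : (Fin (2 * 4 + 1) → ℂ) →ₗ[ℂ] ℂ[X] :=
  ∑ i : Fin (2 * 4 + 1), (monomial (8 - (i : ℕ))).comp
    (((-1 : ℂ) ^ ((8 - (i : ℕ)) - 4) / ((8 - (i : ℕ)).factorial : ℂ)) • LinearMap.proj i)

theorem eval_iterate_derivative_pairingPoly (x : Fin (2 * 4 + 1) → ℂ) (j : ℕ) (s : ℂ) :
    (derivative^[j] (pairingPoly x)).eval s = formOC 4 x (osc j s) := by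
  simp only [pairingPoly, LinearMap.sum_apply, iterate_derivative_sum, eval_finsetSum, formOC]
  refine Finset.sum_congr rfl fun i _ => ?_
  rw [osc_apply]
  simp only [LinearMap.comp_apply, LinearMap.smul_apply, LinearMap.proj_apply, smul_eq_mul,
    ← C_mul_X_pow_eq_monomial, iterate_derivative_C_mul, iterate_derivative_X_pow_eq_natCast_mul,
    eval_mul, eval_C, eval_natCast, eval_pow, eval_X, pairOC]
  ring

theorem coeff_pairingPoly (x : Fin (2 * 4 + 1) → ℂ) (i : Fin (2 * 4 + 1)) :
    (pairingPoly x).coeff (8 - (i : ℕ)) =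
      (-1 : ℂ) ^ ((8 - (i : ℕ)) - 4) / ((8 - (i : ℕ)).factorial : ℂ) * x i := by
  simp only [pairingPoly, LinearMap.sum_apply, finsetSum_coeff, LinearMap.comp_apply,
    coeff_monomial]
  rw [Finset.sum_eq_single i]
  · simp
  · intro j _ hj
    rw [if_neg]
    intro h
    exact hj (Fin.ext (by omega))
  · simp

theorem natDegree_pairingPoly_le (x : Fin (2 * 4 + 1) → ℂ) : (pairingPoly x).natDegree ≤ 8 := by
  rw [pairingPoly, LinearMap.sum_apply]
  exact natDegree_sum_le_of_forall_le _ _ fun i _ =>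
    (natDegree_monomial_le _).trans (Nat.sub_le _ _)

theorem pairingPoly_injective : Function.Injective pairingPoly := by
  rw [injective_iff_map_eq_zero]
  intro x hx
  ext i
  have h := coeff_pairingPoly x i
  rw [hx, coeff_zero, eq_comm, mul_eq_zero] at h
  exact h.resolve_left (div_ne_zero (pow_ne_zero _ (by norm_num))
    (Nat.cast_ne_zero.mpr (Nat.factorial_ne_zero _)))

theorem natDegree_pairingPoly_le_four {x : Fin (2 * 4 + 1) → ℂ} (h0 : x 0 = 0) (h1 : x 1 = 0)
    (h2 : x 2 = 0) (h3 : x 3 = 0) : (pairingPoly x).natDegree ≤ 4 := by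
  rw [natDegree_le_iff_coeff_eq_zero]
  intro m hm
  by_cases hm8 : 8 < m
  · exact coeff_eq_zero_of_natDegree_lt ((natDegree_pairingPoly_le x).trans_lt hm8)
  · have hc := coeff_pairingPoly x ⟨8 - m, by omega⟩
    have hx : x ⟨8 - m, by omega⟩ = 0 := by
      have : m = 5 ∨ m = 6 ∨ m = 7 ∨ m = 8 := by omega
      rcases this with rfl | rfl | rfl | rfl
      exacts [h3, h2, h1, h0]
    rw [hx, mul_zero] at hc
    rwa [show 8 - (8 - m) = m by omega] at hc

theorem pow_five_dvd_pairingPoly {x : Fin (2 * 4 + 1) → ℂ} {s : ℂ} (hx : formOC 4 x x = 0)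
    (h0 : formOC 4 x (osc 0 s) = 0) (h1 : formOC 4 x (osc 1 s) = 0)
    (h2 : formOC 4 x (osc 2 s) = 0) (h3 : formOC 4 x (osc 3 s) = 0) :
    (X - C s) ^ 5 ∣ pairingPoly x := by
  by_cases hp : pairingPoly x = 0
  · rw [hp]
    exact dvd_zero _
  rw [← le_rootMultiplicity_iff hp, Nat.succ_le_iff, lt_rootMultiplicity_iff_isRoot_iterate_derivative hp]
  intro m hm
  rw [IsRoot, eval_iterate_derivative_pairingPoly]
  interval_cases m
  exacts [h0, h1, h2, h3, formOC_osc_four_eq_zero hx h0 h1 h2 h3]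

theorem sum_le_of_card_eq_four {D : Finset ℕ} (hD : D ⊆ Finset.range 9) (hcard : D.card = 4)
    {d : ℕ} (hd : d ∈ D) (hd4 : d ≤ 4) : ∑ i ∈ D, i ≤ 25 := by
  have key : ∀ D ∈ Finset.powersetCard 4 (Finset.range 9), (∃ d ∈ D, d ≤ 4) →
      ∑ i ∈ D, i ≤ 25 := by
    decide +kernel
  exact key D (Finset.mem_powersetCard.mpr ⟨hD, hcard⟩) ⟨d, hd, hd4⟩

/-- An isotropic four-space meeting ten osculating five-spaces lies in the big cell. -/
theorem eq_zero_of_mem_of_card_eq_ten {H : Submodule ℂ (Fin (2 * 4 + 1) → ℂ)}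
    (hH : Module.finrank ℂ H = 4) (hiso : ∀ x ∈ H, formOC 4 x x = 0) {S : Finset ℂ}
    (hS : S.card = 10) (hmeet : ∀ s ∈ S, H ⊓ oscOC 4 5 s ≠ ⊥) {x : Fin (2 * 4 + 1) → ℂ}
    (hx : x ∈ H) (h0 : x 0 = 0) (h1 : x 1 = 0) (h2 : x 2 = 0) (h3 : x 3 = 0) : x = 0 := by
  classical
  by_contra hx0
  let Q := H.map pairingPoly
  have hQ : Module.finrank ℂ Q = 4 := by
    rw [← hH]
    exact (Submodule.equivMapOfInjective pairingPoly pairingPoly_injective H).finrank_eq.symm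
  let D := (Finset.range 9).filter fun d => ∃ q ∈ Q, q ≠ 0 ∧ q.natDegree = d
  have hD : 4 ≤ D.card := by
    rw [← hQ]
    refine finrank_le_card_of_natDegree_mem Q D fun q hq hq0 => ?_
    refine Finset.mem_filter.mpr ⟨?_, q, hq, hq0, rfl⟩
    obtain ⟨y, -, rfl⟩ := hq
    exact Finset.mem_range_succ_iff.mpr (natDegree_pairingPoly_le y)
  have hxD : (pairingPoly x).natDegree ∈ D :=
    Finset.mem_filter.mpr ⟨Finset.mem_range_succ_iff.mpr (natDegree_pairingPoly_le x),
      pairingPoly x, ⟨x, hx, rfl⟩, fun h => hx0 (pairingPoly_injective (by rw [h, map_zero])), rfl⟩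
  obtain ⟨E, hxE, hED, hE⟩ := Finset.exists_subsuperset_card_eq
    (Finset.singleton_subset_iff.mpr hxD) (by simp) hD
  have hsum := sum_le_of_card_eq_four (hED.trans (Finset.filter_subset _ _)) hE
    (Finset.singleton_subset_iff.mp hxE) (natDegree_pairingPoly_le_four h0 h1 h2 h3)
  let e := E.orderEmbOfFin hE
  have he : ∀ i, ∃ q ∈ Q, q ≠ 0 ∧ q.natDegree = e i := fun i =>
    (Finset.mem_filter.mp (hED (E.orderEmbOfFin_mem hE i))).2
  choose p hpQ hp0 hpe using he
  have hinj : Function.Injective fun i => (p i).natDegree := fun i j hij => by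
    simp only [hpe] at hij
    exact e.injective hij
  obtain ⟨hW0, hW⟩ := det_wronskianMatrix hp0 hinj
  have hsum' : ∑ i, (p i).natDegree = ∑ i ∈ E, i := by
    simp only [hpe]
    rw [← Finset.sum_image (f := fun i => i) (s := Finset.univ) (g := e) (fun a _ b _ h => e.injective h)]
    congr 1
    exact Finset.image_orderEmbOfFin_univ E hE
  have hli := linearIndependent_of_injective_natDegree hp0 hinj
  have hspan : Submodule.span ℂ (Set.range p) = Q := by
    refine Submodule.eq_of_le_of_finrank_eq (Submodule.span_le.mpr ?_) ?_
    · rintro _ ⟨i, rfl⟩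
      exact hpQ i
    · rw [finrank_span_eq_card hli, hQ, Fintype.card_fin]
  have hdvd : ∀ s ∈ S, (X - C s) ^ 2 ∣ (wronskianMatrix p).det := fun s hs => by
    obtain ⟨y, hy, hy0, k0, k1, k2, k3⟩ := (inf_oscOC_five_ne_bot_iff H s).mp (hmeet s hs)
    have hyQ : pairingPoly y ∈ Submodule.span ℂ (Set.range p) := hspan ▸ ⟨y, hy, rfl⟩
    obtain ⟨c, hc⟩ := (Submodule.mem_span_range_iff_exists_fun ℂ).mp hyQ
    refine sq_dvd_det_wronskianMatrix (c := c) (s := s) ?_ ?_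
    · rintro rfl
      refine hy0 (pairingPoly_injective ?_)
      rw [← hc]
      simp
    · simp only [← smul_eq_C_mul]
      rw [hc]
      exact pow_five_dvd_pairingPoly (hiso y hy) k0 k1 k2 k3
  have hprod : ∏ s ∈ S, (X - C s) ^ 2 ∣ (wronskianMatrix p).det := by
    refine Finset.prod_dvd_of_coprime (fun a _ b _ hab => ?_) hdvd
    exact (pairwise_coprime_X_sub_C (s := id) Function.injective_id hab).pow
  have hdeg := natDegree_le_of_dvd hprod hW0
  rw [natDegree_prod _ _ fun s _ => pow_ne_zero _ (X_sub_C_ne_zero s)] at hdeg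
  simp only [natDegree_pow, natDegree_X_sub_C, mul_one, Finset.sum_const, hS, smul_eq_mul] at hdeg
  rw [hsum'] at hW
  simp [Fin.sum_univ_succ] at hW
  omega

end BigCell

section Chart

/-- Coordinates on the big cell of the space of isotropic four-spaces in `ℂ⁹`. -/
@[ext]
structure Chart where
  (a1 a2 a3 a4 c12 c13 c14 c23 c24 c34 : ℂ)

namespace Chart

/-- The isotropic subspace with given coordinates. -/
def toSubmodule (P : Chart) : Submodule ℂ (Fin (2 * 4 + 1) → ℂ) where
  carrier := {x | x 4 = P.a4 * x 0 + P.a3 * x 1 + P.a2 * x 2 + P.a1 * x 3 ∧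
    x 5 = P.c14 * x 0 + P.c13 * x 1 + P.c12 * x 2 - P.a1 * x 4 / 2 ∧
    x 6 = P.c24 * x 0 + P.c23 * x 1 - P.c12 * x 3 - P.a2 * x 4 / 2 ∧
    x 7 = P.c34 * x 0 - P.c23 * x 2 - P.c13 * x 3 - P.a3 * x 4 / 2 ∧
    x 8 = -P.c34 * x 1 - P.c24 * x 2 - P.c14 * x 3 - P.a4 * x 4 / 2}
  zero_mem' := by simp
  add_mem' := by
    rintro x y ⟨h4, h5, h6, h7, h8⟩ ⟨k4, k5, k6, k7, k8⟩
    refine ⟨?_, ?_, ?_, ?_, ?_⟩ <;> simp only [Pi.add_apply]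
    · linear_combination h4 + k4
    · linear_combination h5 + k5
    · linear_combination h6 + k6
    · linear_combination h7 + k7
    · linear_combination h8 + k8
  smul_mem' := by
    rintro r x ⟨h4, h5, h6, h7, h8⟩
    refine ⟨?_, ?_, ?_, ?_, ?_⟩ <;> simp only [Pi.smul_apply, smul_eq_mul]
    · linear_combination r * h4
    · linear_combination r * h5
    · linear_combination r * h6
    · linear_combination r * h7
    · linear_combination r * h8

variable (P : Chart)

theorem mem_toSubmodule {x : Fin (2 * 4 + 1) → ℂ} : x ∈ P.toSubmodule ↔
    x 4 = P.a4 * x 0 + P.a3 * x 1 + P.a2 * x 2 + P.a1 * x 3 ∧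
    x 5 = P.c14 * x 0 + P.c13 * x 1 + P.c12 * x 2 - P.a1 * x 4 / 2 ∧
    x 6 = P.c24 * x 0 + P.c23 * x 1 - P.c12 * x 3 - P.a2 * x 4 / 2 ∧
    x 7 = P.c34 * x 0 - P.c23 * x 2 - P.c13 * x 3 - P.a3 * x 4 / 2 ∧
    x 8 = -P.c34 * x 1 - P.c24 * x 2 - P.c14 * x 3 - P.a4 * x 4 / 2 :=
  Iff.rfl

theorem formOC_eq_zero {x y : Fin (2 * 4 + 1) → ℂ} (hx : x ∈ P.toSubmodule)
    (hy : y ∈ P.toSubmodule) : formOC 4 x y = 0 := by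
  obtain ⟨h4, h5, h6, h7, h8⟩ := P.mem_toSubmodule.mp hx
  obtain ⟨k4, k5, k6, k7, k8⟩ := P.mem_toSubmodule.mp hy
  rw [formOC_four, h5, h6, h7, h8, k5, k6, k7, k8, h4, k4]
  ring

/-- The vector of the subspace with given leading coordinates. -/
noncomputable def vec (u : Fin 4 → ℂ) : Fin (2 * 4 + 1) → ℂ :=
  let m := P.a4 * u 0 + P.a3 * u 1 + P.a2 * u 2 + P.a1 * u 3
  ![u 0, u 1, u 2, u 3, m,
    P.c14 * u 0 + P.c13 * u 1 + P.c12 * u 2 - P.a1 * m / 2,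
    P.c24 * u 0 + P.c23 * u 1 - P.c12 * u 3 - P.a2 * m / 2,
    P.c34 * u 0 - P.c23 * u 2 - P.c13 * u 3 - P.a3 * m / 2,
    -P.c34 * u 1 - P.c24 * u 2 - P.c14 * u 3 - P.a4 * m / 2]

theorem vec_mem (u : Fin 4 → ℂ) : P.vec u ∈ P.toSubmodule :=
  ⟨rfl, rfl, rfl, rfl, rfl⟩

variable {P} in
theorem eq_vec {x : Fin (2 * 4 + 1) → ℂ} (hx : x ∈ P.toSubmodule) :
    x = P.vec ![x 0, x 1, x 2, x 3] := by
  obtain ⟨h4, h5, h6, h7, h8⟩ := P.mem_toSubmodule.mp hx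
  ext i
  obtain ⟨i, hi⟩ := i
  have hi' : i < 9 := hi
  interval_cases i
  · rfl
  · rfl
  · rfl
  · rfl
  · exact h4
  · exact h5.trans (by rw [h4]; rfl)
  · exact h6.trans (by rw [h4]; rfl)
  · exact h7.trans (by rw [h4]; rfl)
  · exact h8.trans (by rw [h4]; rfl)

/-- The projection of `ℂ⁹` to the first four coordinates. -/
def proj : (Fin (2 * 4 + 1) → ℂ) →ₗ[ℂ] Fin 4 → ℂ :=
  LinearMap.pi ![LinearMap.proj 0, LinearMap.proj 1, LinearMap.proj 2, LinearMap.proj 3]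

theorem proj_apply (x : Fin (2 * 4 + 1) → ℂ) : proj x = ![x 0, x 1, x 2, x 3] := by
  ext i
  fin_cases i <;> rfl

theorem proj_vec (u : Fin 4 → ℂ) : proj (P.vec u) = u := by
  ext i
  fin_cases i <;> rfl

theorem finrank_toSubmodule : Module.finrank ℂ P.toSubmodule = 4 := by
  have hbij : Function.Bijective (proj ∘ₗ P.toSubmodule.subtype) := by
    constructor
    · rintro ⟨x, hx⟩ ⟨y, hy⟩ h
      replace h : proj x = proj y := h
      rw [proj_apply, proj_apply] at h
      exact Subtype.ext ((eq_vec hx).trans ((congrArg P.vec h).trans (eq_vec hy).symm))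
    · exact fun u => ⟨⟨P.vec u, P.vec_mem u⟩, P.proj_vec u⟩
  simpa using (LinearEquiv.ofBijective _ hbij).finrank_eq

theorem toSubmodule_injective : Function.Injective toSubmodule := by
  intro P Q h
  have key : ∀ u, P.vec u = Q.vec u := fun u => by
    have hP : P.vec u ∈ Q.toSubmodule := h ▸ P.vec_mem u
    exact (eq_vec hP).trans (congrArg Q.vec ((proj_apply _).symm.trans (P.proj_vec u)))
  have k4 := fun u => congrFun (key u) 4
  have k5 := fun u => congrFun (key u) 5
  have k6 := fun u => congrFun (key u) 6
  have k7 := fun u => congrFun (key u) 7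
  have e4 : P.a4 = Q.a4 := by simpa [vec] using k4 ![1, 0, 0, 0]
  have e3 : P.a3 = Q.a3 := by simpa [vec] using k4 ![0, 1, 0, 0]
  have e2 : P.a2 = Q.a2 := by simpa [vec] using k4 ![0, 0, 1, 0]
  have e1 : P.a1 = Q.a1 := by simpa [vec] using k4 ![0, 0, 0, 1]
  have e14 : P.c14 = Q.c14 := by simpa [vec, e1, e4] using k5 ![1, 0, 0, 0]
  have e13 : P.c13 = Q.c13 := by simpa [vec, e1, e3] using k5 ![0, 1, 0, 0]
  have e12 : P.c12 = Q.c12 := by simpa [vec, e1, e2] using k5 ![0, 0, 1, 0]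
  have e24 : P.c24 = Q.c24 := by simpa [vec, e2, e4] using k6 ![1, 0, 0, 0]
  have e23 : P.c23 = Q.c23 := by simpa [vec, e2, e3] using k6 ![0, 1, 0, 0]
  have e34 : P.c34 = Q.c34 := by simpa [vec, e3, e4] using k7 ![1, 0, 0, 0]
  exact Chart.ext e1 e2 e3 e4 e12 e13 e14 e23 e24 e34

theorem exists_eq_toSubmodule {H : Submodule ℂ (Fin (2 * 4 + 1) → ℂ)}
    (hH : Module.finrank ℂ H = 4) (hiso : ∀ x ∈ H, ∀ y ∈ H, formOC 4 x y = 0)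
    (hcell : ∀ x ∈ H, x 0 = 0 → x 1 = 0 → x 2 = 0 → x 3 = 0 → x = 0) :
    ∃ P : Chart, H = P.toSubmodule := by
  have hinj : Function.Injective (proj ∘ₗ H.subtype) := by
    rw [injective_iff_map_eq_zero]
    rintro ⟨x, hx⟩ h
    replace h : proj x = 0 := h
    rw [proj_apply] at h
    exact Subtype.ext (hcell x hx (congrFun h 0) (congrFun h 1) (congrFun h 2) (congrFun h 3))
  have hsurj : Function.Surjective (proj ∘ₗ H.subtype) :=
    (LinearMap.injective_iff_surjective_of_finrank_eq_finrank (by simpa using hH)).mp hinj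
  have hex : ∀ u : Fin 4 → ℂ, ∃ x ∈ H, x 0 = u 0 ∧ x 1 = u 1 ∧ x 2 = u 2 ∧ x 3 = u 3 := by
    intro u
    obtain ⟨⟨x, hx⟩, h⟩ := hsurj u
    replace h : proj x = u := h
    exact ⟨x, hx, congrFun h 0, congrFun h 1, congrFun h 2, congrFun h 3⟩
  obtain ⟨p, hp, p0, p1, p2, p3⟩ := hex ![1, 0, 0, 0]
  obtain ⟨q, hq, q0, q1, q2, q3⟩ := hex ![0, 1, 0, 0]
  obtain ⟨r, hr, r0, r1, r2, r3⟩ := hex ![0, 0, 1, 0]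
  obtain ⟨t, ht, t0, t1, t2, t3⟩ := hex ![0, 0, 0, 1]
  simp only [Matrix.cons_val] at p0 p1 p2 p3 q0 q1 q2 q3 r0 r1 r2 r3 t0 t1 t2 t3
  have hform : ∀ x ∈ H, ∀ y ∈ H, x 0 * y 8 + x 1 * y 7 + x 2 * y 6 + x 3 * y 5 + x 4 * y 4
      + x 5 * y 3 + x 6 * y 2 + x 7 * y 1 + x 8 * y 0 = 0 := fun x hx y hy => by
    rw [← formOC_four, hiso x hx y hy]
  have hpp := hform p hp p hp
  have hpq := hform p hp q hq
  have hpr := hform p hp r hr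
  have hpt := hform p hp t ht
  have hqq := hform q hq q hq
  have hqr := hform q hq r hr
  have hqt := hform q hq t ht
  have hrr := hform r hr r hr
  have hrt := hform r hr t ht
  have htt := hform t ht t ht
  simp only [p0, p1, p2, p3, q0, q1, q2, q3, r0, r1, r2, r3, t0, t1, t2, t3]
    at hpp hpq hpr hpt hqq hqr hqt hrr hrt htt
  let P : Chart :=
    { a1 := t 4
      a2 := r 4
      a3 := q 4
      a4 := p 4
      c12 := r 5 + r 4 * t 4 / 2
      c13 := q 5 + q 4 * t 4 / 2
      c14 := p 5 + p 4 * t 4 / 2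
      c23 := q 6 + q 4 * r 4 / 2
      c24 := p 6 + p 4 * r 4 / 2
      c34 := p 7 + p 4 * q 4 / 2 }
  refine ⟨P, Submodule.eq_of_le_of_finrank_eq (fun x hx => ?_)
    (hH.trans P.finrank_toSubmodule.symm)⟩
  have hx' : x = x 0 • p + x 1 • q + x 2 • r + x 3 • t := by
    rw [← sub_eq_zero]
    refine hcell _ (sub_mem hx (add_mem (add_mem (add_mem (H.smul_mem _ hp) (H.smul_mem _ hq))
      (H.smul_mem _ hr)) (H.smul_mem _ ht))) ?_ ?_ ?_ ?_ <;>
    simp [p0, p1, p2, p3, q0, q1, q2, q3, r0, r1, r2, r3, t0, t1, t2, t3]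
  have e : ∀ i, x i = x 0 * p i + x 1 * q i + x 2 * r i + x 3 * t i := fun i =>
    congrFun hx' i
  rw [mem_toSubmodule, e 8, e 7, e 6, e 5, e 4]
  refine ⟨?_, ?_, ?_, ?_, ?_⟩ <;> dsimp only [P]
  · ring
  · linear_combination x 3 * htt / 2
  · linear_combination x 3 * hrt + x 2 * hrr / 2
  · linear_combination x 3 * hqt + x 2 * hqr + x 1 * hqq / 2
  · linear_combination x 3 * hpt + x 2 * hpr + x 1 * hpq + x 0 * hpp / 2

end Chart

end Chart

section Pfaffian

namespace Chart

variable (P : Chart)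

/-- The polynomial whose roots are the points at which the subspace meets the osculating
five-space. -/
noncomputable def pfaffian (s : ℂ) : ℂ :=
  s ^ 10 / 1209600 - P.a1 * s ^ 9 / 120960 - P.a2 * s ^ 8 / 13440
    + (-P.a3 / 2880 - P.c12 / 2016) * s ^ 7 + (-P.a4 / 1440 - P.c13 / 288) * s ^ 6
    + (-P.c14 / 120 - P.c23 / 80) * s ^ 5
    + (-P.c24 / 24 + (P.a1 * P.c23 - P.a2 * P.c13 + P.a3 * P.c12) / 48) * s ^ 4
    + (-P.c34 / 12 + (P.a1 * P.c24 - P.a2 * P.c14 + P.a4 * P.c12) / 12) * s ^ 3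
    + (P.a1 * P.c34 - P.a3 * P.c14 + P.a4 * P.c13) / 4 * s ^ 2
    + (P.a2 * P.c34 - P.a3 * P.c24 + P.a4 * P.c23) / 2 * s
    + (P.c12 * P.c34 - P.c13 * P.c24 + P.c14 * P.c23)

/-- The difference of a skew-symmetric matrix and half of a symmetric rank one matrix. -/
noncomputable def skewSub (k01 k02 k03 k12 k13 k23 v0 v1 v2 v3 : ℂ) : Matrix (Fin 4) (Fin 4) ℂ :=
  !![-v0 * v0 / 2, k01 - v0 * v1 / 2, k02 - v0 * v2 / 2, k03 - v0 * v3 / 2;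
    -k01 - v0 * v1 / 2, -v1 * v1 / 2, k12 - v1 * v2 / 2, k13 - v1 * v3 / 2;
    -k02 - v0 * v2 / 2, -k12 - v1 * v2 / 2, -v2 * v2 / 2, k23 - v2 * v3 / 2;
    -k03 - v0 * v3 / 2, -k13 - v1 * v3 / 2, -k23 - v2 * v3 / 2, -v3 * v3 / 2]

theorem det_skewSub (k01 k02 k03 k12 k13 k23 v0 v1 v2 v3 : ℂ) :
    (skewSub k01 k02 k03 k12 k13 k23 v0 v1 v2 v3).det =
      (k01 * k23 - k02 * k13 + k03 * k12) ^ 2 := by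
  rw [Matrix.det_succ_row_zero]
  simp [skewSub, Fin.sum_univ_succ, Matrix.det_fin_three, Matrix.submatrix_apply, Fin.succAbove]
  ring

/-- The matrix of incidence conditions. -/
noncomputable def incidence (s : ℂ) : Matrix (Fin 4) (Fin 4) ℂ :=
  skewSub (P.c34 - s ^ 7 / 2016 + (P.a4 * (s ^ 3 / 6) + P.a3 * (s ^ 4 / 24)) / 2)
    (P.c24 + s ^ 6 / 288 + (-P.a4 * (s ^ 2 / 2) + P.a2 * (s ^ 4 / 24)) / 2)
    (P.c14 - s ^ 5 / 80 + (P.a4 * s + P.a1 * (s ^ 4 / 24)) / 2)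
    (P.c23 - s ^ 5 / 120 + (-P.a3 * (s ^ 2 / 2) - P.a2 * (s ^ 3 / 6)) / 2)
    (P.c13 + s ^ 4 / 24 + (P.a3 * s - P.a1 * (s ^ 3 / 6)) / 2)
    (P.c12 - s ^ 3 / 12 + (P.a2 * s + P.a1 * (s ^ 2 / 2)) / 2)
    (P.a4 + s ^ 4 / 24) (P.a3 - s ^ 3 / 6) (P.a2 + s ^ 2 / 2) (P.a1 - s)

theorem det_incidence (s : ℂ) : (P.incidence s).det = P.pfaffian s ^ 2 := by
  rw [incidence, det_skewSub, pfaffian]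
  congr 1
  ring

variable {P} in
theorem vecMul_incidence {x : Fin (2 * 4 + 1) → ℂ} (hx : x ∈ P.toSubmodule) (s : ℂ) :
    Matrix.vecMul ![x 0, x 1, x 2, x 3] (P.incidence s) =
      ![formOC 4 x (osc 0 s) - s * formOC 4 x (osc 1 s) + s ^ 2 / 2 * formOC 4 x (osc 2 s)
          - s ^ 3 / 6 * formOC 4 x (osc 3 s),
        formOC 4 x (osc 1 s) - s * formOC 4 x (osc 2 s) + s ^ 2 / 2 * formOC 4 x (osc 3 s),
        formOC 4 x (osc 2 s) - s * formOC 4 x (osc 3 s), formOC 4 x (osc 3 s)] := by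
  obtain ⟨h4, h5, h6, h7, h8⟩ := P.mem_toSubmodule.mp hx
  rw [formOC_osc_0, formOC_osc_1, formOC_osc_2, formOC_osc_3, h5, h6, h7, h8, h4]
  ext j
  fin_cases j <;>
  simp [incidence, skewSub, Matrix.vecMul, dotProduct, Fin.sum_univ_succ] <;> ring

theorem inf_oscOC_ne_bot_iff (s : ℂ) : P.toSubmodule ⊓ oscOC 4 5 s ≠ ⊥ ↔ P.pfaffian s = 0 := by
  rw [← pow_eq_zero_iff two_ne_zero, ← det_incidence, ← Matrix.exists_vecMul_eq_zero_iff,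
    inf_oscOC_five_ne_bot_iff]
  constructor
  · rintro ⟨x, hx, hx0, h0, h1, h2, h3⟩
    refine ⟨![x 0, x 1, x 2, x 3], fun h => hx0 ?_, ?_⟩
    · rw [eq_vec hx, h]
      ext i
      fin_cases i <;> simp [vec]
    · rw [vecMul_incidence hx, h0, h1, h2, h3]
      simp
  · rintro ⟨u, hu, h⟩
    have hvec : ![P.vec u 0, P.vec u 1, P.vec u 2, P.vec u 3] = u :=
      (proj_apply _).symm.trans (P.proj_vec u)
    have key := vecMul_incidence (P.vec_mem u) s
    rw [hvec, h] at key
    have h3 : 0 = formOC 4 (P.vec u) (osc 3 s) := congrFun key 3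
    have h2 : 0 = formOC 4 (P.vec u) (osc 2 s) - s * formOC 4 (P.vec u) (osc 3 s) := congrFun key 2
    have h1 : 0 = formOC 4 (P.vec u) (osc 1 s) - s * formOC 4 (P.vec u) (osc 2 s)
      + s ^ 2 / 2 * formOC 4 (P.vec u) (osc 3 s) := congrFun key 1
    have h0 : 0 = formOC 4 (P.vec u) (osc 0 s) - s * formOC 4 (P.vec u) (osc 1 s)
      + s ^ 2 / 2 * formOC 4 (P.vec u) (osc 2 s) - s ^ 3 / 6 * formOC 4 (P.vec u) (osc 3 s) :=
      congrFun key 0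
    rw [← h3, mul_zero, sub_zero] at h2
    rw [← h3, ← h2, mul_zero, mul_zero, sub_zero, add_zero] at h1
    rw [← h3, ← h2, ← h1] at h0
    refine ⟨P.vec u, P.vec_mem u, fun hz => hu ?_, ?_, h1.symm, h2.symm, h3.symm⟩
    · rw [← P.proj_vec u, hz, map_zero]
    · simpa using h0.symm

end Chart

end Pfaffian

section Coefficients

open Polynomial

namespace Chart

variable (P : Chart)

/-- The normalised Pfaffian as a polynomial. -/
noncomputable def pfaffianPoly : ℂ[X] :=
  X ^ 10 + C (-10 * P.a1) * X ^ 9 + C (-90 * P.a2) * X ^ 8 + C (-420 * P.a3 - 600 * P.c12) * X ^ 7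
    + C (-840 * P.a4 - 4200 * P.c13) * X ^ 6 + C (-10080 * P.c14 - 15120 * P.c23) * X ^ 5
    + C (-50400 * P.c24 + 25200 * (P.a1 * P.c23 - P.a2 * P.c13 + P.a3 * P.c12)) * X ^ 4
    + C (-100800 * P.c34 + 100800 * (P.a1 * P.c24 - P.a2 * P.c14 + P.a4 * P.c12)) * X ^ 3
    + C (302400 * (P.a1 * P.c34 - P.a3 * P.c14 + P.a4 * P.c13)) * X ^ 2
    + C (604800 * (P.a2 * P.c34 - P.a3 * P.c24 + P.a4 * P.c23)) * X
    + C (1209600 * (P.c12 * P.c34 - P.c13 * P.c24 + P.c14 * P.c23))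

theorem eval_pfaffianPoly (s : ℂ) : P.pfaffianPoly.eval s = 1209600 * P.pfaffian s := by
  simp only [pfaffianPoly, pfaffian, eval_add, eval_mul, eval_pow, eval_X, eval_C]
  ring

theorem natDegree_pfaffianPoly : P.pfaffianPoly.natDegree = 10 := by
  rw [pfaffianPoly]
  compute_degree!

theorem monic_pfaffianPoly : P.pfaffianPoly.Monic := by
  rw [pfaffianPoly]
  monicity!

theorem pfaffian_eq_zero_iff {S : Finset ℂ} (hS : S.card = 10) :
    (∀ s ∈ S, P.pfaffian s = 0) ↔ P.pfaffianPoly = ∏ s ∈ S, (X - C s) := by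
  constructor
  · intro h
    have hdvd : ∏ s ∈ S, (X - C s) ∣ P.pfaffianPoly := by
      refine Finset.prod_dvd_of_coprime (fun a _ b _ hab =>
        pairwise_coprime_X_sub_C (s := id) Function.injective_id hab) fun s hs => ?_
      rw [dvd_iff_isRoot, IsRoot, eval_pfaffianPoly, h s hs, mul_zero]
    refine (eq_of_monic_of_dvd_of_natDegree_le (monic_prod_of_monic _ _ fun s _ => monic_X_sub_C s)
      P.monic_pfaffianPoly hdvd ?_)
    rw [natDegree_pfaffianPoly, natDegree_prod_of_monic _ _ fun s _ => monic_X_sub_C s]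
    simp [hS]
  · intro h s hs
    have := P.eval_pfaffianPoly s
    rw [h, eval_prod, Finset.prod_eq_zero hs (by simp)] at this
    simpa using this.symm

theorem pfaffianPoly_eq_iff {R : ℂ[X]} (hR : R.Monic) (hdeg : R.natDegree = 10) :
    P.pfaffianPoly = R ↔ -10 * P.a1 = R.coeff 9 ∧ -90 * P.a2 = R.coeff 8 ∧
      -420 * P.a3 - 600 * P.c12 = R.coeff 7 ∧ -840 * P.a4 - 4200 * P.c13 = R.coeff 6 ∧
      -10080 * P.c14 - 15120 * P.c23 = R.coeff 5 ∧
      -50400 * P.c24 + 25200 * (P.a1 * P.c23 - P.a2 * P.c13 + P.a3 * P.c12) = R.coeff 4 ∧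
      -100800 * P.c34 + 100800 * (P.a1 * P.c24 - P.a2 * P.c14 + P.a4 * P.c12) = R.coeff 3 ∧
      302400 * (P.a1 * P.c34 - P.a3 * P.c14 + P.a4 * P.c13) = R.coeff 2 ∧
      604800 * (P.a2 * P.c34 - P.a3 * P.c24 + P.a4 * P.c23) = R.coeff 1 ∧
      1209600 * (P.c12 * P.c34 - P.c13 * P.c24 + P.c14 * P.c23) = R.coeff 0 := by
  constructor
  · rintro rfl
    simp only [pfaffianPoly, coeff_add, coeff_C_mul, coeff_X_pow, coeff_X, coeff_C]
    norm_num
  · rintro ⟨h9, h8, h7, h6, h5, h4, h3, h2, h1, h0⟩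
    ext k
    rcases lt_trichotomy k 10 with hk | rfl | hk
    · simp only [pfaffianPoly, h0, h1, h2, h3, h4, h5, h6, h7, h8, h9, coeff_add, coeff_C_mul,
        coeff_X_pow, coeff_X, coeff_C]
      interval_cases k <;> norm_num
    · rw [← P.natDegree_pfaffianPoly, P.monic_pfaffianPoly.coeff_natDegree,
        P.natDegree_pfaffianPoly, ← hdeg, hR.coeff_natDegree]
    · rw [coeff_eq_zero_of_natDegree_lt (P.natDegree_pfaffianPoly ▸ hk),
        coeff_eq_zero_of_natDegree_lt (hdeg ▸ hk)]

/-- The chart point attached to a solution of the normalised system. -/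
noncomputable def ofNormSol (g2 g3 g4 g5 g6 g7 X y z : ℂ) : Chart where
  a1 := 0
  a2 := g2 / 210 ^ 2
  a3 := 10 * X / 210 ^ 3
  a4 := 5 * y / 210 ^ 4
  c12 := (g3 - 7 * X) / 210 ^ 3
  c13 := (g4 - y) / 210 ^ 4
  c14 := 3 * z / 210 ^ 5
  c23 := (g5 - 2 * z) / 210 ^ 5
  c24 := (g6 + (-g2 * (g4 - y) + 10 * X * (g3 - 7 * X)) / 2) / 210 ^ 6
  c34 := (g7 - g2 * (3 * z) + 5 * y * (g3 - 7 * X)) / 210 ^ 7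

theorem ofNormSol_injective {g2 g3 g4 g5 g6 g7 X y z X' y' z' : ℂ}
    (h : ofNormSol g2 g3 g4 g5 g6 g7 X y z = ofNormSol g2 g3 g4 g5 g6 g7 X' y' z') :
    X = X' ∧ y = y' ∧ z = z' := by
  have h1 : 10 * X / 210 ^ 3 = 10 * X' / 210 ^ 3 := congrArg a3 h
  have h2 : 5 * y / 210 ^ 4 = 5 * y' / 210 ^ 4 := congrArg a4 h
  have h3 : 3 * z / 210 ^ 5 = 3 * z' / 210 ^ 5 := congrArg c14 h
  exact ⟨by linear_combination 210 ^ 3 / 10 * h1, by linear_combination 210 ^ 4 / 5 * h2,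
    by linear_combination 210 ^ 5 / 3 * h3⟩

theorem pfaffianPoly_eq_iff_isNormSol {R : ℂ[X]} (hR : R.Monic) (hdeg : R.natDegree = 10)
    (h9 : R.coeff 9 = 0) {g2 g3 g4 g5 g6 g7 g8 g9 g10 : ℂ} (h2 : g2 = -490 * R.coeff 8)
    (h3 : g3 = -15435 * R.coeff 7) (h4 : g4 = -463050 * R.coeff 6)
    (h5 : g5 = -27011250 * R.coeff 5) (h6 : g6 = -1701708750 * R.coeff 4)
    (h7 : g7 = -178679418750 * R.coeff 3) (h8 : g8 = 12507559312500 * R.coeff 2)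
    (hg9 : g9 = 1313293727812500 * R.coeff 1) (h10 : g10 = 137895841420312500 * R.coeff 0) :
    P.pfaffianPoly = R ↔ ∃ X y z, IsNormSol g2 g3 g4 g5 g6 g7 g8 g9 g10 X y z ∧
      P = ofNormSol g2 g3 g4 g5 g6 g7 X y z := by
  rw [P.pfaffianPoly_eq_iff hR hdeg, h9]
  constructor
  · rintro ⟨k9, k8, k7, k6, k5, k4, k3, k2, k1, k0⟩
    rw [← k8] at h2
    rw [← k7] at h3
    rw [← k6] at h4
    rw [← k5] at h5
    rw [← k4] at h6
    rw [← k3] at h7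
    rw [← k2] at h8
    rw [← k1] at hg9
    rw [← k0] at h10
    have ha : P.a1 = 0 := by simpa using k9
    rw [ha] at h6 h7 h8
    obtain ⟨X, hX⟩ : ∃ X, P.a3 = 10 * X / 210 ^ 3 := ⟨P.a3 * 210 ^ 3 / 10, by field_simp⟩
    obtain ⟨y, hy⟩ : ∃ y, P.a4 = 5 * y / 210 ^ 4 := ⟨P.a4 * 210 ^ 4 / 5, by field_simp⟩
    obtain ⟨z, hz⟩ : ∃ z, P.c14 = 3 * z / 210 ^ 5 := ⟨P.c14 * 210 ^ 5 / 3, by field_simp⟩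
    have e2 : P.a2 = g2 / 210 ^ 2 := by rw [h2]; ring
    have e3 : P.c12 = (g3 - 7 * X) / 210 ^ 3 := by rw [h3, hX]; ring
    have e4 : P.c13 = (g4 - y) / 210 ^ 4 := by rw [h4, hy]; ring
    have e5 : P.c23 = (g5 - 2 * z) / 210 ^ 5 := by rw [h5, hz]; ring
    have e6 : P.c24 = (g6 + (-g2 * (g4 - y) + 10 * X * (g3 - 7 * X)) / 2) / 210 ^ 6 := by
      rw [e2, e4, hX, e3] at h6
      linear_combination -(1 / 210 ^ 6) * h6
    have e7 : P.c34 = (g7 - g2 * (3 * z) + 5 * y * (g3 - 7 * X)) / 210 ^ 7 := by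
      rw [e2, hz, hy, e3] at h7
      linear_combination -(1 / 210 ^ 7) * h7
    refine ⟨X, y, z, ⟨?_, ?_, ?_⟩, Chart.ext ha e2 hX hy e3 e4 hz e5 e6 e7⟩
    · rw [h8, hX, hz, hy, e4]
      ring
    · rw [hg9, e2, e7, hX, e6, hy, e5]
      ring
    · rw [h10, e3, e7, e4, e6, hz, e5]
      ring
  · rintro ⟨X, y, z, ⟨f8, f9, f10⟩, rfl⟩
    dsimp only [ofNormSol]
    refine ⟨by ring, by rw [h2]; ring, by rw [h3]; ring, by rw [h4]; ring, by rw [h5]; ring,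
      by rw [h6]; ring, by rw [h7]; ring, ?_, ?_, ?_⟩
    · linear_combination 302400 / 210 ^ 8 * f8 + 302400 / 210 ^ 8 * h8
    · linear_combination 604800 / 210 ^ 9 * f9 + 604800 / 210 ^ 9 * hg9
    · linear_combination 1209600 / 210 ^ 10 * f10 + 1209600 / 210 ^ 10 * h10

end Chart

end Coefficients

section Recenter

/-- The similitude of `ℂ⁹` corresponding to the substitution `t ↦ 10 (t - σ)` on the curve. -/
noncomputable def recenter (σ : ℂ) : (Fin (2 * 4 + 1) → ℂ) →ₗ[ℂ] Fin (2 * 4 + 1) → ℂ where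
  toFun x := ![formOC 4 x (osc 8 σ), -10 * formOC 4 x (osc 7 σ), 10 ^ 2 * formOC 4 x (osc 6 σ),
    -10 ^ 3 * formOC 4 x (osc 5 σ), 10 ^ 4 * formOC 4 x (osc 4 σ), 10 ^ 5 * formOC 4 x (osc 3 σ),
    10 ^ 6 * formOC 4 x (osc 2 σ), 10 ^ 7 * formOC 4 x (osc 1 σ), 10 ^ 8 * formOC 4 x (osc 0 σ)]
  map_add' x y := by
    simp only [formOC_add_left]
    ext i
    fin_cases i <;> simp <;> ring
  map_smul' a x := by
    simp only [formOC_smul_left]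
    ext i
    fin_cases i <;> simp <;> ring

theorem recenter_apply (σ : ℂ) (x : Fin (2 * 4 + 1) → ℂ) : recenter σ x =
    ![formOC 4 x (osc 8 σ), -10 * formOC 4 x (osc 7 σ), 10 ^ 2 * formOC 4 x (osc 6 σ),
    -10 ^ 3 * formOC 4 x (osc 5 σ), 10 ^ 4 * formOC 4 x (osc 4 σ), 10 ^ 5 * formOC 4 x (osc 3 σ),
    10 ^ 6 * formOC 4 x (osc 2 σ), 10 ^ 7 * formOC 4 x (osc 1 σ), 10 ^ 8 * formOC 4 x (osc 0 σ)] :=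
  rfl

theorem recenter_injective (σ : ℂ) : Function.Injective (recenter σ) := by
  rw [injective_iff_map_eq_zero]
  intro x hx
  rw [recenter_apply] at hx
  have h8 : formOC 4 x (osc 8 σ) = 0 := congrFun hx 0
  have h7 : formOC 4 x (osc 7 σ) = 0 := by simpa using congrFun hx 1
  have h6 : formOC 4 x (osc 6 σ) = 0 := by simpa using congrFun hx 2
  have h5 : formOC 4 x (osc 5 σ) = 0 := by simpa using congrFun hx 3
  have h4 : formOC 4 x (osc 4 σ) = 0 := by simpa using congrFun hx 4
  have h3 : formOC 4 x (osc 3 σ) = 0 := by simpa using congrFun hx 5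
  have h2 : formOC 4 x (osc 2 σ) = 0 := by simpa using congrFun hx 6
  have h1 : formOC 4 x (osc 1 σ) = 0 := by simpa using congrFun hx 7
  have h0 : formOC 4 x (osc 0 σ) = 0 := by simpa using congrFun hx 8
  rw [osc_expansion x σ, h0, h1, h2, h3, h4, h5, h6, h7, h8]
  simp

theorem formOC_recenter (σ : ℂ) (x y : Fin (2 * 4 + 1) → ℂ) :
    formOC 4 (recenter σ x) (recenter σ y) = 10 ^ 8 * formOC 4 x y := by
  rw [formOC_eq_osc x y σ, formOC_four, recenter_apply, recenter_apply]
  simp only [Matrix.cons_val]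
  ring

theorem formOC_recenter_osc (σ s : ℂ) (x : Fin (2 * 4 + 1) → ℂ) :
    formOC 4 (recenter σ x) (osc 0 (10 * (s - σ))) = 10 ^ 8 * formOC 4 x (osc 0 s) ∧
    formOC 4 (recenter σ x) (osc 1 (10 * (s - σ))) = 10 ^ 7 * formOC 4 x (osc 1 s) ∧
    formOC 4 (recenter σ x) (osc 2 (10 * (s - σ))) = 10 ^ 6 * formOC 4 x (osc 2 s) ∧
    formOC 4 (recenter σ x) (osc 3 (10 * (s - σ))) = 10 ^ 5 * formOC 4 x (osc 3 s) := by
  rw [recenter_apply]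
  simp only [formOC_osc_0, formOC_osc_1, formOC_osc_2, formOC_osc_3, formOC_osc_4, formOC_osc_5,
    formOC_osc_6, formOC_osc_7, formOC_osc_8, Matrix.cons_val]
  refine ⟨?_, ?_, ?_, ?_⟩ <;> ring

/-- The maximal isotropic subspaces meeting the osculating five-spaces at the points of a set. -/
def incidenceSet (S : Finset ℂ) : Set (Submodule ℂ (Fin (2 * 4 + 1) → ℂ)) :=
  {H | Module.finrank ℂ H = 4 ∧ (∀ x ∈ H, ∀ y ∈ H, formOC 4 x y = 0) ∧
    ∀ s ∈ S, H ⊓ oscOC 4 5 s ≠ ⊥}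

theorem comap_recenter_mem_incidenceSet {σ : ℂ} {S : Finset ℂ}
    {K : Submodule ℂ (Fin (2 * 4 + 1) → ℂ)} :
    K.comap (recenter σ) ∈ incidenceSet S ↔ K ∈ incidenceSet (S.image fun s => 10 * (s - σ)) := by
  let e := LinearEquiv.ofInjectiveEndo (recenter σ) (recenter_injective σ)
  have hsurj : Function.Surjective (recenter σ) := e.surjective
  have hrank : Module.finrank ℂ (K.comap (recenter σ)) = Module.finrank ℂ K := by
    have : K.comap (recenter σ) = K.map (e.symm : (Fin (2 * 4 + 1) → ℂ) →ₗ[ℂ] _) :=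
      (Submodule.map_equiv_eq_comap_symm e.symm K).symm
    rw [this]
    exact e.symm.finrank_map_eq K
  refine and_congr (by rw [hrank]) (and_congr ?_ ?_)
  · constructor
    · intro h x hx y hy
      obtain ⟨x, rfl⟩ := hsurj x
      obtain ⟨y, rfl⟩ := hsurj y
      rw [formOC_recenter, h x hx y hy, mul_zero]
    · intro h x hx y hy
      simpa [formOC_recenter] using h _ hx _ hy
  · rw [Finset.forall_mem_image]
    refine forall₂_congr fun s _ => ?_
    rw [inf_oscOC_five_ne_bot_iff, inf_oscOC_five_ne_bot_iff]
    refine (exists_congr fun x => ?_).trans hsurj.exists.symm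
    obtain ⟨h0, h1, h2, h3⟩ := formOC_recenter_osc σ s x
    rw [h0, h1, h2, h3, Submodule.mem_comap, ne_eq, ne_eq,
      map_eq_zero_iff _ (recenter_injective σ)]
    simp

theorem comap_recenter_injective (σ : ℂ) :
    Function.Injective (Submodule.comap (recenter σ)) :=
  Submodule.comap_injective_of_surjective
    (LinearEquiv.ofInjectiveEndo (recenter σ) (recenter_injective σ)).surjective

theorem conj_recenter {σ : ℂ} (hσ : starRingEnd ℂ σ = σ) (x : Fin (2 * 4 + 1) → ℂ) :
    (fun i => starRingEnd ℂ (recenter σ x i)) = recenter σ fun i => starRingEnd ℂ (x i) := by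
  rw [recenter_apply, recenter_apply]
  simp only [formOC_osc_0, formOC_osc_1, formOC_osc_2, formOC_osc_3, formOC_osc_4, formOC_osc_5,
    formOC_osc_6, formOC_osc_7, formOC_osc_8]
  ext i
  fin_cases i <;> simp [hσ, Complex.conj_ofNat]

theorem conjStableOC.comap_recenter {σ : ℂ} (hσ : starRingEnd ℂ σ = σ)
    {K : Submodule ℂ (Fin (2 * 4 + 1) → ℂ)} (hK : conjStableOC 4 K) :
    conjStableOC 4 (K.comap (recenter σ)) := fun x hx => by
  rw [Submodule.mem_comap, ← conj_recenter hσ]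
  exact hK _ hx

end Recenter

section Count

open Polynomial

theorem Chart.conjStableOC_toSubmodule {P : Chart} (h1 : starRingEnd ℂ P.a1 = P.a1)
    (h2 : starRingEnd ℂ P.a2 = P.a2) (h3 : starRingEnd ℂ P.a3 = P.a3)
    (h4 : starRingEnd ℂ P.a4 = P.a4) (h12 : starRingEnd ℂ P.c12 = P.c12)
    (h13 : starRingEnd ℂ P.c13 = P.c13) (h14 : starRingEnd ℂ P.c14 = P.c14)
    (h23 : starRingEnd ℂ P.c23 = P.c23) (h24 : starRingEnd ℂ P.c24 = P.c24)
    (h34 : starRingEnd ℂ P.c34 = P.c34) : conjStableOC 4 P.toSubmodule := fun x hx => by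
  obtain ⟨k4, k5, k6, k7, k8⟩ := P.mem_toSubmodule.mp hx
  refine P.mem_toSubmodule.mpr ⟨?_, ?_, ?_, ?_, ?_⟩
  · simp [k4, h1, h2, h3, h4]
  · simp [k5, h1, h12, h13, h14, Complex.conj_ofNat]
  · simp [k6, h2, h12, h23, h24, Complex.conj_ofNat]
  · simp [k7, h3, h13, h23, h34, Complex.conj_ofNat]
  · simp [k8, h4, h14, h24, h34, Complex.conj_ofNat]

theorem mem_incidenceSet_iff {S : Finset ℂ} (hS : S.card = 10)
    {H : Submodule ℂ (Fin (2 * 4 + 1) → ℂ)} : H ∈ incidenceSet S ↔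
      ∃ P : Chart, P.pfaffianPoly = ∏ s ∈ S, (X - C s) ∧ P.toSubmodule = H := by
  constructor
  · rintro ⟨hH, hiso, hmeet⟩
    obtain ⟨P, rfl⟩ := Chart.exists_eq_toSubmodule hH hiso fun x hx =>
      eq_zero_of_mem_of_card_eq_ten hH (fun y hy => hiso y hy y hy) hS hmeet hx
    exact ⟨P, (P.pfaffian_eq_zero_iff hS).mp fun s hs => (P.inf_oscOC_ne_bot_iff s).mp (hmeet s hs),
      rfl⟩
  · rintro ⟨P, hP, rfl⟩
    exact ⟨P.finrank_toSubmodule, fun x hx y hy => P.formOC_eq_zero hx hy,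
      fun s hs => (P.inf_oscOC_ne_bot_iff s).mpr ((P.pfaffian_eq_zero_iff hS).mpr hP s hs)⟩

theorem IsNormSol.conj_eq {g2 g3 g4 g5 g6 g7 g8 g9 g10 X y z : ℂ}
    (h : IsNormSol g2 g3 g4 g5 g6 g7 g8 g9 g10 X y z) (hX : starRingEnd ℂ X = X)
    (hc : CorankLEOne g2 g3 g4 g5 g6 g7 g8 g9 g10 X)
    (h2 : starRingEnd ℂ g2 = g2) (h3 : starRingEnd ℂ g3 = g3) (h4 : starRingEnd ℂ g4 = g4)
    (h5 : starRingEnd ℂ g5 = g5) (h6 : starRingEnd ℂ g6 = g6) (h7 : starRingEnd ℂ g7 = g7)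
    (h8 : starRingEnd ℂ g8 = g8) (h9 : starRingEnd ℂ g9 = g9)
    (h10 : starRingEnd ℂ g10 = g10) : starRingEnd ℂ y = y ∧ starRingEnd ℂ z = z := by
  have h' := h.conj
  rw [h2, h3, h4, h5, h6, h7, h8, h9, h10, hX] at h'
  exact hc.unique h' h

theorem incidenceSet_of_hasRealSpectrum {S : Finset ℂ} (hS : S.card = 10) (hsum : ∑ s ∈ S, s = 0)
    {R : ℂ[X]} (hR : R = ∏ s ∈ S, (X - C s)) (hreal : ∀ k, starRingEnd ℂ (R.coeff k) = R.coeff k)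
    {g2 g3 g4 g5 g6 g7 g8 g9 g10 : ℂ} (h2 : g2 = -490 * R.coeff 8)
    (h3 : g3 = -15435 * R.coeff 7) (h4 : g4 = -463050 * R.coeff 6)
    (h5 : g5 = -27011250 * R.coeff 5) (h6 : g6 = -1701708750 * R.coeff 4)
    (h7 : g7 = -178679418750 * R.coeff 3) (h8 : g8 = 12507559312500 * R.coeff 2)
    (h9 : g9 = 1313293727812500 * R.coeff 1) (h10 : g10 = 137895841420312500 * R.coeff 0)
    (h : HasRealSpectrum g2 g3 g4 g5 g6 g7 g8 g9 g10) :
    (incidenceSet S).ncard = 12 ∧ ∀ H ∈ incidenceSet S, conjStableOC 4 H := by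
  obtain ⟨hcard, hspec⟩ := h.isNormSol
  have hmonic : R.Monic := hR ▸ monic_prod_of_monic _ _ fun s _ => monic_X_sub_C s
  have hdeg : R.natDegree = 10 := by
    rw [hR, natDegree_prod_of_monic _ _ fun s _ => monic_X_sub_C s]
    simp [hS]
  have hc9 : R.coeff 9 = 0 := by
    have := prod_X_sub_C_coeff_card_pred S (fun s => s) (by simp [hS])
    rwa [hS, hsum, neg_zero, ← hR] at this
  have hmem : ∀ H, H ∈ incidenceSet S ↔ ∃ v : ℂ × ℂ × ℂ,
      IsNormSol g2 g3 g4 g5 g6 g7 g8 g9 g10 v.1 v.2.1 v.2.2 ∧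
      (Chart.ofNormSol g2 g3 g4 g5 g6 g7 v.1 v.2.1 v.2.2).toSubmodule = H := fun H => by
    rw [mem_incidenceSet_iff hS, ← hR]
    simp only [Chart.pfaffianPoly_eq_iff_isNormSol _ hmonic hdeg hc9 h2 h3 h4 h5 h6 h7 h8 h9 h10]
    constructor
    · rintro ⟨_, ⟨X, y, z, hv, rfl⟩, rfl⟩
      exact ⟨(X, y, z), hv, rfl⟩
    · rintro ⟨⟨X, y, z⟩, hv, rfl⟩
      exact ⟨_, ⟨X, y, z, hv, rfl⟩, rfl⟩
  constructor
  · rw [← hcard]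
    symm
    refine Set.ncard_congr
      (fun v _ => (Chart.ofNormSol g2 g3 g4 g5 g6 g7 v.1 v.2.1 v.2.2).toSubmodule)
      (fun v hv => (hmem _).mpr ⟨v, hv, rfl⟩) ?_ ?_
    · rintro ⟨X, y, z⟩ ⟨X', y', z'⟩ _ _ hv
      obtain ⟨rfl, rfl, rfl⟩ := Chart.ofNormSol_injective (Chart.toSubmodule_injective hv)
      rfl
    · intro H hH
      obtain ⟨v, hv, rfl⟩ := (hmem H).mp hH
      exact ⟨v, hv, rfl⟩
  · intro H hH
    obtain ⟨⟨X, y, z⟩, hv, rfl⟩ := (hmem H).mp hH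
    obtain ⟨hX, hc⟩ := hspec X y z hv
    replace hX : starRingEnd ℂ X = X := Complex.conj_eq_iff_im.mpr hX
    have hreal' : ∀ {c g : ℂ} {k : ℕ}, starRingEnd ℂ c = c → g = c * R.coeff k →
        starRingEnd ℂ g = g := fun {c g k} hc hg => by rw [hg, map_mul, hc, hreal]
    replace h2 := hreal' (by simp [Complex.conj_ofNat]) h2
    replace h3 := hreal' (by simp [Complex.conj_ofNat]) h3
    replace h4 := hreal' (by simp [Complex.conj_ofNat]) h4
    replace h5 := hreal' (by simp [Complex.conj_ofNat]) h5
    replace h6 := hreal' (by simp [Complex.conj_ofNat]) h6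
    replace h7 := hreal' (by simp [Complex.conj_ofNat]) h7
    replace h8 := hreal' (by simp [Complex.conj_ofNat]) h8
    replace h9 := hreal' (by simp [Complex.conj_ofNat]) h9
    replace h10 := hreal' (by simp [Complex.conj_ofNat]) h10
    obtain ⟨hy, hz⟩ := hv.conj_eq hX hc h2 h3 h4 h5 h6 h7 h8 h9 h10
    apply Chart.conjStableOC_toSubmodule <;>
    simp [Chart.ofNormSol, Complex.conj_ofNat, h2, h3, h4, h5, h6, h7, hX, hy, hz]

theorem incidenceSet_natCast {T : Finset ℕ}
    (hT : T ⊆ ({1, 2, 3, 5, 7, 10, 11, 13, 15, 16, 17, 23, 29, 31} : Finset ℕ))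
    (hcard : T.card = 10) :
    (incidenceSet (T.image fun t : ℕ => (t : ℂ))).ncard = 12 ∧
      ∀ H ∈ incidenceSet (T.image fun t : ℕ => (t : ℂ)), conjStableOC 4 H := by
  let σ : ℂ := (∑ u ∈ T, u : ℕ) / 10
  have hσ : starRingEnd ℂ σ = σ := by simp [σ, Complex.conj_ofNat]
  have hinj : Function.Injective fun t : ℕ => 10 * ((t : ℂ) - σ) := fun t u h => by
    simpa using h
  let S := T.image fun t : ℕ => 10 * ((t : ℂ) - σ)
  have hS : S.card = 10 := by rw [Finset.card_image_of_injective _ hinj, hcard]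
  have hST : (T.image fun t : ℕ => (t : ℂ)).image (fun s => 10 * (s - σ)) = S := by
    rw [Finset.image_image]
    rfl
  have hsum : ∑ s ∈ S, s = 0 := by
    rw [Finset.sum_image hinj.injOn, ← Finset.mul_sum, Finset.sum_sub_distrib, Finset.sum_const,
      hcard, nsmul_eq_mul]
    simp only [σ]
    push_cast
    ring
  let P : ℤ[X] := ∏ t ∈ T, (X - C (10 * (t : ℤ) - ((∑ u ∈ T, u : ℕ) : ℤ)))
  have hP : P.map (Int.castRingHom ℂ) = ∏ s ∈ S, (X - C s) := by
    rw [Finset.prod_image hinj.injOn, Polynomial.map_prod]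
    refine Finset.prod_congr rfl fun t _ => ?_
    rw [Polynomial.map_sub, map_X, map_C, eq_intCast]
    congr 2
    simp only [σ]
    push_cast
    ring
  have hcoeff : ∀ k, (P.map (Int.castRingHom ℂ)).coeff k = P.coeff k := fun k => by
    rw [coeff_map, eq_intCast]
  have hspec := hasRealSpectrum_of_subset hT hcard (P := P) rfl
  simp only [← hcoeff] at hspec
  obtain ⟨hncard, hreal⟩ := incidenceSet_of_hasRealSpectrum hS hsum hP
    (fun k => by rw [hcoeff, map_intCast]) rfl rfl rfl rfl rfl rfl rfl rfl rfl hspec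
  have himage : incidenceSet (T.image fun t : ℕ => (t : ℂ)) =
      Submodule.comap (recenter σ) '' incidenceSet S := by
    ext H
    constructor
    · intro hH
      have hHK : (H.map (recenter σ)).comap (recenter σ) = H :=
        Submodule.comap_map_eq_of_injective (recenter_injective σ) H
      rw [← hHK, comap_recenter_mem_incidenceSet, hST] at hH
      exact ⟨_, hH, hHK⟩
    · rintro ⟨K, hK, rfl⟩
      rwa [comap_recenter_mem_incidenceSet, hST]
  rw [himage, Set.ncard_image_of_injective _ (comap_recenter_injective σ)]
  refine ⟨hncard, ?_⟩
  rintro _ ⟨K, hK, rfl⟩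
  exact (hreal K hK).comap_recenter hσ

end Count

/-- For `n = 4` and every 10-element subset `T` of
`{1,2,3,5,7,10,11,13,15,16,17,23,29,31}`, the set of 4-dimensional maximal isotropic
subspaces `H ⊆ ℂ⁹` with `H ∩ F₅(t) ≠ 0` for all `t ∈ T` has exactly twelve elements,
all of them real. -/
theorem stmt_10 (T : Finset ℕ)
    (hT : T ⊆ ({1, 2, 3, 5, 7, 10, 11, 13, 15, 16, 17, 23, 29, 31} : Finset ℕ))
    (hcard : T.card = 10) :
    {H : Submodule ℂ (Fin (2 * 4 + 1) → ℂ) |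
        Module.finrank ℂ H = 4 ∧
        (∀ x ∈ H, ∀ y ∈ H, formOC 4 x y = 0) ∧
        ∀ t ∈ T, H ⊓ oscOC 4 5 (t : ℂ) ≠ ⊥}.Finite ∧
      {H : Submodule ℂ (Fin (2 * 4 + 1) → ℂ) |
        Module.finrank ℂ H = 4 ∧
        (∀ x ∈ H, ∀ y ∈ H, formOC 4 x y = 0) ∧
        ∀ t ∈ T, H ⊓ oscOC 4 5 (t : ℂ) ≠ ⊥}.ncard = 12 ∧
      ∀ H ∈ {H : Submodule ℂ (Fin (2 * 4 + 1) → ℂ) |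
        Module.finrank ℂ H = 4 ∧
        (∀ x ∈ H, ∀ y ∈ H, formOC 4 x y = 0) ∧
        ∀ t ∈ T, H ⊓ oscOC 4 5 (t : ℂ) ≠ ⊥}, conjStableOC 4 H := by
  have hset : incidenceSet (T.image fun t : ℕ => (t : ℂ)) =
      {H : Submodule ℂ (Fin (2 * 4 + 1) → ℂ) | Module.finrank ℂ H = 4 ∧
        (∀ x ∈ H, ∀ y ∈ H, formOC 4 x y = 0) ∧ ∀ t ∈ T, H ⊓ oscOC 4 5 (t : ℂ) ≠ ⊥} := by
    simp only [incidenceSet, Finset.forall_mem_image]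
  obtain ⟨hncard, hreal⟩ := incidenceSet_natCast hT hcard
  rw [← hset]
  exact ⟨Set.finite_of_ncard_ne_zero (by rw [hncard]; norm_num), hncard, hreal⟩
end

section
/- For any three pairwise distinct real numbers s_1, s_2, s_3, there is no 2-dimensional subspace H of ℝ^4 that is Lagrangian for the alternating form ⟨x,y⟩ = x_1 y_4 − y_1 x_4 + x_2 y_3 − y_2 x_3 and satisfies H ∩ F_2(s_i) ≠ {0} for i = 1, 2, 3, where F_2(s) is the span of γ(s) = (1, s, s²/2, −s³/6) and γ'(s) = (0, 1, s, −s²/2). -/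
/-- A solution of a nontrivial homogeneous linear equation in two unknowns is a multiple of the
evident one. -/
theorem exists_eq_mul_of_mul_add_mul_eq_zero {K : Type*} [Field K] {p q x y : K}
    (hpq : p ≠ 0 ∨ q ≠ 0) (h : p * x + q * y = 0) : ∃ l : K, x = l * q ∧ y = -(l * p) := by
  rcases hpq with hp | hq
  · refine ⟨-y / p, ?_, ?_⟩
    · field_simp
      linear_combination h
    · field_simp
  · refine ⟨x / q, ?_, ?_⟩
    · field_simp
    · field_simp
      linear_combination h

/-- The vanishing, divided by `t`, of the alternating form on the vectors with coordinates
`(a, b)` and `(x, y)` in two osculating planes whose parameters differ by `t`. The vector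
`(x, y)` is then a multiple of the solution given by `(a, b)`. -/
theorem exists_scalar_of_osculating_orthogonal {t a b x y : ℝ} (ht : t ≠ 0)
    (hab : a ≠ 0 ∨ b ≠ 0) (hxy : x ≠ 0 ∨ y ≠ 0)
    (h : -(a * x) * t ^ 2 / 6 + (b * x - a * y) * t / 2 + b * y = 0) :
    ∃ l : ℝ, l ≠ 0 ∧ x = l * (b - a * t / 2) ∧ y = l * (a * t ^ 2 / 6 - b * t / 2) := by
  have hpq : -a * t ^ 2 / 6 + b * t / 2 ≠ 0 ∨ b - a * t / 2 ≠ 0 := by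
    by_contra! hc
    obtain ⟨h1, h2⟩ := hc
    have ha : a = 0 := by
      have : a * t ^ 2 = 0 := by linear_combination 12 * h1 - 6 * t * h2
      simpa [ht] using this
    have hb : b = 0 := by simpa [ha] using h2
    tauto
  obtain ⟨l, hx, hy⟩ := exists_eq_mul_of_mul_add_mul_eq_zero (x := x) (y := y) hpq
    (by linear_combination h)
  refine ⟨l, ?_, hx, by rw [hy]; ring⟩
  rintro rfl
  simp at hx hy
  tauto

/-- Nonzero vectors in the osculating planes at three distinct parameters, with differences
`t`, `u` and `u - t`, are not pairwise orthogonal for the alternating form. -/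
theorem osculating_not_pairwise_orthogonal {t u a b c d e f : ℝ} (ht : t ≠ 0) (hu : u ≠ 0)
    (htu : u - t ≠ 0) (hab : a ≠ 0 ∨ b ≠ 0) (hcd : c ≠ 0 ∨ d ≠ 0) (hef : e ≠ 0 ∨ f ≠ 0)
    (h₁₂ : -(a * c) * t ^ 2 / 6 + (b * c - a * d) * t / 2 + b * d = 0)
    (h₁₃ : -(a * e) * u ^ 2 / 6 + (b * e - a * f) * u / 2 + b * f = 0)
    (h₂₃ : -(c * e) * (u - t) ^ 2 / 6 + (d * e - c * f) * (u - t) / 2 + d * f = 0) :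
    False := by
  obtain ⟨l, hl, rfl, rfl⟩ := exists_scalar_of_osculating_orthogonal ht hab hcd h₁₂
  obtain ⟨m, hm, rfl, rfl⟩ := exists_scalar_of_osculating_orthogonal hu hab hef h₁₃
  have key : (t * u * a - 3 * (t + u) * b / 2) ^ 2 + 3 / 4 * ((u - t) * b) ^ 2 = 0 := by
    have : l * m * ((t * u * a - 3 * (t + u) * b / 2) ^ 2 + 3 / 4 * ((u - t) * b) ^ 2) = 0 := by
      linear_combination 36 * h₂₃
    simpa only [mul_eq_zero, hl, hm, false_or] using this
  have hb : b = 0 := by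
    have : (u - t) * b = 0 := by
      nlinarith [sq_nonneg (t * u * a - 3 * (t + u) * b / 2), sq_nonneg ((u - t) * b)]
    simpa [htu] using this
  subst hb
  simp_all

/-- For any three pairwise distinct real numbers `s 0, s 1, s 2`, there is no
2-dimensional subspace `H` of `ℝ⁴`, Lagrangian for the alternating form
`⟨x,y⟩ = x₁y₄ − y₁x₄ + x₂y₃ − y₂x₃`, meeting each osculating 2-plane
`F₂(sᵢ) = span{γ(sᵢ), γ'(sᵢ)}` of the curve `γ(s) = (1, s, s²/2, −s³/6)` nontrivially. -/
theorem stmt_11 (s : Fin 3 → ℝ) (hs : Function.Injective s) :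
    ¬ ∃ H : Submodule ℝ (Fin 4 → ℝ), Module.finrank ℝ H = 2 ∧
      (∀ x ∈ H, ∀ y ∈ H, x 0 * y 3 - y 0 * x 3 + x 1 * y 2 - y 1 * x 2 = 0) ∧
      ∀ i : Fin 3,
        H ⊓ Submodule.span ℝ
            {![1, s i, (s i) ^ 2 / 2, -(s i) ^ 3 / 6], ![0, 1, s i, -(s i) ^ 2 / 2]} ≠ ⊥ := by
  rintro ⟨H, -, hL, hF⟩
  have hcoord : ∀ i, ∃ a b : ℝ, (a ≠ 0 ∨ b ≠ 0) ∧
      a • ![1, s i, (s i) ^ 2 / 2, -(s i) ^ 3 / 6] + b • ![0, 1, s i, -(s i) ^ 2 / 2] ∈ H := by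
    intro i
    obtain ⟨x, hx, hx0⟩ := Submodule.exists_mem_ne_zero_of_ne_bot (hF i)
    obtain ⟨hxH, hxF⟩ := Submodule.mem_inf.1 hx
    obtain ⟨a, b, rfl⟩ := Submodule.mem_span_pair.1 hxF
    refine ⟨a, b, ?_, hxH⟩
    by_contra! hab
    exact hx0 (by simp [hab.1, hab.2])
  choose a b hab hH using hcoord
  have hne : ∀ i j, i ≠ j → s j - s i ≠ 0 := fun i j hij ↦ sub_ne_zero.2 (hs.ne hij.symm)
  have horth : ∀ i j, i ≠ j → -(a i * a j) * (s j - s i) ^ 2 / 6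
      + (b i * a j - a i * b j) * (s j - s i) / 2 + b i * b j = 0 := by
    intro i j hij
    have h := hL _ (hH i) _ (hH j)
    simp at h
    refine (mul_eq_zero.1 ?_).resolve_left (hne i j hij)
    linear_combination h
  have hsub : s 2 - s 1 = (s 2 - s 0) - (s 1 - s 0) := by ring
  exact osculating_not_pairwise_orthogonal (hne 0 1 (by decide)) (hne 0 2 (by decide))
    (hsub ▸ hne 1 2 (by decide)) (hab 0) (hab 1) (hab 2) (horth 0 1 (by decide))
    (horth 0 2 (by decide)) (hsub ▸ horth 1 2 (by decide))
end

section
/- (Lemma 2.3.) Let 0 < d_1 < ⋯ < d_m < n and let w ∈ S_n be a permutation whose descent set is contained in {d_1,…,d_m} and which is not the maximal such permutation, i.e., ℓ(w) < Σ_{i=1}^{m} (d_i − d_{i−1})(n − d_i) (with d_0 = 0), the dimension of the flag manifold. Then ⋂_{s ∈ ℂ} X_w F_•(s) = ∅: for every partial flag E_• of type d in ℂ^n there exists s ∈ ℂ such that E_• does not lie in the Schubert variety X_w F_•(s), i.e., for some i and j one has dim(E_{d_i} ∩ F_j(s)) < #{k ≤ d_i : w(k) ≤ j}. -/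
/-- The `j`-th coordinatewise derivative at `s` of the rational normal curve
`γ(s) = (1, s, s², …, s^{n-1})` in `ℂⁿ`. -/
noncomputable def oscVec (n : ℕ) (j : ℕ) (s : ℂ) : Fin n → ℂ :=
  fun i => iteratedDeriv j (fun t : ℂ => t ^ (i : ℕ)) s

/-- The osculating subspace `F_k(s) = span{γ(s), γ'(s), …, γ^{(k-1)}(s)}`. -/
noncomputable def oscF (n k : ℕ) (s : ℂ) : Submodule ℂ (Fin n → ℂ) :=
  Submodule.span ℂ (Set.range fun j : Fin k => oscVec n j s)

/-- The length `ℓ(w)`: the number of inversions of the permutation `w`. -/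
def invCount (n : ℕ) (w : Equiv.Perm (Fin n)) : ℕ :=
  (Finset.univ.filter fun p : Fin n × Fin n => p.1 < p.2 ∧ w p.2 < w p.1).card

/-- `#{k ≤ di : w(k) ≤ j}` (in 1-indexed terms), the rank number of the Schubert
condition; here `w` is `0`-indexed. -/
def schubNum (n : ℕ) (w : Equiv.Perm (Fin n)) (di j : ℕ) : ℕ :=
  (Finset.univ.filter fun k : Fin n => (k : ℕ) < di ∧ ((w k : ℕ)) < j).card

open Polynomial in
/-- Applying `X ^ j * D ^ j` to `X ^ e * g` multiplies the lowest coefficient by the falling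
factorial of `e`. -/
lemma exists_X_pow_mul_iterate_derivative {R : Type*} [CommRing R] (e : ℕ) (g : R[X]) (j : ℕ) :
    ∃ h : R[X], X ^ j * derivative^[j] (X ^ e * g) = X ^ e * h ∧
      h.eval 0 = (descPochhammer R j).eval (e : R) * g.eval 0 := by
  induction j with
  | zero => exact ⟨g, by simp⟩
  | succ j ih =>
    obtain ⟨h, hh, h0⟩ := ih
    refine ⟨(e - j : R[X]) * h + X * derivative h, ?_, ?_⟩
    · have key : X * derivative (X ^ j * derivative^[j] (X ^ e * g)) =
          X * derivative (X ^ e * h) := by rw [hh]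
      have euler (k : ℕ) : (X : R[X]) * derivative (X ^ k) = (k : R[X]) * X ^ k := by
        cases k with
        | zero => simp
        | succ k => simp only [derivative_X_pow, Nat.add_sub_cancel, map_natCast]; ring
      rw [derivative_mul, derivative_mul] at key
      rw [Function.iterate_succ_apply' derivative]
      linear_combination key - (j : R[X]) * hh + h * euler e -
        derivative^[j] (X ^ e * g) * euler j
    · rw [descPochhammer_succ_eval]
      simp [h0]
      ring

open Polynomial in
/-- The Wronskian of polynomials with pairwise distinct orders of vanishing at `0` is nonzero. -/
lemma det_iterate_derivative_ne_zero {K : Type*} [Field K] [CharZero K] {r : ℕ}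
    {e : Fin r → ℕ} (he : Function.Injective e) (g : Fin r → K[X])
    (hg : ∀ a, (g a).eval 0 ≠ 0) :
    (Matrix.of fun a j : Fin r => derivative^[(j : ℕ)] (X ^ e a * g a)).det ≠ 0 := by
  choose h hh h0 using fun a j : Fin r => exists_X_pow_mul_iterate_derivative (e a) (g a) j
  have hdet : (∏ j : Fin r, (X : K[X]) ^ (j : ℕ)) *
      (Matrix.of fun a j : Fin r => derivative^[(j : ℕ)] (X ^ e a * g a)).det =
      (∏ a, X ^ e a) * (Matrix.of h).det := by
    rw [← Matrix.det_mul_row, ← Matrix.det_mul_column]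
    congr 1
    ext1 a j
    exact hh a j
  intro hzero
  rw [hzero, mul_zero, eq_comm, mul_eq_zero] at hdet
  have hz : (Matrix.of h).det = 0 :=
    hdet.resolve_left (Finset.prod_ne_zero_iff.2 fun a _ => pow_ne_zero _ X_ne_zero)
  have heval : (∏ a, (g a).eval 0) * (Matrix.vandermonde fun a => (e a : K)).det = 0 := by
    rw [Matrix.det_eval_matrixOfPolynomials_eq_det_vandermonde _
      (fun i : Fin r => descPochhammer K i) (fun i => descPochhammer_natDegree K i)
      (fun i => monic_descPochhammer K i), ← Matrix.det_mul_column]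
    refine Eq.trans ?_ ((RingHom.map_det (evalRingHom (0 : K)) (Matrix.of h)).symm.trans
      (by rw [hz, map_zero]))
    congr 1
    ext a j
    simp [h0, mul_comm]
  exact mul_ne_zero (Finset.prod_ne_zero_iff.2 fun a _ => hg a)
    (Matrix.det_vandermonde_ne_zero_iff.2 (Nat.cast_injective.comp he)) heval

open Polynomial in
/-- Pairing a functional with `γ^{(j)}(s)` evaluates the `j`-th derivative of the polynomial whose
coefficients are the values of the functional on the standard basis. -/
lemma apply_oscVec {n : ℕ} (φ : Module.Dual ℂ (Fin n → ℂ)) (j : ℕ) (s : ℂ) :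
    φ (oscVec n j s) =
      (derivative^[j] (∑ i : Fin n, C (φ (Pi.single i 1)) * X ^ (i : ℕ))).eval s := by
  rw [iterate_derivative_sum, eval_finsetSum, LinearMap.pi_apply_eq_sum_univ]
  refine Finset.sum_congr rfl fun i _ => ?_
  rw [iterate_derivative_C_mul, iterate_derivative_X_pow_eq_C_mul, oscVec, iteratedDeriv_pow]
  simp only [eval_mul, eval_C, eval_pow, eval_X, smul_eq_mul]
  rw [mul_comm]
  congr 3
  ext k
  simp [Pi.single_apply, eq_comm]

lemma oscF_mono {n k l : ℕ} (hkl : k ≤ l) (s : ℂ) : oscF n k s ≤ oscF n l s := by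
  refine Submodule.span_mono ?_
  rintro _ ⟨j, rfl⟩
  exact ⟨Fin.castLE hkl j, rfl⟩

/-- The functionals `φ a` kill `E`, and `φ a` has its first nonzero coordinate at `e a`, where `e`
is injective; there are at least `codim E` of them. -/
lemma exists_echelon_annihilators {K : Type*} [Field K] {n : ℕ} (E : Submodule K (Fin n → K)) :
    ∃ (r : ℕ) (e : Fin r → Fin n) (φ : Fin r → Module.Dual K (Fin n → K)),
      n ≤ Module.finrank K E + r ∧ Function.Injective e ∧ (∀ a, ∀ v ∈ E, φ a v = 0) ∧
      (∀ a, ∀ i < e a, φ a (Pi.single i 1) = 0) ∧ ∀ a, φ a (Pi.single (e a) 1) ≠ 0 := by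
  classical
  let b : Fin n → Fin n → K := fun i => Pi.single i 1
  let p : Fin n → Submodule K (Fin n → K) := fun i => E ⊔ Submodule.span K (b '' Set.Iio i)
  let S : Finset (Fin n) := {i | b i ∉ p i}
  let e : Fin S.card ↪o Fin n := S.orderEmbOfFin rfl
  have he (a : Fin S.card) : b (e a) ∉ p (e a) :=
    (Finset.mem_filter.1 (S.orderEmbOfFin_mem rfl a)).2
  choose φ hφ hp using fun a => Submodule.exists_dual_map_eq_bot_of_notMem (he a) inferInstance
  have hker (a : Fin S.card) : ∀ v ∈ p (e a), φ a v = 0 := fun v hv => by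
    rw [← Submodule.mem_bot K, ← hp a]
    exact Submodule.mem_map_of_mem hv
  refine ⟨S.card, e, φ, ?_, e.injective, fun a v hv => hker a v (Submodule.mem_sup_left hv),
    fun a i hi => hker a _ (Submodule.mem_sup_right (Submodule.subset_span ⟨i, hi, rfl⟩)), hφ⟩
  have hb : ∀ i, b i ∈ E ⊔ Submodule.span K (b '' S) := by
    intro i
    induction i using WellFoundedLT.induction with
    | ind i ih =>
      by_cases hi : i ∈ S
      · exact Submodule.mem_sup_right (Submodule.subset_span ⟨i, hi, rfl⟩)
      · have hi' : b i ∈ p i := by simpa [S] using hi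
        refine (sup_le le_sup_left (Submodule.span_le.2 ?_) : p i ≤ _) hi'
        rintro _ ⟨j, hj, rfl⟩
        exact ih j hj
  have htop : E ⊔ Submodule.span K (b '' S) = ⊤ := by
    rw [eq_top_iff, ← (Pi.basisFun K (Fin n)).span_eq, Submodule.span_le]
    rintro _ ⟨i, rfl⟩
    simpa [b] using hb i
  calc n = Module.finrank K (E ⊔ Submodule.span K (b '' S) : Submodule K (Fin n → K)) := by
        rw [htop, finrank_top, Module.finrank_fin_fun]
    _ ≤ Module.finrank K E + Module.finrank K (Submodule.span K (b '' S)) :=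
        Submodule.finrank_add_le_finrank_add_finrank _ _
    _ ≤ _ := by
        gcongr
        rw [← Finset.coe_image]
        exact (finrank_span_finset_le_card _).trans Finset.card_image_le

open Polynomial in
/-- Every subspace is transverse to some osculating subspace of complementary dimension. -/
lemma exists_inf_oscF_eq_bot {n k : ℕ} (E : Submodule ℂ (Fin n → ℂ))
    (hk : Module.finrank ℂ E + k ≤ n) : ∃ s : ℂ, E ⊓ oscF n k s = ⊥ := by
  obtain ⟨r, e, φ, hr, he, hE, hlow, hne⟩ := exists_echelon_annihilators E
  let f : Fin r → ℂ[X] := fun a => ∑ i : Fin n, C (φ a (Pi.single i 1)) * X ^ (i : ℕ)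
  have hf (a : Fin r) : X ^ (e a : ℕ) ∣ f a := by
    refine Finset.dvd_sum fun i _ => ?_
    rcases lt_or_ge i (e a) with hi | hi
    · simp [hlow a i hi]
    · exact (pow_dvd_pow X hi).mul_left _
  choose g hg using hf
  have hg0 (a : Fin r) : (g a).eval 0 ≠ 0 := by
    have hcoeff : (f a).coeff (e a) = φ a (Pi.single (e a) 1) := by
      simp [f, coeff_X_pow, Fin.val_inj]
    rw [← coeff_zero_eq_eval_zero]
    have hnea := hne a
    rwa [← hcoeff, hg, coeff_X_pow_mul', if_pos le_rfl, Nat.sub_self] at hnea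
  have hdet := det_iterate_derivative_ne_zero (Fin.val_injective.comp he) g hg0
  obtain ⟨s, hs⟩ : ∃ s : ℂ, (Matrix.of fun a j : Fin r =>
      derivative^[(j : ℕ)] (X ^ (e a : ℕ) * g a)).det.eval s ≠ 0 := by
    by_contra! h
    exact hdet (Polynomial.funext fun s => by simpa using h s)
  refine ⟨s, (Submodule.eq_bot_iff _).2 ?_⟩
  rintro v ⟨hvE, hvF⟩
  obtain ⟨c, rfl⟩ := (Submodule.mem_span_range_iff_exists_fun ℂ).1
    (oscF_mono (show k ≤ r by omega) s hvF)
  rw [← coe_evalRingHom, RingHom.map_det] at hs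
  have hc : c = 0 := by
    refine Matrix.eq_zero_of_mulVec_eq_zero hs (funext fun a => ?_)
    rw [Pi.zero_apply, ← hE a _ hvE, map_sum]
    simp only [Matrix.mulVec, dotProduct]
    refine Finset.sum_congr rfl fun j _ => ?_
    rw [map_smul, apply_oscVec, smul_eq_mul, mul_comm]
    change c j * eval s (derivative^[(j : ℕ)] (X ^ (e a : ℕ) * g a)) = _
    rw [← hg]
  simp [hc]

lemma card_fin_filter_lt {n a : ℕ} (ha : a ≤ n) :
    (Finset.univ.filter fun x : Fin n => (x : ℕ) < a).card = a := by
  rw [Fin.card_filter_val_lt, min_eq_right ha]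

lemma card_fin_filter_ge {n a : ℕ} (ha : a ≤ n) :
    (Finset.univ.filter fun x : Fin n => a ≤ (x : ℕ)).card = n - a := by
  have h := Finset.card_filter_add_card_filter_not (s := (Finset.univ : Finset (Fin n)))
    (fun x : Fin n => (x : ℕ) < a)
  simp only [not_lt, Finset.card_univ, Fintype.card_fin, card_fin_filter_lt ha] at h
  omega

lemma card_fin_filter_Ico {n a b : ℕ} (hb : b ≤ n) :
    (Finset.univ.filter fun x : Fin n => a ≤ (x : ℕ) ∧ (x : ℕ) < b).card = b - a := by
  rw [← Nat.card_Ico a b, ← Finset.card_map Fin.valEmbedding]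
  congr 1
  ext x
  simp only [Finset.mem_map, Finset.mem_filter, Finset.mem_univ, true_and, Finset.mem_Ico,
    Fin.valEmbedding_apply]
  exact ⟨by rintro ⟨y, hy, rfl⟩; exact hy, fun hx => ⟨⟨x, by omega⟩, hx, rfl⟩⟩

/-- A permutation sending the first `a` elements to the last `a` sends the others to the
first `n - a`. -/
lemma perm_apply_lt_of_le {n a : ℕ} (ha : a ≤ n) (w : Equiv.Perm (Fin n))
    (h : ∀ k : Fin n, (k : ℕ) < a → n - a ≤ (w k : ℕ)) (k : Fin n) (hk : a ≤ (k : ℕ)) :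
    (w k : ℕ) < n - a := by
  by_contra! hwk
  have himage : (Finset.univ.filter fun x : Fin n => (x : ℕ) < a).map w.toEmbedding =
      Finset.univ.filter fun x : Fin n => n - a ≤ (x : ℕ) := by
    refine Finset.eq_of_subset_of_card_le ?_ ?_
    · intro x hx
      obtain ⟨y, hy, rfl⟩ := Finset.mem_map.1 hx
      simpa using h y (by simpa using hy)
    · rw [Finset.card_map, card_fin_filter_lt ha, card_fin_filter_ge (Nat.sub_le n a)]
      omega
  have hmem : w k ∈ (Finset.univ.filter fun x : Fin n => (x : ℕ) < a).map w.toEmbedding := by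
    rw [himage]
    simpa using hwk
  obtain ⟨y, hy, hyk⟩ := Finset.mem_map.1 hmem
  rw [w.injective hyk] at hy
  simp at hy
  omega

/-- A permutation sending the first `dᵢ` elements to the last `dᵢ`, for all `i`, has at least
`Σᵢ (dᵢ − dᵢ₋₁)(n − dᵢ)` inversions. -/
lemma sum_le_invCount {n m : ℕ} {d : Fin (m + 1) → ℕ} (hmono : Monotone d)
    (hdn : d (Fin.last m) ≤ n) (w : Equiv.Perm (Fin n))
    (h : ∀ (i : Fin m) (k : Fin n), (k : ℕ) < d i.succ → n - d i.succ ≤ (w k : ℕ)) :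
    ∑ i : Fin m, (d i.succ - d i.castSucc) * (n - d i.succ) ≤ invCount n w := by
  have hd (i : Fin m) : d i.succ ≤ n := (hmono (Fin.le_last _)).trans hdn
  let T : Fin m → Finset (Fin n × Fin n) := fun i =>
    (Finset.univ.filter fun x : Fin n => d i.castSucc ≤ (x : ℕ) ∧ (x : ℕ) < d i.succ) ×ˢ
      (Finset.univ.filter fun x : Fin n => d i.succ ≤ (x : ℕ))
  have hT (i : Fin m) : (T i).card = (d i.succ - d i.castSucc) * (n - d i.succ) := by
    rw [Finset.card_product, card_fin_filter_Ico (hd i), card_fin_filter_ge (hd i)]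
  have hlt {i j : Fin m} (hij : i < j) : Disjoint (T i) (T j) := by
    have hle : d i.succ ≤ d j.castSucc := hmono (Fin.succ_le_castSucc_iff.2 hij)
    refine Finset.disjoint_left.2 fun x hi hj => ?_
    simp only [T, Finset.mem_product, Finset.mem_filter, Finset.mem_univ, true_and] at hi hj
    omega
  rw [← Finset.sum_congr rfl fun i _ => hT i, ← Finset.card_biUnion fun i _ j _ hij =>
    hij.lt_or_gt.elim hlt fun hji => (hlt hji).symm]
  refine Finset.card_le_card fun x hx => ?_
  obtain ⟨i, -, hi⟩ := Finset.mem_biUnion.1 hx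
  simp only [T, Finset.mem_product, Finset.mem_filter, Finset.mem_univ, true_and] at hi
  have h1 := h i x.1 hi.1.2
  have h2 := perm_apply_lt_of_le (hd i) w (h i) x.2 hi.2
  simp only [Finset.mem_filter, Finset.mem_univ, true_and, Fin.lt_def]
  omega

/-- Lemma 2.3: for dimensions `0 = d₀ < d₁ < ⋯ < d_m < n` and a permutation `w` with
descent set contained in `{d₁,…,d_m}` which is not the longest such permutation
(`ℓ(w) < Σᵢ (dᵢ − dᵢ₋₁)(n − dᵢ)`, the dimension of the flag manifold), the intersection
`⋂_{s ∈ ℂ} X_w F_•(s)` is empty: every partial flag of type `d` fails the Schubert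
condition for `F_•(s)` for some `s ∈ ℂ`. -/
theorem stmt_17 (n m : ℕ) (d : Fin (m + 1) → ℕ) (hd0 : d 0 = 0)
    (hmono : StrictMono d) (hdn : d (Fin.last m) < n)
    (w : Equiv.Perm (Fin n))
    (hdesc : ∀ (q : ℕ) (hq : q + 1 < n),
      ((w ⟨q + 1, hq⟩ : Fin n) : ℕ) < ((w ⟨q, Nat.lt_of_succ_lt hq⟩ : Fin n) : ℕ) →
        ∃ i : Fin m, d i.succ = q + 1)
    (hlen : invCount n w < ∑ i : Fin m, (d i.succ - d i.castSucc) * (n - d i.succ))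
    (E : Fin m → Submodule ℂ (Fin n → ℂ))
    (hEmono : Monotone E) (hEdim : ∀ i, Module.finrank ℂ (E i) = d i.succ) :
    ∃ s : ℂ, ∃ (i : Fin m) (j : ℕ), j ≤ n ∧
      Module.finrank ℂ ↥(E i ⊓ oscF n j s) < schubNum n w (d i.succ) j := by
  obtain ⟨i, k, hk, hwk⟩ : ∃ (i : Fin m) (k : Fin n), (k : ℕ) < d i.succ ∧
      (w k : ℕ) < n - d i.succ := by
    by_contra! h
    exact hlen.not_ge (sum_le_invCount hmono.monotone hdn.le w h)
  obtain ⟨s, hs⟩ := exists_inf_oscF_eq_bot (k := n - d i.succ) (E i) (by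
    rw [hEdim]
    omega)
  refine ⟨s, i, n - d i.succ, Nat.sub_le _ _, ?_⟩
  rw [hs, finrank_bot]
  exact Finset.card_pos.2 ⟨k, by simp [hk, hwk]⟩
end
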